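/- arXiv:1002.3018 — 2 statements merged into one kernel-verified Lean document; each statement's English description precedes it below -/
import Mathlib

section
/- Suppose d_max = max_j d_j ≥ 1 and Δ = o(E) as n → ∞, where d_max = max_j d_j, x_max = max_j x_j and Δ = d_max(d_max + x_max). Then G(d,X) = ((2E)! / (E! · 2^E · ∏_{j=1}^n d_j!)) · exp( −(Σ_{j=1}^n d_j(d_j−1))/(4E) − (Σ_{j=1}^n d_j(d_j−1))²/(16E²) − (Σ_{jk∈X} d_j d_k)/(2E) + O(Δ²/E) ). -/
open Filter Finset Asymptotics MeasureTheory
open scoped Classical Topology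

noncomputable section

/-- The number of simple graphs on `Fin n` with degree sequence `d` having
no edge in common with the graph `X`. -/
def gCount {n : ℕ} (d : Fin n → ℕ) (X : SimpleGraph (Fin n)) : ℕ :=
  Nat.card {H : SimpleGraph (Fin n) //
    (∀ v, Nat.card (H.neighborSet v) = d v) ∧ Disjoint H.edgeSet X.edgeSet}

/-- The degree `x_j` of vertex `j` in the graph `X`. -/
def xDeg {n : ℕ} (X : SimpleGraph (Fin n)) (j : Fin n) : ℕ :=
  Nat.card (X.neighborSet j)

/-- The number of edges of `X`. -/
def xEdges {n : ℕ} (X : SimpleGraph (Fin n)) : ℕ := Nat.card X.edgeSet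

/-- The average degree `d̄ = 2E/n`. -/
def dBar {n : ℕ} (d : Fin n → ℕ) : ℝ := (∑ j, (d j : ℝ)) / n

/-- The density `λ = d̄/(n-1)`. -/
def lamb {n : ℕ} (d : Fin n → ℕ) : ℝ := dBar d / ((n : ℝ) - 1)

/-- `A = λ(1-λ)/2`. -/
def aPar {n : ℕ} (d : Fin n → ℕ) : ℝ := lamb d * (1 - lamb d) / 2

/-- `δ_j = d_j - d̄ + λ x_j`. -/
def deltaPar {n : ℕ} (d : Fin n → ℕ) (X : SimpleGraph (Fin n)) (j : Fin n) : ℝ :=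
  (d j : ℝ) - dBar d + lamb d * (xDeg X j : ℝ)

/-- The sum over unordered pairs `{j,k}` with `X.Adj j k` of `f j * f k`. -/
def pairSum {n : ℕ} (X : SimpleGraph (Fin n)) (f : Fin n → ℝ) : ℝ :=
  (∑ j, ∑ k, if X.Adj j k then f j * f k else 0) / 2

/-- `R = Σ_j (d_j - d̄)²`. -/
def rPar {n : ℕ} (d : Fin n → ℕ) : ℝ := ∑ j, ((d j : ℝ) - dBar d)^2

/-- The naive estimate `Ĝ(d,X)`. -/
def gHat {n : ℕ} (d : Fin n → ℕ) (X : SimpleGraph (Fin n)) : ℝ :=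
  (1 - lamb d) ^ (-(xEdges X : ℝ)) *
  (lamb d ^ lamb d * (1 - lamb d) ^ (1 - lamb d)) ^ n.choose 2 *
  ∏ j, ((n - 1 - xDeg X j).choose (d j) : ℝ)

/-- `E = (1/2) Σ_j d_j` (exact when the sum is even). -/
def eN {n : ℕ} (d : Fin n → ℕ) : ℕ := (∑ j, d j) / 2

/-- `d_max = max_j d_j`. -/
def dMax {n : ℕ} (d : Fin n → ℕ) : ℕ := Finset.univ.sup d

/-- `Δ = d_max (d_max + x_max)`. -/
def bigDelta {n : ℕ} (d : Fin n → ℕ) (X : SimpleGraph (Fin n)) : ℕ :=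
  dMax d * (dMax d + dMax (xDeg X))

open scoped symmDiff

section Switching

variable {V : Type*} [Fintype V] [DecidableEq V]

/-- The degree of `v` in `H`. -/
def gdeg (H : SimpleGraph V) (v : V) : ℕ := #{u | H.Adj v u}

/-- Membership of an unordered pair in a set of pairs. -/
def InPairs (L : Finset (V × V)) (a b : V) : Prop := (a, b) ∈ L ∨ (b, a) ∈ L

/-- The simple graphs with degrees `d` that avoid all pairs in `X` and contain all pairs in `L`. -/
def fam (d : V → ℕ) (X L : Finset (V × V)) : Finset (SimpleGraph V) :=
  {H | (∀ v, gdeg H v = d v) ∧ (∀ a b, InPairs X a b → ¬ H.Adj a b) ∧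
    ∀ a b, InPairs L a b → H.Adj a b}

/-- The number of elements of `fam`, as a real number. -/
def famCard (d : V → ℕ) (X L : Finset (V × V)) : ℝ := (#(fam d X L) : ℝ)

/-- The 4-cycle with edges `jk`, `ab`, `ja`, `kb`. -/
def quad (j k a b : V) : SimpleGraph V :=
  SimpleGraph.edge j k ⊔ SimpleGraph.edge a b ⊔ SimpleGraph.edge j a ⊔ SimpleGraph.edge k b

omit [Fintype V] [DecidableEq V] in
lemma symmDiff_graph_adj (H C : SimpleGraph V) (u v : V) :
    (H ∆ C).Adj u v ↔ (H.Adj u v ∧ ¬ C.Adj u v) ∨ (C.Adj u v ∧ ¬ H.Adj u v) := by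
  simp [symmDiff_def]

omit [DecidableEq V] in
lemma gdeg_eq_of_iff {H H' : SimpleGraph V} {v : V} (h : ∀ u, H'.Adj v u ↔ H.Adj v u) :
    gdeg H' v = gdeg H v := by
  simp [gdeg, h]

lemma gdeg_eq_of_swap {H H' : SimpleGraph V} {v p q : V} (hp : H.Adj v p) (hq : ¬ H.Adj v q)
    (h : ∀ u, H'.Adj v u ↔ (H.Adj v u ∧ u ≠ p) ∨ u = q) : gdeg H' v = gdeg H v := by
  have : ({u | H'.Adj v u} : Finset V) = insert q (({u | H.Adj v u} : Finset V).erase p) := by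
    ext u; simp only [mem_filter, mem_univ, true_and, h, mem_insert, mem_erase]; tauto
  unfold gdeg
  rw [this, card_insert_of_notMem (by simp [hq]), card_erase_add_one (by simpa using hp)]

omit [Fintype V] in
lemma quad_adj (j k a b u v : V) : (quad j k a b).Adj u v ↔ u ≠ v ∧
    ((u = j ∧ v = k) ∨ (u = k ∧ v = j) ∨ (u = a ∧ v = b) ∨ (u = b ∧ v = a) ∨
     (u = j ∧ v = a) ∨ (u = a ∧ v = j) ∨ (u = k ∧ v = b) ∨ (u = b ∧ v = k)) := by
  simp only [quad, SimpleGraph.sup_adj, SimpleGraph.edge_adj]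
  tauto

lemma gdeg_symmDiff_quad {H : SimpleGraph V} {j k a b : V} (hjk : H.Adj j k) (hab : H.Adj a b)
    (hja : ¬ H.Adj j a) (hkb : ¬ H.Adj k b) (hja' : j ≠ a) (hkb' : k ≠ b) (v : V) :
    gdeg (H ∆ quad j k a b) v = gdeg H v := by
  have hjk' := hjk.ne
  have hab' := hab.ne
  have hka : k ≠ a := by rintro rfl; exact hja hjk
  have hjb : j ≠ b := by rintro rfl; exact hkb hjk.symm
  have hkj := hjk.symm
  have hba := hab.symm
  have haj : ¬ H.Adj a j := fun h => hja h.symm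
  have hbk : ¬ H.Adj b k := fun h => hkb h.symm
  by_cases h1 : v = j
  · subst h1
    refine gdeg_eq_of_swap hjk hja fun u => ?_
    rw [symmDiff_graph_adj, quad_adj]
    grind
  by_cases h2 : v = k
  · subst h2
    refine gdeg_eq_of_swap hkj hkb fun u => ?_
    rw [symmDiff_graph_adj, quad_adj]
    grind
  by_cases h3 : v = a
  · subst h3
    refine gdeg_eq_of_swap hab haj fun u => ?_
    rw [symmDiff_graph_adj, quad_adj]
    grind
  by_cases h4 : v = b
  · subst h4
    refine gdeg_eq_of_swap hba hbk fun u => ?_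
    rw [symmDiff_graph_adj, quad_adj]
    grind
  refine gdeg_eq_of_iff fun u => ?_
  rw [symmDiff_graph_adj, quad_adj]
  grind

lemma mem_fam {d : V → ℕ} {X L : Finset (V × V)} {H : SimpleGraph V} :
    H ∈ fam d X L ↔ (∀ v, gdeg H v = d v) ∧ (∀ a b, InPairs X a b → ¬ H.Adj a b) ∧
    ∀ a b, InPairs L a b → H.Adj a b := by
  simp [fam]

omit [Fintype V] [DecidableEq V] in
lemma InPairs.symm {L : Finset (V × V)} {a b : V} (h : InPairs L a b) : InPairs L b a := Or.symm h

omit [Fintype V] in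
lemma inPairs_insert {L : Finset (V × V)} {a b j k : V} :
    InPairs (insert (j, k) L) a b ↔ (a = j ∧ b = k) ∨ (a = k ∧ b = j) ∨ InPairs L a b := by
  simp only [InPairs, mem_insert, Prod.mk.injEq]
  tauto

lemma mem_fam_insert {d : V → ℕ} {X L : Finset (V × V)} {H : SimpleGraph V} {j k : V} :
    H ∈ fam d X (insert (j, k) L) ↔ H ∈ fam d X L ∧ H.Adj j k := by
  simp only [mem_fam, inPairs_insert]
  constructor
  · rintro ⟨h1, h2, h3⟩
    exact ⟨⟨h1, h2, fun a b h => h3 a b (by tauto)⟩, h3 j k (by tauto)⟩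
  · rintro ⟨⟨h1, h2, h3⟩, h4⟩
    refine ⟨h1, h2, fun a b h => ?_⟩
    rcases h with ⟨rfl, rfl⟩ | ⟨rfl, rfl⟩ | h
    exacts [h4, h4.symm, h3 a b h]

/-- The pairs along which an edge `jk` of `H` can be switched away. -/
def switchable (H : SimpleGraph V) (X L : Finset (V × V)) (j k : V) : Finset (V × V) :=
  {p | H.Adj p.1 p.2 ∧ ¬ InPairs L p.1 p.2 ∧ j ≠ p.1 ∧ k ≠ p.2 ∧ ¬ H.Adj j p.1 ∧ ¬ H.Adj k p.2 ∧
    ¬ InPairs X j p.1 ∧ ¬ InPairs X k p.2}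

/-- The neighbours of `j` in `H` along edges outside `L`. -/
def freeNbr (H : SimpleGraph V) (L : Finset (V × V)) (j : V) : Finset V :=
  {a | H.Adj j a ∧ ¬ InPairs L j a}

/-- The degree of `j` in the graph with edge set `L`. -/
def pairDeg (L : Finset (V × V)) (j : V) : ℕ := #{a | InPairs L j a}

omit [DecidableEq V] in
lemma card_freeNbr {H : SimpleGraph V} {L : Finset (V × V)} (hL : ∀ a b, InPairs L a b → H.Adj a b)
    (j : V) : #(freeNbr H L j) = gdeg H j - pairDeg L j := by
  unfold freeNbr gdeg pairDeg
  rw [← card_sdiff_of_subset]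
  · congr 1; ext; simp
  · intro a; simpa using hL j a

lemma symmDiff_quad_mem_fam {d : V → ℕ} {X L : Finset (V × V)} {H : SimpleGraph V} {j k a b : V}
    (hH : H ∈ fam d X L) (hjk : H.Adj j k) (hab : H.Adj a b)
    (hja : ¬ H.Adj j a) (hkb : ¬ H.Adj k b) (hja' : j ≠ a) (hkb' : k ≠ b)
    (hjkL : ¬ InPairs L j k) (habL : ¬ InPairs L a b)
    (hjaX : ¬ InPairs X j a) (hkbX : ¬ InPairs X k b) :
    H ∆ quad j k a b ∈ fam d X L := by
  rw [mem_fam] at hH ⊢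
  obtain ⟨h1, h2, h3⟩ := hH
  refine ⟨fun v => by rw [gdeg_symmDiff_quad hjk hab hja hkb hja' hkb', h1], ?_, ?_⟩
  · intro u v huv
    have huv' := huv.symm
    have := h2 u v huv
    rw [symmDiff_graph_adj, quad_adj]
    have e1 := h2 j k
    have e2 := h2 a b
    rintro (h | ⟨⟨-, h⟩, -⟩)
    · tauto
    · rcases h with ⟨rfl, rfl⟩ | ⟨rfl, rfl⟩ | ⟨rfl, rfl⟩ | ⟨rfl, rfl⟩ | ⟨rfl, rfl⟩ | ⟨rfl, rfl⟩ |
        ⟨rfl, rfl⟩ | ⟨rfl, rfl⟩ <;> tauto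
  · intro u v huv
    have huv' := huv.symm
    have := h3 u v huv
    have e1 := h3 j a
    have e2 := h3 k b
    rw [symmDiff_graph_adj, quad_adj]
    left
    refine ⟨this, ?_⟩
    rintro ⟨-, h⟩
    rcases h with ⟨rfl, rfl⟩ | ⟨rfl, rfl⟩ | ⟨rfl, rfl⟩ | ⟨rfl, rfl⟩ | ⟨rfl, rfl⟩ | ⟨rfl, rfl⟩ |
        ⟨rfl, rfl⟩ | ⟨rfl, rfl⟩ <;> tauto

lemma sum_switchable_le (d : V → ℕ) (X L : Finset (V × V)) {j k : V} (hjkL : ¬ InPairs L j k) :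
    ∑ H ∈ fam d X (insert (j, k) L), #(switchable H X L j k) ≤
      ∑ H ∈ fam d X L, #(freeNbr H L j ×ˢ freeNbr H L k) := by
  rw [← card_sigma, ← card_sigma]
  refine card_le_card_of_injOn (fun q => ⟨q.1 ∆ quad j k q.2.1 q.2.2, q.2⟩) ?_ ?_
  · rintro ⟨H, a, b⟩ h
    simp only [coe_sigma, Set.mem_sigma_iff, mem_coe, mem_fam_insert, switchable, mem_filter,
      mem_univ, true_and, mem_product, freeNbr] at h ⊢
    obtain ⟨⟨hH, hjk⟩, hab, habL, hja', hkb', hja, hkb, hjaX, hkbX⟩ := h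
    refine ⟨symmDiff_quad_mem_fam hH hjk hab hja hkb hja' hkb' hjkL habL hjaX hkbX, ?_⟩
    rw [mem_fam] at hH
    simp only [symmDiff_graph_adj, quad_adj]
    refine ⟨⟨Or.inr ⟨⟨hja', by tauto⟩, hja⟩, fun h => hja (hH.2.2 _ _ h)⟩,
      ⟨Or.inr ⟨⟨hkb', by tauto⟩, hkb⟩, fun h => hkb (hH.2.2 _ _ h)⟩⟩
  · rintro ⟨H, p⟩ - ⟨H', p'⟩ - h
    simp only [Sigma.mk.injEq, heq_eq_eq] at h
    obtain ⟨h, rfl⟩ := h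
    rw [symmDiff_left_inj.mp h]

/-- The pairs along which a non-edge `jk` of `H` can be switched into an edge. -/
def reverseSwitchable (H : SimpleGraph V) (X L : Finset (V × V)) (j k : V) : Finset (V × V) :=
  {p ∈ freeNbr H L j ×ˢ freeNbr H L k | p.1 ≠ p.2 ∧ ¬ H.Adj p.1 p.2 ∧ ¬ InPairs X p.1 p.2}

lemma sum_reverseSwitchable_le (d : V → ℕ) (X L : Finset (V × V)) {j k : V} (hjk' : j ≠ k)
    (hjkX : ¬ InPairs X j k) :
    ∑ H ∈ fam d X L with ¬ H.Adj j k, #(reverseSwitchable H X L j k) ≤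
      ∑ H ∈ fam d X (insert (j, k) L), #({p | H.Adj p.1 p.2} : Finset (V × V)) := by
  rw [← card_sigma, ← card_sigma]
  refine card_le_card_of_injOn (fun q => ⟨q.1 ∆ quad j q.2.1 k q.2.2, q.2⟩) ?_ ?_
  · rintro ⟨H, a, b⟩ h
    simp only [coe_sigma, Set.mem_sigma_iff, mem_coe, mem_fam_insert, reverseSwitchable, mem_filter,
      mem_univ, true_and, mem_product, freeNbr] at h ⊢
    obtain ⟨⟨hH, hjk⟩, ⟨⟨hja, hjaL⟩, hkb, hkbL⟩, hne, hab, habX⟩ := h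
    refine ⟨⟨symmDiff_quad_mem_fam hH hja hkb hjk hab hjk' hne hjaL hkbL hjkX habX, ?_⟩, ?_⟩
    · rw [symmDiff_graph_adj, quad_adj]
      exact Or.inr ⟨⟨hjk', by simp⟩, hjk⟩
    · rw [symmDiff_graph_adj, quad_adj]
      exact Or.inr ⟨⟨hne, by simp⟩, hab⟩
  · rintro ⟨H, p⟩ - ⟨H', p'⟩ - h
    simp only [Sigma.mk.injEq, heq_eq_eq] at h
    obtain ⟨h, rfl⟩ := h
    rw [symmDiff_left_inj.mp h]

end Switching

section Counting

variable {V : Type*} [Fintype V] [DecidableEq V]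

/-- The maximum degrees are small compared with the total degree. -/
structure Sparse (d : V → ℕ) (X : Finset (V × V)) (M x : ℕ) : Prop where
  one_le : 1 ≤ M
  deg_le : ∀ v, d v ≤ M
  pairDeg_le : ∀ v, pairDeg X v ≤ x
  large : 1000 * (M * (M + x)) ≤ ∑ v, d v

omit [DecidableEq V] in
lemma card_filter_prod (P : V → V → Prop) :
    #({p | P p.1 p.2} : Finset (V × V)) = ∑ a, #({b | P a b} : Finset V) := by
  simp only [card_filter, ← univ_product_univ, sum_product]

lemma card_adj_pairs {d : V → ℕ} {X L : Finset (V × V)} {H : SimpleGraph V} (hH : H ∈ fam d X L) :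
    #({p | H.Adj p.1 p.2} : Finset (V × V)) = ∑ v, d v := by
  rw [card_filter_prod]
  exact sum_congr rfl fun v _ => (mem_fam.mp hH).1 v

lemma card_inPairs_le (L : Finset (V × V)) :
    #({p | InPairs L p.1 p.2} : Finset (V × V)) ≤ 2 * #L := by
  have : ({p | InPairs L p.1 p.2} : Finset (V × V)) ⊆ L ∪ L.image Prod.swap := by
    rintro ⟨a, b⟩ h
    simp only [mem_filter, mem_univ, true_and] at h
    simp only [mem_union, mem_image, Prod.exists, Prod.swap_prod_mk, Prod.mk.injEq]
    rcases h with h | h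
    · exact Or.inl h
    · exact Or.inr ⟨b, a, h, rfl, rfl⟩
  refine (card_le_card this).trans ((card_union_le _ _).trans ?_)
  have := card_image_le (s := L) (f := Prod.swap)
  omega

lemma card_fst_mem_adj_le {d : V → ℕ} {X L : Finset (V × V)} {H : SimpleGraph V} {M : ℕ}
    (hH : H ∈ fam d X L) (hM : ∀ v, d v ≤ M) (B : Finset V) :
    #({p | p.1 ∈ B ∧ H.Adj p.1 p.2} : Finset (V × V)) ≤ #B * M := by
  have h0 : #({p | p.1 ∈ B ∧ H.Adj p.1 p.2} : Finset (V × V)) =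
      ∑ a, #({b | a ∈ B ∧ H.Adj a b} : Finset V) := by
    simp only [card_filter, ← univ_product_univ, sum_product]
  rw [h0, ← smul_eq_mul, ← sum_const, ← sum_filter_add_sum_filter_not univ (· ∈ B)]
  have : ∑ a with a ∉ B, #({b | a ∈ B ∧ H.Adj a b} : Finset V) = 0 := by
    refine sum_eq_zero fun a ha => ?_
    simp only [mem_filter, mem_univ, true_and] at ha
    simp [ha]
  rw [this, add_zero, filter_univ_mem]
  refine sum_le_sum fun a ha => ?_
  refine le_trans (card_le_card ?_) (((mem_fam.mp hH).1 a).le.trans (hM a))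
  intro b; simp

lemma total_le_card_switchable {d : V → ℕ} {X L : Finset (V × V)} {H : SimpleGraph V} {M x : ℕ}
    (hs : Sparse d X M x) (hH : H ∈ fam d X L) (j k : V) :
    ∑ v, d v ≤ #(switchable H X L j k) + 2 * #L + 4 * (M * (M + x)) := by
  set B : V → Finset V := fun j => insert j (({a | H.Adj j a} : Finset V) ∪ ({a | InPairs X j a} : Finset V))
    with hBdef
  have hB : ∀ j, #(B j) ≤ 1 + M + x := fun j => by
    have h1 : #({a | H.Adj j a} : Finset V) ≤ M := ((mem_fam.mp hH).1 j).le.trans (hs.deg_le j)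
    have h2 : #({a | InPairs X j a} : Finset V) ≤ x := hs.pairDeg_le j
    have h3 := card_insert_le j (({a | H.Adj j a} : Finset V) ∪ ({a | InPairs X j a} : Finset V))
    have h4 := card_union_le ({a | H.Adj j a} : Finset V) {a | InPairs X j a}
    simp only [hBdef]; omega
  have hBM : ∀ j, #(B j) * M ≤ 2 * (M * (M + x)) := fun j => by
    have := hs.one_le
    nlinarith [hB j, Nat.mul_le_mul_right M (hB j)]
  have hsub : ({p | H.Adj p.1 p.2} : Finset (V × V)) ⊆
      ((switchable H X L j k ∪ ({p | InPairs L p.1 p.2} : Finset (V × V))) ∪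
        ({p | p.1 ∈ B j ∧ H.Adj p.1 p.2} : Finset (V × V))) ∪
        ({p | p.1 ∈ B k ∧ H.Adj p.1 p.2} : Finset (V × V)).image Prod.swap := by
    rintro ⟨a, b⟩ h
    simp only [mem_filter, mem_univ, true_and] at h
    simp only [mem_union, mem_filter, mem_univ, true_and, mem_image, Prod.exists,
      Prod.swap_prod_mk, Prod.mk.injEq, switchable]
    by_cases h1 : InPairs L a b
    · exact Or.inl (Or.inl (Or.inr h1))
    by_cases h2 : a ∈ B j
    · exact Or.inl (Or.inr ⟨h2, h⟩)
    by_cases h3 : b ∈ B k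
    · exact Or.inr ⟨b, a, ⟨h3, h.symm⟩, rfl, rfl⟩
    simp only [hBdef, mem_insert, mem_union, mem_filter, mem_univ, true_and, not_or] at h2 h3
    exact Or.inl (Or.inl (Or.inl ⟨h, h1, Ne.symm h2.1, Ne.symm h3.1, h2.2.1, h3.2.1, h2.2.2,
      h3.2.2⟩))
  have h0 := card_le_card hsub
  rw [card_adj_pairs hH] at h0
  have h1 := card_union_le ((switchable H X L j k ∪ ({p | InPairs L p.1 p.2} : Finset (V × V))) ∪
        ({p | p.1 ∈ B j ∧ H.Adj p.1 p.2} : Finset (V × V)))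
        (({p | p.1 ∈ B k ∧ H.Adj p.1 p.2} : Finset (V × V)).image Prod.swap)
  have h2 := card_union_le (switchable H X L j k ∪ ({p | InPairs L p.1 p.2} : Finset (V × V)))
        ({p | p.1 ∈ B j ∧ H.Adj p.1 p.2} : Finset (V × V))
  have h3 := card_union_le (switchable H X L j k) ({p | InPairs L p.1 p.2} : Finset (V × V))
  have h4 := card_inPairs_le L
  have h5 := card_fst_mem_adj_le hH hs.deg_le (B j)
  have h6 := card_fst_mem_adj_le hH hs.deg_le (B k)
  have h7 := card_image_le (s := ({p | p.1 ∈ B k ∧ H.Adj p.1 p.2} : Finset (V × V)))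
    (f := Prod.swap)
  have h8 := hBM j
  have h9 := hBM k
  omega

lemma card_freeNbr_prod {d : V → ℕ} {X L : Finset (V × V)} {H : SimpleGraph V}
    (hH : H ∈ fam d X L) (j k : V) :
    #(freeNbr H L j ×ˢ freeNbr H L k) = (d j - pairDeg L j) * (d k - pairDeg L k) := by
  obtain ⟨h1, -, h3⟩ := mem_fam.mp hH
  rw [card_product, card_freeNbr h3, card_freeNbr h3, h1, h1]

lemma famCard_nonneg (d : V → ℕ) (X L : Finset (V × V)) : 0 ≤ famCard d X L := Nat.cast_nonneg _

lemma mul_famCard_insert_le {d : V → ℕ} {X L : Finset (V × V)} {M x : ℕ}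
    (hs : Sparse d X M x) {j k : V} (hjkL : ¬ InPairs L j k) :
    ((∑ v, d v : ℕ) - 2 * #L - 4 * (M * (M + x)) : ℝ) * famCard d X (insert (j, k) L) ≤
      famCard d X L * (((d j - pairDeg L j : ℕ) : ℝ) * ((d k - pairDeg L k : ℕ) : ℝ)) := by
  have h1 : ∑ H ∈ fam d X L, #(freeNbr H L j ×ˢ freeNbr H L k) =
      #(fam d X L) * ((d j - pairDeg L j) * (d k - pairDeg L k)) := by
    rw [sum_congr rfl fun H hH => card_freeNbr_prod hH j k, sum_const, smul_eq_mul]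
  have h2 : #(fam d X (insert (j, k) L)) * ∑ v, d v ≤
      ∑ H ∈ fam d X (insert (j, k) L), (#(switchable H X L j k) + 2 * #L + 4 * (M * (M + x))) := by
    rw [← smul_eq_mul, ← sum_const]
    exact sum_le_sum fun H hH => total_le_card_switchable hs (mem_fam_insert.mp hH).1 j k
  simp only [sum_add_distrib, sum_const, smul_eq_mul] at h2
  have h3 := sum_switchable_le d X L hjkL
  rw [h1] at h3
  have h4 : #(fam d X (insert (j, k) L)) * ∑ v, d v ≤
      #(fam d X L) * ((d j - pairDeg L j) * (d k - pairDeg L k)) +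
        #(fam d X (insert (j, k) L)) * (2 * #L) +
        #(fam d X (insert (j, k) L)) * (4 * (M * (M + x))) := by linarith
  have h5 : ((#(fam d X (insert (j, k) L)) * ∑ v, d v : ℕ) : ℝ) ≤
      ((#(fam d X L) * ((d j - pairDeg L j) * (d k - pairDeg L k)) +
        #(fam d X (insert (j, k) L)) * (2 * #L) +
        #(fam d X (insert (j, k) L)) * (4 * (M * (M + x))) : ℕ) : ℝ) := by exact_mod_cast h4
  simp only [Nat.cast_mul, Nat.cast_add, Nat.cast_ofNat] at h5
  unfold famCard
  linarith

/-- The total degree as a real number. -/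
def tot (d : V → ℕ) : ℝ := ((∑ v, d v : ℕ) : ℝ)

omit [DecidableEq V] in
lemma Sparse.large_real {d : V → ℕ} {X : Finset (V × V)} {M x : ℕ} (hs : Sparse d X M x) :
    1000 * ((M : ℝ) * (M + x)) ≤ tot d := by
  unfold tot; exact_mod_cast hs.large

omit [DecidableEq V] in
lemma Sparse.sq_le {d : V → ℕ} {X : Finset (V × V)} {M x : ℕ} (_ : Sparse d X M x) :
    (M : ℝ) * M ≤ (M : ℝ) * (M + x) := by
  have : (0 : ℝ) ≤ x := Nat.cast_nonneg _
  have : (0 : ℝ) ≤ M := Nat.cast_nonneg _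
  nlinarith

omit [DecidableEq V] in
lemma Sparse.one_le_real {d : V → ℕ} {X : Finset (V × V)} {M x : ℕ} (hs : Sparse d X M x) :
    (1 : ℝ) ≤ M := by exact_mod_cast hs.one_le

omit [DecidableEq V] in
lemma Sparse.one_le_prod {d : V → ℕ} {X : Finset (V × V)} {M x : ℕ} (hs : Sparse d X M x) :
    (1 : ℝ) ≤ (M : ℝ) * (M + x) := by nlinarith [hs.sq_le, hs.one_le_real]

omit [DecidableEq V] in
lemma Sparse.tot_pos {d : V → ℕ} {X : Finset (V × V)} {M x : ℕ} (hs : Sparse d X M x) :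
    0 < tot d := by linarith [hs.large_real, hs.one_le_prod]

lemma famCard_insert_crude {d : V → ℕ} {X L : Finset (V × V)} {M x : ℕ}
    (hs : Sparse d X M x) (hL : #L ≤ 3) {j k : V} (hjkL : ¬ InPairs L j k) :
    tot d * famCard d X (insert (j, k) L) ≤ 2 * famCard d X L * ((d j : ℝ) * d k) := by
  have h1 := mul_famCard_insert_le hs hjkL
  have h2 : ((d j - pairDeg L j : ℕ) : ℝ) ≤ d j := by exact_mod_cast Nat.sub_le _ _
  have h3 : ((d k - pairDeg L k : ℕ) : ℝ) ≤ d k := by exact_mod_cast Nat.sub_le _ _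
  have h4 : (#L : ℝ) ≤ 3 := by exact_mod_cast hL
  have h5 := hs.large_real
  have h6 := hs.one_le_prod
  have h7 := famCard_nonneg d X L
  have h8 := famCard_nonneg d X (insert (j, k) L)
  have h9 : ((d j - pairDeg L j : ℕ) : ℝ) * ((d k - pairDeg L k : ℕ) : ℝ) ≤ (d j : ℝ) * d k := by
    gcongr
  have h10 := mul_le_mul_of_nonneg_left h9 h7
  change (tot d - 2 * #L - 4 * (M * (M + x)) : ℝ) * _ ≤ _ at h1
  nlinarith

end Counting

section EdgeProbability

variable {V : Type*} [Fintype V] [DecidableEq V]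

lemma card_two_edges_le {d : V → ℕ} {X L : Finset (V × V)} {M x : ℕ}
    (hs : Sparse d X M x) (hL : #L ≤ 1) {j k : V} (hjk : j ≠ k) (a b : V) :
    tot d ^ 2 * (#{H ∈ fam d X L | ¬ H.Adj j k ∧ a ∈ freeNbr H L j ∧ b ∈ freeNbr H L k} : ℝ) ≤
      4 * (famCard d X L * ((d j : ℝ) * d k)) * ((d a : ℝ) * d b) := by
  have hG := famCard_nonneg d X L
  have hN := hs.tot_pos
  rcases ({H ∈ fam d X L | ¬ H.Adj j k ∧ a ∈ freeNbr H L j ∧ b ∈ freeNbr H L k}).eq_empty_or_nonempty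
    with he | ⟨H, hH⟩
  · rw [he]; simp; positivity
  simp only [mem_filter, freeNbr, mem_univ, true_and] at hH
  obtain ⟨hH, hjk', ⟨hja, hjaL⟩, hkb, hkbL⟩ := hH
  have h1 := famCard_insert_crude hs (by omega) hjaL
  have hkbL' : ¬ InPairs (insert (j, a) L) k b := by
    rw [inPairs_insert]
    rintro (⟨rfl, -⟩ | ⟨rfl, rfl⟩ | h)
    exacts [hjk rfl, hjk' hja, hkbL h]
  have h2 := famCard_insert_crude hs (by have := card_insert_le (j, a) L; omega) hkbL'
  have h3 : (#{H ∈ fam d X L | ¬ H.Adj j k ∧ a ∈ freeNbr H L j ∧ b ∈ freeNbr H L k} : ℝ) ≤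
      famCard d X (insert (k, b) (insert (j, a) L)) := by
    unfold famCard
    norm_cast
    refine card_le_card fun H hH => ?_
    simp only [mem_filter, freeNbr, mem_univ, true_and] at hH
    rw [mem_fam_insert, mem_fam_insert]
    tauto
  calc _ ≤ tot d ^ 2 * famCard d X (insert (k, b) (insert (j, a) L)) := by gcongr
    _ = tot d * (tot d * famCard d X (insert (k, b) (insert (j, a) L))) := by ring
    _ ≤ tot d * (2 * famCard d X (insert (j, a) L) * (d k * d b)) := by gcongr
    _ = (tot d * famCard d X (insert (j, a) L)) * (2 * (d k * d b)) := by ring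
    _ ≤ (2 * famCard d X L * (d j * d a)) * (2 * (d k * d b)) := by gcongr
    _ = _ := by ring

lemma card_three_edges_le {d : V → ℕ} {X L : Finset (V × V)} {M x : ℕ}
    (hs : Sparse d X M x) (hL : #L ≤ 1) {j k : V} (hjk : j ≠ k) (a b : V) :
    tot d ^ 3 * (#{H ∈ fam d X L | ¬ H.Adj j k ∧ (a ∈ freeNbr H L j ∧ b ∈ freeNbr H L k) ∧
        H.Adj a b ∧ ¬ InPairs L a b} : ℝ) ≤
      8 * (famCard d X L * ((d j : ℝ) * d k)) * ((d a : ℝ) * d b) ^ 2 := by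
  have hG := famCard_nonneg d X L
  have hN := hs.tot_pos
  rcases ({H ∈ fam d X L | ¬ H.Adj j k ∧ (a ∈ freeNbr H L j ∧ b ∈ freeNbr H L k) ∧
        H.Adj a b ∧ ¬ InPairs L a b}).eq_empty_or_nonempty
    with he | ⟨H, hH⟩
  · rw [he]; simp; positivity
  simp only [mem_filter, freeNbr, mem_univ, true_and] at hH
  obtain ⟨hH, hjk', ⟨⟨hja, hjaL⟩, hkb, hkbL⟩, hab, habL⟩ := hH
  have h1 := famCard_insert_crude hs (by omega) hjaL
  have hkbL' : ¬ InPairs (insert (j, a) L) k b := by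
    rw [inPairs_insert]
    rintro (⟨rfl, -⟩ | ⟨rfl, rfl⟩ | h)
    exacts [hjk rfl, hjk' hja, hkbL h]
  have c1 := card_insert_le (j, a) L
  have c2 := card_insert_le (k, b) (insert (j, a) L)
  have h2 := famCard_insert_crude hs (by omega) hkbL'
  have habL' : ¬ InPairs (insert (k, b) (insert (j, a) L)) a b := by
    rw [inPairs_insert, inPairs_insert]
    rintro (⟨rfl, -⟩ | ⟨rfl, rfl⟩ | ⟨rfl, rfl⟩ | ⟨-, rfl⟩ | h)
    exacts [hjk' hja, hkb.ne rfl, hja.ne rfl, hjk' hkb.symm, habL h]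
  have h3 := famCard_insert_crude hs (by omega) habL'
  have h4 : (#{H ∈ fam d X L | ¬ H.Adj j k ∧ (a ∈ freeNbr H L j ∧ b ∈ freeNbr H L k) ∧
        H.Adj a b ∧ ¬ InPairs L a b} : ℝ) ≤
      famCard d X (insert (a, b) (insert (k, b) (insert (j, a) L))) := by
    unfold famCard
    norm_cast
    refine card_le_card fun H hH => ?_
    simp only [mem_filter, freeNbr, mem_univ, true_and] at hH
    rw [mem_fam_insert, mem_fam_insert, mem_fam_insert]
    tauto
  calc _ ≤ tot d ^ 3 * famCard d X (insert (a, b) (insert (k, b) (insert (j, a) L))) := by gcongr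
    _ = tot d ^ 2 * (tot d * famCard d X (insert (a, b) (insert (k, b) (insert (j, a) L)))) := by
      ring
    _ ≤ tot d ^ 2 * (2 * famCard d X (insert (k, b) (insert (j, a) L)) * (d a * d b)) := by gcongr
    _ = tot d * (tot d * famCard d X (insert (k, b) (insert (j, a) L))) * (2 * (d a * d b)) := by
      ring
    _ ≤ tot d * (2 * famCard d X (insert (j, a) L) * (d k * d b)) * (2 * (d a * d b)) := by gcongr
    _ = (tot d * famCard d X (insert (j, a) L)) * (2 * (d k * d b)) * (2 * (d a * d b)) := by ring
    _ ≤ (2 * famCard d X L * (d j * d a)) * (2 * (d k * d b)) * (2 * (d a * d b)) := by gcongr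
    _ = _ := by ring

omit [DecidableEq V] in
lemma tot_eq_sum (d : V → ℕ) : tot d = ∑ v, (d v : ℝ) := by simp [tot]

omit [DecidableEq V] in
lemma sum_sq_le {d : V → ℕ} {M : ℕ} (hM : ∀ v, d v ≤ M) :
    ∑ a, (d a : ℝ) * d a ≤ M * tot d := by
  rw [tot_eq_sum, mul_sum]
  refine sum_le_sum fun a _ => ?_
  have : (d a : ℝ) ≤ M := by exact_mod_cast hM a
  gcongr

omit [DecidableEq V] in
lemma sum_inPairs_le {d : V → ℕ} {X : Finset (V × V)} {M x : ℕ} (hM : ∀ v, d v ≤ M)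
    (hx : ∀ v, pairDeg X v ≤ x) :
    ∑ p : V × V with InPairs X p.1 p.2, (d p.1 : ℝ) * d p.2 ≤ x * M * tot d := by
  rw [tot_eq_sum, mul_sum, sum_filter, ← univ_product_univ, sum_product]
  refine sum_le_sum fun a _ => ?_
  dsimp only
  rw [← sum_filter]
  calc ∑ b with InPairs X a b, (d a : ℝ) * d b ≤ ∑ b with InPairs X a b, (d a : ℝ) * M :=
        sum_le_sum fun b _ => by
          have : (d b : ℝ) ≤ M := by exact_mod_cast hM b
          gcongr
    _ = pairDeg X a * (d a * M : ℝ) := by simp [pairDeg]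
    _ ≤ x * (d a * M : ℝ) := by
        have : (pairDeg X a : ℝ) ≤ x := by exact_mod_cast hx a
        gcongr
    _ = _ := by ring

lemma sum_inPairs_le_card {d : V → ℕ} {L : Finset (V × V)} {M : ℕ} (hM : ∀ v, d v ≤ M) :
    ∑ p : V × V with InPairs L p.1 p.2, (d p.1 : ℝ) * d p.2 ≤ 2 * #L * (M * M) := by
  calc ∑ p : V × V with InPairs L p.1 p.2, (d p.1 : ℝ) * d p.2
      ≤ ∑ p : V × V with InPairs L p.1 p.2, (M * M : ℝ) := sum_le_sum fun p _ => by
          have h1 : (d p.1 : ℝ) ≤ M := by exact_mod_cast hM _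
          have h2 : (d p.2 : ℝ) ≤ M := by exact_mod_cast hM _
          gcongr
    _ = (#({p | InPairs L p.1 p.2} : Finset (V × V)) : ℝ) * (M * M) := by simp
    _ ≤ _ := by
        have : (#({p | InPairs L p.1 p.2} : Finset (V × V)) : ℝ) ≤ 2 * #L := by
          exact_mod_cast card_inPairs_le L
        gcongr

/-- The pairs that are excluded as targets of a reverse switching irrespective of the graph. -/
def excluded (X L : Finset (V × V)) : Finset (V × V) :=
  (({p | p.1 = p.2} : Finset (V × V)) ∪ ({p | InPairs X p.1 p.2} : Finset (V × V))) ∪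
    ({p | InPairs L p.1 p.2} : Finset (V × V))

lemma sum_excluded_le {d : V → ℕ} {X L : Finset (V × V)} {M x : ℕ} (hs : Sparse d X M x)
    (hL : #L ≤ 1) :
    ∑ p ∈ excluded X L, (d p.1 : ℝ) * d p.2 ≤ 2 * ((M : ℝ) * (M + x)) * tot d := by
  have hu : ∀ s t : Finset (V × V), ∑ p ∈ s ∪ t, (d p.1 : ℝ) * d p.2 ≤
      ∑ p ∈ s, (d p.1 : ℝ) * d p.2 + ∑ p ∈ t, (d p.1 : ℝ) * d p.2 := fun s t => by
    rw [← sum_union_inter]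
    have : 0 ≤ ∑ p ∈ s ∩ t, (d p.1 : ℝ) * d p.2 := sum_nonneg fun _ _ => by positivity
    linarith
  have h1 := hu (({p | p.1 = p.2} : Finset (V × V)) ∪ ({p | InPairs X p.1 p.2} : Finset (V × V)))
    ({p | InPairs L p.1 p.2} : Finset (V × V))
  have h2 := hu {p | p.1 = p.2} ({p | InPairs X p.1 p.2} : Finset (V × V))
  have h3 : ∑ p : V × V with p.1 = p.2, (d p.1 : ℝ) * d p.2 ≤ M * tot d := by
    refine le_trans (le_of_eq ?_) (sum_sq_le hs.deg_le)
    rw [sum_filter, ← univ_product_univ, sum_product]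
    simp
  have h4 := sum_inPairs_le hs.deg_le hs.pairDeg_le
  have h5 := sum_inPairs_le_card (L := L) hs.deg_le
  have h6 : (#L : ℝ) ≤ 1 := by exact_mod_cast hL
  have h7 : (2 * #L * (M * M) : ℝ) ≤ 2 * 1 * (M * M) := by gcongr
  have h8 := hs.sq_le
  have h9 := hs.one_le_real
  have h10 := hs.large_real
  have h11 := hs.one_le_prod
  have h12 : (M : ℝ) * tot d ≤ M * M * tot d := by
    have := hs.tot_pos
    have : (M : ℝ) ≤ M * M := by nlinarith
    gcongr
  have h13 : 2 * ((M : ℝ) * (M + x)) ≤ (M : ℝ) * (M + x) * tot d := by nlinarith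
  unfold excluded
  nlinarith

lemma card_le_reverseSwitchable (H : SimpleGraph V) (X L : Finset (V × V)) (j k : V) :
    #(freeNbr H L j ×ˢ freeNbr H L k) ≤ #(reverseSwitchable H X L j k) +
      #{p ∈ excluded X L | p.1 ∈ freeNbr H L j ∧ p.2 ∈ freeNbr H L k} +
      #({p | (p.1 ∈ freeNbr H L j ∧ p.2 ∈ freeNbr H L k) ∧ H.Adj p.1 p.2 ∧ ¬ InPairs L p.1 p.2} :
        Finset (V × V)) := by
  refine le_trans (card_le_card ?_) ((card_union_le _ _).trans (Nat.add_le_add_right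
    (card_union_le _ _) _))
  rintro ⟨a, b⟩ h
  simp only [mem_product] at h
  simp only [mem_union, mem_filter, excluded, reverseSwitchable, mem_product, mem_univ, true_and]
  tauto

lemma sum_excluded_pairs_le {d : V → ℕ} {X L : Finset (V × V)} {M x : ℕ}
    (hs : Sparse d X M x) (hL : #L ≤ 1) {j k : V} (hjk : j ≠ k) :
    tot d ^ 2 *
      ∑ H ∈ fam d X L with ¬ H.Adj j k, (#{p ∈ excluded X L | p.1 ∈ freeNbr H L j ∧ p.2 ∈ freeNbr H L k} : ℝ) ≤
      4 * (famCard d X L * ((d j : ℝ) * d k)) * (2 * ((M : ℝ) * (M + x)) * tot d) := by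
  have h := sum_card_bipartiteAbove_eq_sum_card_bipartiteBelow (s := {H ∈ fam d X L | ¬ H.Adj j k}) (t := excluded X L)
    (fun H p => p.1 ∈ freeNbr H L j ∧ p.2 ∈ freeNbr H L k)
  simp only [bipartiteAbove, bipartiteBelow] at h
  have h' : ∑ H ∈ fam d X L with ¬ H.Adj j k, (#{p ∈ excluded X L | p.1 ∈ freeNbr H L j ∧ p.2 ∈ freeNbr H L k} : ℝ) =
      ∑ p ∈ excluded X L, (#{H ∈ {H ∈ fam d X L | ¬ H.Adj j k} | p.1 ∈ freeNbr H L j ∧ p.2 ∈ freeNbr H L k} : ℝ) := by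
    exact_mod_cast h
  rw [h', mul_sum]
  refine le_trans (sum_le_sum fun p _ => ?_)
    ((mul_sum _ _ _).symm.le.trans (mul_le_mul_of_nonneg_left (sum_excluded_le hs hL) ?_))
  · have := card_two_edges_le hs hL hjk p.1 p.2
    rw [filter_filter]
    exact this
  · have := famCard_nonneg d X L
    positivity

lemma sum_adjacent_pairs_le {d : V → ℕ} {X L : Finset (V × V)} {M x : ℕ}
    (hs : Sparse d X M x) (hL : #L ≤ 1) {j k : V} (hjk : j ≠ k) :
    tot d ^ 3 *
      ∑ H ∈ fam d X L with ¬ H.Adj j k, (#({p | (p.1 ∈ freeNbr H L j ∧ p.2 ∈ freeNbr H L k) ∧ H.Adj p.1 p.2 ∧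
        ¬ InPairs L p.1 p.2} : Finset (V × V)) : ℝ) ≤
      8 * (famCard d X L * ((d j : ℝ) * d k)) * (M * tot d) ^ 2 := by
  have h := sum_card_bipartiteAbove_eq_sum_card_bipartiteBelow (s := {H ∈ fam d X L | ¬ H.Adj j k})
    (t := (univ : Finset (V × V)))
    (fun H p => (p.1 ∈ freeNbr H L j ∧ p.2 ∈ freeNbr H L k) ∧ H.Adj p.1 p.2 ∧
      ¬ InPairs L p.1 p.2)
  simp only [bipartiteAbove, bipartiteBelow] at h
  have h' : ∑ H ∈ fam d X L with ¬ H.Adj j k, (#({p | (p.1 ∈ freeNbr H L j ∧ p.2 ∈ freeNbr H L k) ∧ H.Adj p.1 p.2 ∧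
      ¬ InPairs L p.1 p.2} : Finset (V × V)) : ℝ) =
      ∑ p : V × V, (#{H ∈ {H ∈ fam d X L | ¬ H.Adj j k} | (p.1 ∈ freeNbr H L j ∧ p.2 ∈ freeNbr H L k) ∧ H.Adj p.1 p.2 ∧
      ¬ InPairs L p.1 p.2} : ℝ) := by
    exact_mod_cast h
  have hsq : ∑ p : V × V, ((d p.1 : ℝ) * d p.2) ^ 2 ≤ (M * tot d) ^ 2 := by
    have e : ∑ p : V × V, ((d p.1 : ℝ) * d p.2) ^ 2 = (∑ a, (d a : ℝ) * d a) ^ 2 := by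
      rw [sq (∑ a, (d a : ℝ) * d a), sum_mul_sum, ← univ_product_univ, sum_product]
      exact sum_congr rfl fun a _ => sum_congr rfl fun b _ => by ring
    rw [e]
    have := sum_sq_le hs.deg_le
    have : 0 ≤ ∑ a, (d a : ℝ) * d a := sum_nonneg fun _ _ => by positivity
    gcongr
  rw [h', mul_sum]
  refine le_trans (sum_le_sum fun p _ => ?_)
    ((mul_sum _ _ _).symm.le.trans (mul_le_mul_of_nonneg_left hsq ?_))
  · have := card_three_edges_le hs hL hjk p.1 p.2
    rw [filter_filter]
    exact this
  · have := famCard_nonneg d X L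
    positivity

lemma famCard_insert_lower {d : V → ℕ} {X L : Finset (V × V)} {M x : ℕ}
    (hs : Sparse d X M x) (hL : #L ≤ 1) {j k : V} (hjk : j ≠ k) (hjkX : ¬ InPairs X j k)
    (hjkL : ¬ InPairs L j k) :
    famCard d X L * (((d j - pairDeg L j : ℕ) : ℝ) * ((d k - pairDeg L k : ℕ) : ℝ)) ≤
      tot d * famCard d X (insert (j, k) L) +
        20 * ((M * (M + x)) / tot d) * (famCard d X L * ((d j : ℝ) * d k)) := by
  set m : ℝ := ((d j - pairDeg L j : ℕ) : ℝ) * ((d k - pairDeg L k : ℕ) : ℝ) with hm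
  set G := famCard d X L with hGdef
  set A := famCard d X (insert (j, k) L) with hA
  set B : Finset (SimpleGraph V) := {H ∈ fam d X L | ¬ H.Adj j k} with hB
  have hN := hs.tot_pos
  have hsplit : G = A + #B := by
    have : ({H ∈ fam d X L | H.Adj j k} : Finset (SimpleGraph V)) = fam d X (insert (j, k) L) := by
      ext H; rw [mem_filter, mem_fam_insert]
    have h := card_filter_add_card_filter_not (s := fam d X L) (fun H => H.Adj j k)
    rw [this] at h
    simp only [hGdef, hA, famCard, hB]
    exact_mod_cast h.symm
  have hmain : (#B : ℝ) * m ≤ ∑ H ∈ B, (#(reverseSwitchable H X L j k) : ℝ) +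
      ∑ H ∈ B, (#{p ∈ excluded X L | p.1 ∈ freeNbr H L j ∧ p.2 ∈ freeNbr H L k} : ℝ) +
      ∑ H ∈ B, (#({p | (p.1 ∈ freeNbr H L j ∧ p.2 ∈ freeNbr H L k) ∧ H.Adj p.1 p.2 ∧
        ¬ InPairs L p.1 p.2} : Finset (V × V)) : ℝ) := by
    rw [← sum_add_distrib, ← sum_add_distrib, ← nsmul_eq_mul, ← sum_const]
    refine sum_le_sum fun H hH => ?_
    have h1 := card_freeNbr_prod (mem_filter.mp hH).1 j k
    have h2 := card_le_reverseSwitchable H X L j k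
    rw [h1] at h2
    rw [hm]
    exact_mod_cast h2
  have hrev : ∑ H ∈ B, (#(reverseSwitchable H X L j k) : ℝ) ≤ tot d * A := by
    have h := sum_reverseSwitchable_le d X L hjk hjkX
    rw [sum_congr rfl fun H hH => card_adj_pairs hH, sum_const, smul_eq_mul] at h
    rw [mul_comm]
    rw [hA]
    unfold tot famCard
    exact_mod_cast h
  have hbad1 := sum_excluded_pairs_le hs hL hjk
  have hbad2 := sum_adjacent_pairs_le hs hL hjk
  rw [← hB, ← hGdef] at hbad1 hbad2
  have hcrude := famCard_insert_crude hs (by omega) hjkL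
  rw [← hA, ← hGdef] at hcrude
  have hG0 : 0 ≤ G := famCard_nonneg d X L
  have hA0 : 0 ≤ A := famCard_nonneg _ _ _
  have hmM : m ≤ M * M := by
    have h1 : ((d j - pairDeg L j : ℕ) : ℝ) ≤ M := by
      exact_mod_cast (Nat.sub_le _ _).trans (hs.deg_le j)
    have h2 : ((d k - pairDeg L k : ℕ) : ℝ) ≤ M := by
      exact_mod_cast (Nat.sub_le _ _).trans (hs.deg_le k)
    rw [hm]; gcongr
  have hm0 : 0 ≤ m := by positivity
  have hMD := hs.sq_le
  set D : ℝ := (M : ℝ) * (M + x) with hD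
  set P : ℝ := G * ((d j : ℝ) * d k) with hP
  have hP0 : 0 ≤ P := by positivity
  have hM0 : (0 : ℝ) ≤ (M : ℝ) * M := by positivity
  set N := tot d
  set S1 := ∑ H ∈ B, (#{p ∈ excluded X L | p.1 ∈ freeNbr H L j ∧ p.2 ∈ freeNbr H L k} : ℝ)
  set S2 := ∑ H ∈ B, (#({p | (p.1 ∈ freeNbr H L j ∧ p.2 ∈ freeNbr H L k) ∧ H.Adj p.1 p.2 ∧
        ¬ InPairs L p.1 p.2} : Finset (V × V)) : ℝ)
  have e1 : S1 ≤ 8 * (D / N) * P := by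
    have : N ^ 2 * S1 ≤ N ^ 2 * (8 * (D / N) * P) := by
      refine hbad1.trans (le_of_eq ?_)
      field_simp; ring
    exact le_of_mul_le_mul_left this (by positivity)
  have e2 : S2 ≤ 8 * (D / N) * P := by
    have : N ^ 3 * S2 ≤ N ^ 3 * (8 * (D / N) * P) := by
      refine hbad2.trans ?_
      have : N ^ 3 * (8 * (D / N) * P) = 8 * P * D * N ^ 2 := by field_simp
      rw [this]
      have : 8 * P * (M * N) ^ 2 = 8 * P * (M * M) * N ^ 2 := by ring
      rw [this]
      gcongr
    exact le_of_mul_le_mul_left this (by positivity)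
  have e3 : A * m ≤ 2 * (D / N) * P := by
    have : N * (A * m) ≤ N * (2 * (D / N) * P) := by
      have : N * (2 * (D / N) * P) = (2 * P) * D := by field_simp
      rw [this]
      calc N * (A * m) = (N * A) * m := by ring
        _ ≤ (2 * G * (d j * d k)) * D := by
          gcongr
          exact hmM.trans hMD
        _ = _ := by rw [hP]; ring
    exact le_of_mul_le_mul_left this (by positivity)
  have hDN : 0 ≤ D / N * P := by
    have : 0 ≤ D := hM0.trans hMD
    positivity
  rw [hsplit, add_mul]
  linarith

/-- The proportion of graphs containing an additional edge `jk`. -/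
lemma famCard_insert_estimate {d : V → ℕ} {X L : Finset (V × V)} {M x : ℕ}
    (hs : Sparse d X M x) (hL : #L ≤ 1) {j k : V} (hjk : j ≠ k) (hjkX : ¬ InPairs X j k)
    (hjkL : ¬ InPairs L j k) :
    |tot d * famCard d X (insert (j, k) L) -
      famCard d X L * (((d j - pairDeg L j : ℕ) : ℝ) * ((d k - pairDeg L k : ℕ) : ℝ))| ≤
      20 * ((M * (M + x)) / tot d) * (famCard d X L * ((d j : ℝ) * d k)) := by
  have h1 := famCard_insert_lower hs hL hjk hjkX hjkL
  have h2 := mul_famCard_insert_le hs hjkL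
  change (tot d - 2 * #L - 4 * (M * (M + x)) : ℝ) * _ ≤ _ at h2
  have h3 := famCard_insert_crude hs (by omega) hjkL
  have h4 : (#L : ℝ) ≤ 1 := by exact_mod_cast hL
  have hN := hs.tot_pos
  have hD := hs.one_le_prod
  have hA0 := famCard_nonneg d X (insert (j, k) L)
  have hG0 := famCard_nonneg d X L
  rw [abs_le]
  refine ⟨by linarith, ?_⟩
  set A := famCard d X (insert (j, k) L)
  set G := famCard d X L
  set N := tot d
  set D : ℝ := (M : ℝ) * (M + x)
  have h5 : (2 * #L + 4 * D) * A ≤ 6 * D * A := by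
    gcongr; linarith
  have h6 : 6 * D * A ≤ 20 * (D / N) * (G * (d j * d k)) := by
    have h : 6 * (D / N) * (N * A) ≤ 6 * (D / N) * (2 * G * (d j * d k)) := by gcongr
    have e : 6 * (D / N) * (N * A) = 6 * D * A := by field_simp
    have : 0 ≤ (D / N) * (G * (d j * d k)) := by positivity
    rw [e] at h
    linarith
  linarith

end EdgeProbability

section Avoiding

variable {V : Type*} [Fintype V] [DecidableEq V]

lemma abs_log_one_sub_add_le {p : ℝ} (h1 : p ≤ 1 / 2) :
    |Real.log (1 - p) + p| ≤ 2 * p ^ 2 := by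
  have hp : 0 < 1 - p := by linarith
  have h2 := Real.log_le_sub_one_of_pos hp
  have h3 := Real.one_sub_inv_le_log_of_pos hp
  have h4 : (1 - p)⁻¹ ≤ 1 + p + 2 * p ^ 2 := by
    rw [inv_le_iff_one_le_mul₀ hp]
    nlinarith [mul_nonneg (sq_nonneg p) (by linarith : 0 ≤ 1 - 2 * p)]
  rw [abs_le]
  constructor <;> nlinarith [sq_nonneg p]

lemma fam_eq_zero_of_loop (d : V → ℕ) (X L : Finset (V × V)) (v : V) :
    famCard d X (insert (v, v) L) = 0 := by
  unfold famCard
  rw [Nat.cast_eq_zero, card_eq_zero, eq_empty_iff_forall_notMem]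
  intro H hH
  exact (mem_fam_insert.mp hH).2.ne rfl

lemma famCard_insert_avoid (d : V → ℕ) (X L : Finset (V × V)) (j k : V) :
    famCard d (insert (j, k) X) L + famCard d X (insert (j, k) L) = famCard d X L := by
  have h1 : ({H ∈ fam d X L | H.Adj j k} : Finset (SimpleGraph V)) = fam d X (insert (j, k) L) := by
    ext H; rw [mem_filter, mem_fam_insert]
  have h2 : ({H ∈ fam d X L | ¬ H.Adj j k} : Finset (SimpleGraph V)) =
      fam d (insert (j, k) X) L := by
    ext H
    simp only [mem_filter, mem_fam, inPairs_insert]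
    constructor
    · rintro ⟨⟨h1, h2, h3⟩, h4⟩
      refine ⟨h1, fun a b h => ?_, h3⟩
      rcases h with ⟨rfl, rfl⟩ | ⟨rfl, rfl⟩ | h
      exacts [h4, fun h => h4 h.symm, h2 a b h]
    · rintro ⟨h1, h2, h3⟩
      exact ⟨⟨h1, fun a b h => h2 a b (by tauto), h3⟩, h2 j k (by tauto)⟩
  have h := card_filter_add_card_filter_not (s := fam d X L) (fun H => H.Adj j k)
  rw [h1, h2] at h
  unfold famCard
  rw [add_comm]
  exact_mod_cast h

omit [DecidableEq V] in
lemma Sparse.mono {d : V → ℕ} {X Y : Finset (V × V)} {M x : ℕ} (hs : Sparse d X M x)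
    (hY : Y ⊆ X) : Sparse d Y M x where
  one_le := hs.one_le
  deg_le := hs.deg_le
  large := hs.large
  pairDeg_le v := by
    refine le_trans (card_le_card fun a => ?_) (hs.pairDeg_le v)
    simp only [mem_filter, mem_univ, true_and]
    exact Or.imp (fun h => hY h) fun h => hY h

omit [DecidableEq V] in
lemma Sparse.mul_le {d : V → ℕ} {X : Finset (V × V)} {M x : ℕ} (hs : Sparse d X M x) (j k : V) :
    (d j : ℝ) * d k ≤ M * (M + x) := by
  refine le_trans ?_ hs.sq_le
  have h1 : (d j : ℝ) ≤ M := by exact_mod_cast hs.deg_le j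
  have h2 : (d k : ℝ) ≤ M := by exact_mod_cast hs.deg_le k
  gcongr

omit [Fintype V] [DecidableEq V] in
lemma not_inPairs_empty (a b : V) : ¬ InPairs (∅ : Finset (V × V)) a b := by simp [InPairs]

omit [DecidableEq V] in
@[simp] lemma pairDeg_empty (v : V) : pairDeg (∅ : Finset (V × V)) v = 0 := by
  simp [pairDeg, not_inPairs_empty]

/-- Forbidding one further pair. -/
lemma log_famCard_insert_avoid {d : V → ℕ} {X : Finset (V × V)} {M x : ℕ}
    (hs : Sparse d X M x) {j k : V} (hjk : j ≠ k) (hjkX : ¬ InPairs X j k)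
    (hpos : 0 < famCard d X ∅) :
    0 < famCard d (insert (j, k) X) ∅ ∧
    |Real.log (famCard d (insert (j, k) X) ∅) - Real.log (famCard d X ∅) +
      (d j : ℝ) * d k / tot d| ≤ 28 * (M * (M + x)) / tot d ^ 2 * ((d j : ℝ) * d k) := by
  have h1 := famCard_insert_estimate hs (L := ∅) (by simp) hjk hjkX (not_inPairs_empty _ _)
  have h2 := famCard_insert_crude hs (L := ∅) (by simp) (not_inPairs_empty j k)
  have h3 := famCard_insert_avoid d X ∅ j k
  have h4 := famCard_nonneg d X (insert (j, k) ∅)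
  have hN := hs.tot_pos
  have hD := hs.one_le_prod
  have hDN := hs.large_real
  have hq := hs.mul_le j k
  have hq0 : 0 ≤ (d j : ℝ) * d k := by positivity
  simp only [pairDeg_empty, Nat.sub_zero] at h1
  set A := famCard d X (insert (j, k) ∅)
  set G := famCard d X ∅
  set N := tot d
  set D : ℝ := (M : ℝ) * (M + x)
  set q : ℝ := (d j : ℝ) * d k
  set p := A / G with hp
  have hA : A = p * G := by rw [hp]; field_simp
  have hp0 : 0 ≤ p := by positivity
  have hpq : p ≤ 2 * q / N := by
    rw [le_div_iff₀ hN]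
    have : G * (p * N) ≤ G * (2 * q) := by rw [hA] at h2; linarith
    exact le_of_mul_le_mul_left this hpos
  have hp1 : p ≤ 1 / 2 := by
    refine hpq.trans ?_
    rw [div_le_iff₀ hN]; linarith
  have hpe : |p - q / N| ≤ 20 * D / N ^ 2 * q := by
    have e1 : N * A - G * q = (N * G) * (p - q / N) := by rw [hA]; field_simp
    have e2 : 20 * (D / N) * (G * q) = (N * G) * (20 * D / N ^ 2 * q) := by field_simp
    rw [e1, e2, abs_mul, abs_of_pos (by positivity)] at h1
    exact le_of_mul_le_mul_left h1 (by positivity)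
  have hp2 : 2 * p ^ 2 ≤ 8 * D / N ^ 2 * q := by
    calc 2 * p ^ 2 ≤ 2 * (2 * q / N) ^ 2 := by gcongr
      _ = 8 * q / N ^ 2 * q := by ring
      _ ≤ _ := by gcongr
  have hnew : famCard d (insert (j, k) X) ∅ = G * (1 - p) := by rw [hA] at h3; linarith
  have hp1' : 0 < 1 - p := by linarith
  rw [hnew]
  refine ⟨by positivity, ?_⟩
  rw [Real.log_mul hpos.ne' hp1'.ne']
  have h5 := abs_log_one_sub_add_le hp1
  have e : Real.log G + Real.log (1 - p) - Real.log G + q / N =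
    (Real.log (1 - p) + p) - (p - q / N) := by ring
  rw [e]
  refine (abs_sub _ _).trans ?_
  have : 28 * D / N ^ 2 * q = 8 * D / N ^ 2 * q + 20 * D / N ^ 2 * q := by ring
  linarith

lemma log_famCard_avoid_aux {d : V → ℕ} {X : Finset (V × V)} {M x : ℕ}
    (hs : Sparse d X M x) (hloop : ∀ p ∈ X, p.1 ≠ p.2) (hanti : ∀ p ∈ X, (p.2, p.1) ∉ X)
    (hpos : 0 < famCard d ∅ ∅) :
    0 < famCard d X ∅ ∧
    |Real.log (famCard d X ∅) - Real.log (famCard d ∅ ∅) +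
      (∑ p ∈ X, (d p.1 : ℝ) * d p.2) / tot d| ≤
      28 * (M * (M + x)) / tot d ^ 2 * ∑ p ∈ X, (d p.1 : ℝ) * d p.2 := by
  induction X using Finset.induction_on with
  | empty => simpa using hpos
  | insert p Y hp ih =>
    have hs' := hs.mono (subset_insert p Y)
    obtain ⟨ih1, ih2⟩ := ih hs' (fun q hq => hloop q (mem_insert_of_mem hq))
      fun q hq h => hanti q (mem_insert_of_mem hq) (mem_insert_of_mem h)
    have hpY : ¬ InPairs Y p.1 p.2 := by
      rintro (h | h)
      · exact hp h
      · exact hanti p (mem_insert_self _ _) (mem_insert_of_mem h)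
    obtain ⟨h1, h2⟩ := log_famCard_insert_avoid hs' (hloop p (mem_insert_self _ _)) hpY ih1
    refine ⟨h1, ?_⟩
    rw [sum_insert hp, add_div, mul_add]
    refine le_trans (le_of_eq ?_) ((abs_add_le _ _).trans (add_le_add h2 ih2))
    congr 1
    ring

/-- The effect of forbidding the pairs in `X`. -/
lemma log_famCard_avoid {d : V → ℕ} {X : Finset (V × V)} {M x : ℕ}
    (hs : Sparse d X M x) (hloop : ∀ p ∈ X, p.1 ≠ p.2) (hanti : ∀ p ∈ X, (p.2, p.1) ∉ X)
    (hpos : 0 < famCard d ∅ ∅) :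
    0 < famCard d X ∅ ∧
    |Real.log (famCard d X ∅) - Real.log (famCard d ∅ ∅) +
      (∑ p ∈ X, (d p.1 : ℝ) * d p.2) / tot d| ≤ 28 * (M * (M + x) : ℝ) ^ 2 / tot d := by
  obtain ⟨h1, h2⟩ := log_famCard_avoid_aux hs hloop hanti hpos
  refine ⟨h1, h2.trans ?_⟩
  have hN := hs.tot_pos
  have hD := hs.one_le_prod
  have h3 : ∑ p ∈ X, (d p.1 : ℝ) * d p.2 ≤ (M * (M + x) : ℝ) * tot d := by
    have h := sum_inPairs_le hs.deg_le hs.pairDeg_le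
    have h' : ∑ p ∈ X, (d p.1 : ℝ) * d p.2 ≤
        ∑ p : V × V with InPairs X p.1 p.2, (d p.1 : ℝ) * d p.2 := by
      refine sum_le_sum_of_subset_of_nonneg (fun p hp => ?_) fun _ _ _ => by positivity
      simp only [mem_filter, mem_univ, true_and]
      exact Or.inl hp
    refine h'.trans (h.trans (mul_le_mul_of_nonneg_right ?_ hN.le))
    nlinarith [hs.one_le_real]
  calc _ ≤ 28 * (M * (M + x) : ℝ) / tot d ^ 2 * ((M * (M + x) : ℝ) * tot d) := by gcongr
    _ = _ := by field_simp

end Avoiding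

section Splitting

variable {V : Type*} [Fintype V] [DecidableEq V]

/-- The path with edges `vw` and `uw`. -/
def cherry (v u w : V) : SimpleGraph V := SimpleGraph.edge v w ⊔ SimpleGraph.edge u w

omit [Fintype V] [DecidableEq V] in
lemma cherry_adj (v u w a b : V) : (cherry v u w).Adj a b ↔ a ≠ b ∧
    ((a = v ∧ b = w) ∨ (a = w ∧ b = v) ∨ (a = u ∧ b = w) ∨ (a = w ∧ b = u)) := by
  simp only [cherry, SimpleGraph.sup_adj, SimpleGraph.edge_adj]
  tauto

lemma gdeg_eq_succ_of_iff {H H' : SimpleGraph V} {v w : V} (hw : H.Adj v w)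
    (h : ∀ u, H'.Adj v u ↔ H.Adj v u ∧ u ≠ w) : gdeg H' v + 1 = gdeg H v := by
  have : ({u | H'.Adj v u} : Finset V) = ({u | H.Adj v u} : Finset V).erase w := by
    ext u; simp only [mem_filter, mem_univ, true_and, h, mem_erase]; tauto
  unfold gdeg
  rw [this, card_erase_add_one (by simpa using hw)]

lemma gdeg_symmDiff_cherry {H : SimpleGraph V} {v u w : V} (hvu : v ≠ u) (hvw : v ≠ w)
    (huw : u ≠ w) (h1 : H.Adj v w) (h2 : ¬ H.Adj u w) :
    gdeg (H ∆ cherry v u w) v + 1 = gdeg H v ∧ gdeg (H ∆ cherry v u w) u = gdeg H u + 1 ∧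
      ∀ a, a ≠ v → a ≠ u → gdeg (H ∆ cherry v u w) a = gdeg H a := by
  have h1' := h1.symm
  have h2' : ¬ H.Adj w u := fun h => h2 h.symm
  refine ⟨gdeg_eq_succ_of_iff h1 fun b => ?_, (gdeg_eq_succ_of_iff (w := w) ?_ fun b => ?_).symm,
    fun a hav hau => ?_⟩
  · rw [symmDiff_graph_adj, cherry_adj]; grind
  · rw [symmDiff_graph_adj, cherry_adj]; grind
  · rw [symmDiff_graph_adj, cherry_adj]; grind
  by_cases haw : a = w
  · subst haw
    refine gdeg_eq_of_swap h1' h2' fun b => ?_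
    rw [symmDiff_graph_adj, cherry_adj]; grind
  · refine gdeg_eq_of_iff fun b => ?_
    rw [symmDiff_graph_adj, cherry_adj]; grind

lemma mem_fam_empty {d : V → ℕ} {H : SimpleGraph V} :
    H ∈ fam d ∅ ∅ ↔ ∀ v, gdeg H v = d v := by
  simp [mem_fam, not_inPairs_empty]

omit [DecidableEq V] in
lemma not_adj_of_gdeg_eq_zero {H : SimpleGraph V} {v : V} (h : gdeg H v = 0) (w : V) :
    ¬ H.Adj v w := by
  unfold gdeg at h
  rw [card_eq_zero, filter_eq_empty_iff] at h
  exact h (mem_univ w)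

lemma card_move_edge {d d' : V → ℕ} {v u w : V} (hvu : v ≠ u) (hvw : v ≠ w)
    (hv : d' v + 1 = d v) (hu : d u = 0) (hu' : d' u = 1)
    (hne : ∀ a, a ≠ v → a ≠ u → d' a = d a) :
    #{H ∈ fam d ∅ ∅ | H.Adj v w} = #{H ∈ fam d' ∅ ∅ | H.Adj u w ∧ ¬ H.Adj v w} := by
  have hcomm : cherry u v w = cherry v u w := sup_comm _ _
  refine card_nbij' (· ∆ cherry v u w) (· ∆ cherry v u w) ?_ ?_ ?_ ?_
  · intro H hH
    simp only [coe_filter, Set.mem_ofPred_eq, mem_fam_empty] at hH ⊢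
    obtain ⟨hd, hvw'⟩ := hH
    have huz := not_adj_of_gdeg_eq_zero ((hd u).trans hu)
    have huw : u ≠ w := by rintro rfl; exact huz v hvw'.symm
    obtain ⟨e1, e2, e3⟩ := gdeg_symmDiff_cherry hvu hvw huw hvw' (huz w)
    refine ⟨fun a => ?_, ?_⟩
    · by_cases hav : a = v
      · subst hav; have := hd a; omega
      by_cases hau : a = u
      · subst hau; have := hd a; omega
      rw [e3 a hav hau, hd, hne a hav hau]
    · have := huz w
      simp only [symmDiff_graph_adj, cherry_adj]
      tauto
  · intro H hH
    simp only [coe_filter, Set.mem_ofPred_eq, mem_fam_empty] at hH ⊢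
    obtain ⟨hd, huw', hvw'⟩ := hH
    obtain ⟨e1, e2, e3⟩ := gdeg_symmDiff_cherry hvu.symm huw'.ne hvw huw' hvw'
    rw [hcomm] at e1 e2 e3
    refine ⟨fun a => ?_, ?_⟩
    · by_cases hav : a = v
      · subst hav; have := hd a; omega
      by_cases hau : a = u
      · subst hau; have := hd a; omega
      rw [e3 a hau hav, hd, hne a hav hau]
    · simp only [symmDiff_graph_adj, cherry_adj]
      tauto
  · intro H _; exact symmDiff_symmDiff_cancel_right _ _
  · intro H _; exact symmDiff_symmDiff_cancel_right _ _

lemma sum_card_adj (d : V → ℕ) (v : V) :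
    ∑ w, #{H ∈ fam d ∅ ∅ | H.Adj v w} = d v * #(fam d ∅ ∅) := by
  have h := sum_card_bipartiteAbove_eq_sum_card_bipartiteBelow (s := fam d ∅ ∅)
      (t := (univ : Finset V)) (fun H w => H.Adj v w)
  simp only [bipartiteAbove, bipartiteBelow] at h
  have h' : ∑ H ∈ fam d ∅ ∅, gdeg H v = ∑ H ∈ fam d ∅ ∅, d v :=
    sum_congr rfl fun H hH => mem_fam_empty.mp hH v
  rw [sum_const, smul_eq_mul, mul_comm] at h'
  rw [← h, ← h']
  rfl

/-- Graphs with a vertex of degree one split off from `v`, classified by whether the two parts of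
`v` can be merged. -/
lemma famCard_split {d d' : V → ℕ} {v u : V} (hvu : v ≠ u)
    (hv : d' v + 1 = d v) (hu : d u = 0) (hu' : d' u = 1)
    (hne : ∀ a, a ≠ v → a ≠ u → d' a = d a) :
    d v * famCard d ∅ ∅ + famCard d' ∅ (insert (u, v) ∅) +
      ∑ w ∈ univ.erase v, famCard d' ∅ (insert (v, w) (insert (u, w) ∅)) = famCard d' ∅ ∅ := by
  have h1 := sum_card_adj d v
  have h2 := sum_card_adj d' u
  rw [hu', one_mul, ← add_sum_erase _ _ (mem_univ v)] at h2
  rw [← add_sum_erase _ _ (mem_univ v)] at h1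
  have h3 : #{H ∈ fam d ∅ ∅ | H.Adj v v} = 0 := by simp
  have h4 : #{H ∈ fam d' ∅ ∅ | H.Adj u v} = #(fam d' ∅ (insert (u, v) ∅)) := by
    congr 1; ext H; rw [mem_filter, mem_fam_insert]
  have h5 : ∑ w ∈ univ.erase v, #{H ∈ fam d' ∅ ∅ | H.Adj u w} =
      ∑ w ∈ univ.erase v, #(fam d' ∅ (insert (v, w) (insert (u, w) ∅))) +
        ∑ w ∈ univ.erase v, #{H ∈ fam d ∅ ∅ | H.Adj v w} := by
    rw [← sum_add_distrib]
    refine sum_congr rfl fun w hw => ?_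
    rw [card_move_edge hvu (ne_of_mem_erase hw).symm hv hu hu' hne, ← filter_filter,
      ← card_filter_add_card_filter_not (fun H : SimpleGraph V => H.Adj v w)]
    congr 2
    ext H; simp only [mem_filter, mem_fam_insert]
  rw [h3, zero_add] at h1
  rw [h4, h5, h1] at h2
  unfold famCard
  norm_cast
  omega

/-- The sum of `d (d - 1)` over all vertices. -/
def fallSum (d : V → ℕ) : ℝ := ∑ v, (d v : ℝ) * ((d v : ℝ) - 1)

lemma cast_mul_pred (n : ℕ) : (n : ℝ) * ((n - 1 : ℕ) : ℝ) = n * ((n : ℝ) - 1) := by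
  cases n <;> simp

lemma pairDeg_singleton_of_ne {u w v : V} (h1 : v ≠ u) (h2 : v ≠ w) :
    pairDeg (insert (u, w) ∅) v = 0 := by
  unfold pairDeg
  rw [card_eq_zero, filter_eq_empty_iff]
  intro a _
  rw [inPairs_insert]
  have := not_inPairs_empty v a
  tauto

lemma pairDeg_singleton_right {u w : V} (h : u ≠ w) : pairDeg (insert (u, w) ∅) w = 1 := by
  unfold pairDeg
  rw [card_eq_one]
  refine ⟨u, ?_⟩
  ext a
  simp only [mem_filter, mem_univ, true_and, mem_singleton, inPairs_insert, not_inPairs_empty]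
  constructor
  · rintro (⟨rfl, -⟩ | ⟨-, rfl⟩ | h)
    exacts [absurd rfl h, rfl, h.elim]
  · rintro rfl; simp

/-- The number of graphs in which `v` and `u` have the common neighbour `w`. -/
lemma famCard_cherry_estimate {d : V → ℕ} {M : ℕ} (hs : Sparse d ∅ M 0) {v u w : V} (hvu : v ≠ u)
    (hvw : v ≠ w) (hu : d u = 1) :
    |tot d ^ 2 * famCard d ∅ (insert (v, w) (insert (u, w) ∅)) -
      famCard d ∅ ∅ * ((d v : ℝ) * ((d w : ℝ) * ((d w : ℝ) - 1)))| ≤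
      60 * ((M : ℝ) ^ 3 / tot d) * (famCard d ∅ ∅ * d v) * d w := by
  have hN := hs.tot_pos
  have hG0 := famCard_nonneg d ∅ ∅
  by_cases huw : u = w
  · subst huw
    have : famCard d ∅ (insert (v, u) (insert (u, u) ∅)) = 0 := by
      rw [Finset.insert_comm]; exact fam_eq_zero_of_loop _ _ _ _
    rw [this, hu]
    simp only [mul_zero, Nat.cast_one, sub_self, abs_zero]
    positivity
  have h1 := famCard_insert_estimate hs (L := ∅) (by simp) huw (not_inPairs_empty _ _)
    (not_inPairs_empty _ _)
  have h2 := famCard_insert_crude hs (L := ∅) (by simp) (not_inPairs_empty u w)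
  have h3 := famCard_insert_estimate hs (L := insert (u, w) ∅) (by simp) hvw
    (not_inPairs_empty _ _) (by
      rw [inPairs_insert]
      have := not_inPairs_empty v w
      tauto)
  rw [pairDeg_singleton_of_ne hvu hvw, pairDeg_singleton_right huw] at h3
  simp only [pairDeg_empty, Nat.sub_zero, hu, Nat.cast_one, one_mul, Nat.cast_zero, add_zero]
    at h1 h2 h3
  have hg0 := famCard_nonneg d ∅ (insert (u, w) ∅)
  have hdw : (d w : ℝ) ≤ M := by exact_mod_cast hs.deg_le w
  set A := famCard d ∅ (insert (v, w) (insert (u, w) ∅))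
  set g := famCard d ∅ (insert (u, w) ∅)
  set G := famCard d ∅ ∅
  set N := tot d
  set t : ℝ := (d v : ℝ) with ht
  have ht0 : 0 ≤ t := Nat.cast_nonneg _
  set c : ℝ := ((d w - 1 : ℕ) : ℝ) with hc
  have hc0 : 0 ≤ c := Nat.cast_nonneg _
  have hcd : c ≤ d w := by rw [hc]; exact_mod_cast Nat.sub_le _ _
  have e : N ^ 2 * A - G * (t * ((d w : ℝ) * ((d w : ℝ) - 1))) =
      N * (N * A - g * (t * c)) + t * c * (N * g - G * d w) := by
    rw [← cast_mul_pred, ← hc]; ring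
  rw [e]
  refine (abs_add_le _ _).trans ?_
  rw [abs_mul, abs_of_pos hN, abs_mul, abs_of_nonneg (by positivity : 0 ≤ t * c)]
  have f1 : N * |N * A - g * (t * c)| ≤ 40 * ((M : ℝ) ^ 3 / N) * (G * t) * d w := by
    calc N * |N * A - g * (t * c)| ≤ N * (20 * (M * M / N) * (g * (t * d w))) := by gcongr
      _ = 20 * (M * M / N) * (t * d w) * (N * g) := by ring
      _ ≤ 20 * (M * M / N) * (t * d w) * (2 * G * M) := by
        exact mul_le_mul_of_nonneg_left (h2.trans (by gcongr)) (by positivity)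
      _ = _ := by ring
  have f2 : t * c * |N * g - G * d w| ≤ 20 * ((M : ℝ) ^ 3 / N) * (G * t) * d w := by
    calc t * c * |N * g - G * d w| ≤ t * M * (20 * (M * M / N) * (G * d w)) := by
          gcongr
          exact hcd.trans hdw
      _ = _ := by ring
  linarith

lemma exists_of_merge_estimates {N G M t A As c S g : ℝ} (hN : 0 < N) (hG : 0 < G)
    (hM1 : 1 ≤ M) (ht0 : 0 ≤ t) (htM : t ≤ M) (hA0 : 0 ≤ A) (hAs0 : 0 ≤ As)
    (hc0 : 0 ≤ c) (hcM : c ≤ M * M)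
    (h2 : |N * A - G * t| ≤ 20 * (M * M / N) * (G * t))
    (hsum : |N ^ 2 * As - G * (t * (S - c))| ≤ 60 * M ^ 3 * (G * t))
    (h1 : g + A + As = G) :
    ∃ p : ℝ, 0 ≤ p ∧ g = G * (1 - p) ∧ |N ^ 2 * p - (N * t + t * S)| ≤ 81 * M ^ 4 := by
  have hM34 : M ^ 3 ≤ M ^ 4 := pow_le_pow_right₀ hM1 (by norm_num)
  have hM0 : 0 ≤ M := by linarith
  have hpG : A + As = (A + As) / G * G := by field_simp
  refine ⟨(A + As) / G, by positivity, by linarith, ?_⟩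
  generalize (A + As) / G = p at hpG
  have e : G * (N ^ 2 * p - (N * t + t * S)) =
      N * (N * A - G * t) + (N ^ 2 * As - G * (t * (S - c))) - G * (t * c) := by
    have : G * (N ^ 2 * p) = N ^ 2 * (A + As) := by rw [hpG]; ring
    linear_combination this
  have f1 : |N * (N * A - G * t)| ≤ G * (20 * M ^ 4) := by
    rw [abs_mul, abs_of_pos hN]
    calc _ ≤ N * (20 * (M * M / N) * (G * t)) := by gcongr
      _ = 20 * (M * M) * (G * t) := by field_simp
      _ ≤ 20 * (M * M) * (G * M) := by gcongr
      _ = G * (20 * M ^ 3) := by ring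
      _ ≤ _ := by gcongr
  have f2 : |N ^ 2 * As - G * (t * (S - c))| ≤ G * (60 * M ^ 4) := by
    refine hsum.trans ?_
    calc _ ≤ 60 * M ^ 3 * (G * M) := by gcongr
      _ = _ := by ring
  have f3 : |G * (t * c)| ≤ G * M ^ 4 := by
    rw [abs_of_nonneg (by positivity)]
    calc _ ≤ G * (M * (M * M)) := by gcongr
      _ = G * M ^ 3 := by ring
      _ ≤ _ := by gcongr
  have f4 : G * |N ^ 2 * p - (N * t + t * S)| ≤ G * (81 * M ^ 4) := by
    rw [← abs_of_pos hG, ← abs_mul, abs_of_pos hG, e]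
    refine (abs_sub _ _).trans ?_
    have := abs_add_le (N * (N * A - G * t)) (N ^ 2 * As - G * (t * (S - c)))
    linarith
  exact le_of_mul_le_mul_left f4 hG

/-- The probability that the two parts of a split vertex cannot be merged. -/
lemma exists_merge_prob {d d' : V → ℕ} {M : ℕ} {v u : V} (hs : Sparse d' ∅ M 0) (hvu : v ≠ u)
    (hv : d' v + 1 = d v) (hu : d u = 0) (hu' : d' u = 1)
    (hne : ∀ a, a ≠ v → a ≠ u → d' a = d a) (hpos : 0 < famCard d' ∅ ∅) :
    ∃ p : ℝ, 0 ≤ p ∧ (d v : ℝ) * famCard d ∅ ∅ = famCard d' ∅ ∅ * (1 - p) ∧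
      |tot d' ^ 2 * p - (tot d' * d' v + d' v * fallSum d')| ≤ 81 * (M : ℝ) ^ 4 := by
  have h1 := famCard_split hvu hv hu hu' hne
  have h2 := famCard_insert_estimate hs (L := ∅) (by simp) hvu.symm (not_inPairs_empty _ _)
    (not_inPairs_empty _ _)
  have hN := hs.tot_pos
  have hM1 := hs.one_le_real
  simp only [pairDeg_empty, Nat.sub_zero, hu', Nat.cast_one, one_mul, Nat.cast_zero, add_zero]
    at h2
  have htM : (d' v : ℝ) ≤ M := by exact_mod_cast hs.deg_le v
  have hA0 := famCard_nonneg d' ∅ (insert (u, v) ∅)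
  have hAs0 : 0 ≤ ∑ w ∈ univ.erase v, famCard d' ∅ (insert (v, w) (insert (u, w) ∅)) :=
    sum_nonneg fun _ _ => famCard_nonneg _ _ _
  have hsum : |tot d' ^ 2 * ∑ w ∈ univ.erase v, famCard d' ∅ (insert (v, w) (insert (u, w) ∅)) -
      famCard d' ∅ ∅ * ((d' v : ℝ) * ∑ w ∈ univ.erase v, ((d' w : ℝ) * ((d' w : ℝ) - 1)))| ≤
      60 * (M : ℝ) ^ 3 * (famCard d' ∅ ∅ * d' v) := by
    rw [mul_sum, mul_sum, mul_sum, ← sum_sub_distrib]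
    refine (abs_sum_le_sum_abs _ _).trans ?_
    calc _ ≤ ∑ w ∈ univ.erase v,
          60 * ((M : ℝ) ^ 3 / tot d') * (famCard d' ∅ ∅ * d' v) * d' w :=
          sum_le_sum fun w hw => famCard_cherry_estimate hs hvu (ne_of_mem_erase hw).symm hu'
      _ ≤ ∑ w, 60 * ((M : ℝ) ^ 3 / tot d') * (famCard d' ∅ ∅ * d' v) * d' w :=
          sum_le_sum_of_subset_of_nonneg (subset_univ _) fun _ _ _ => by positivity
      _ = 60 * (M : ℝ) ^ 3 * (famCard d' ∅ ∅ * d' v) := by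
          rw [← mul_sum, ← tot_eq_sum]; field_simp
  have hSerase : ∑ w ∈ univ.erase v, ((d' w : ℝ) * ((d' w : ℝ) - 1)) =
      fallSum d' - d' v * ((d' v : ℝ) - 1) := by
    unfold fallSum
    rw [← add_sum_erase _ _ (mem_univ v)]; ring
  have hc0 : 0 ≤ (d' v : ℝ) * ((d' v : ℝ) - 1) := by rw [← cast_mul_pred]; positivity
  have hcM : (d' v : ℝ) * ((d' v : ℝ) - 1) ≤ M * M := by
    have : (0 : ℝ) ≤ d' v := Nat.cast_nonneg _
    nlinarith
  rw [hSerase] at hsum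
  exact exists_of_merge_estimates hN hpos hM1 (Nat.cast_nonneg _) htM hA0 hAs0 hc0 hcM h2 hsum h1

/-- Splitting off a vertex of degree one from `v`. -/
lemma log_famCard_split {d d' : V → ℕ} {M : ℕ} {v u : V} (hs : Sparse d' ∅ M 0) (hvu : v ≠ u)
    (hv : d' v + 1 = d v) (hu : d u = 0) (hu' : d' u = 1)
    (hne : ∀ a, a ≠ v → a ≠ u → d' a = d a) (hpos : 0 < famCard d' ∅ ∅) :
    0 < famCard d ∅ ∅ ∧
    |Real.log (famCard d ∅ ∅) + Real.log (d v) - Real.log (famCard d' ∅ ∅) +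
      (d' v / tot d' + d' v * fallSum d' / tot d' ^ 2)| ≤ 99 * (M : ℝ) ^ 4 / tot d' ^ 2 := by
  obtain ⟨p, hp0, hnew, hpe⟩ := exists_merge_prob hs hvu hv hu hu' hne hpos
  have hN := hs.tot_pos
  have hM1 := hs.one_le_real
  have hNM := hs.large_real
  simp only [Nat.cast_zero, add_zero] at hNM
  have htM : (d' v : ℝ) ≤ M := by exact_mod_cast hs.deg_le v
  have hSM : fallSum d' ≤ M * tot d' := by
    refine le_trans (sum_le_sum fun w _ => ?_) (sum_sq_le hs.deg_le)
    have : (0 : ℝ) ≤ d' w := Nat.cast_nonneg _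
    nlinarith
  have hS0 : 0 ≤ fallSum d' := sum_nonneg fun w _ => by
    rw [← cast_mul_pred]; positivity
  have hdv : (d v : ℝ) = d' v + 1 := by exact_mod_cast hv.symm
  set G := famCard d' ∅ ∅
  set N := tot d'
  set t : ℝ := (d' v : ℝ) with ht
  have ht0 : 0 ≤ t := Nat.cast_nonneg _
  set S := fallSum d'
  have hpM : p ≤ 3 * ((M : ℝ) * M) / N := by
    rw [le_div_iff₀ hN]
    have f1 := (abs_le.mp hpe).2
    have f2 : N * t ≤ N * (M * M) := by gcongr; nlinarith
    have f3 : t * S ≤ M * (M * N) := by gcongr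
    have f4 : 81 * (M : ℝ) ^ 4 ≤ N * (M * M) := by
      have : 81 * (M : ℝ) ^ 4 = 81 * (M * M) * (M * M) := by ring
      rw [this]
      have : 0 ≤ (M : ℝ) * M := by positivity
      gcongr; linarith
    have f5 : N * (p * N) ≤ N * (3 * (M * M)) := by linarith
    exact le_of_mul_le_mul_left f5 hN
  have hp1 : p ≤ 1 / 2 := by
    refine hpM.trans ?_
    rw [div_le_iff₀ hN]; linarith [mul_pos (zero_lt_one.trans_le hM1) (zero_lt_one.trans_le hM1)]
  have hp2 : 2 * p ^ 2 ≤ 18 * (M : ℝ) ^ 4 / N ^ 2 := by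
    calc 2 * p ^ 2 ≤ 2 * (3 * ((M : ℝ) * M) / N) ^ 2 := by gcongr
      _ = _ := by ring
  have hp1' : 0 < 1 - p := by linarith
  have hdv0 : (0 : ℝ) < d v := by rw [hdv]; linarith
  have hpos' : 0 < famCard d ∅ ∅ := by
    have : 0 < (d v : ℝ) * famCard d ∅ ∅ := by rw [hnew]; positivity
    exact pos_of_mul_pos_right this hdv0.le
  refine ⟨hpos', ?_⟩
  have hlog : Real.log (famCard d ∅ ∅) + Real.log (d v) = Real.log G + Real.log (1 - p) := by
    rw [← Real.log_mul hpos'.ne' hdv0.ne', mul_comm, hnew, Real.log_mul hpos.ne' hp1'.ne']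
  rw [hlog]
  have h5 := abs_log_one_sub_add_le hp1
  have hpe' : |p - (t / N + t * S / N ^ 2)| ≤ 81 * (M : ℝ) ^ 4 / N ^ 2 := by
    rw [le_div_iff₀ (by positivity)]
    rw [← abs_of_pos (by positivity : 0 < N ^ 2), ← abs_mul, abs_of_pos (by positivity : 0 < N ^ 2)]
    refine le_trans (le_of_eq ?_) hpe
    congr 1
    field_simp
  have e : Real.log G + Real.log (1 - p) - Real.log G + (t / N + t * S / N ^ 2) =
    (Real.log (1 - p) + p) - (p - (t / N + t * S / N ^ 2)) := by ring
  rw [e]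
  refine (abs_sub _ _).trans ?_
  have : 99 * (M : ℝ) ^ 4 / N ^ 2 = 18 * (M : ℝ) ^ 4 / N ^ 2 + 81 * (M : ℝ) ^ 4 / N ^ 2 := by ring
  linarith

end Splitting

section Matching

variable {V : Type*} [Fintype V] [DecidableEq V]

lemma card_remove_edge {d d' : V → ℕ} {v w : V} (hvw : v ≠ w) (hv : d v = 1) (hw : d w = 1)
    (hv' : d' v = 0) (hw' : d' w = 0) (hne : ∀ a, a ≠ v → a ≠ w → d' a = d a) :
    #{H ∈ fam d ∅ ∅ | H.Adj v w} = #(fam d' ∅ ∅) := by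
  have key (H : SimpleGraph V) (h : H.Adj v w) :
      gdeg (H ∆ SimpleGraph.edge v w) v + 1 = gdeg H v ∧
      gdeg (H ∆ SimpleGraph.edge v w) w + 1 = gdeg H w ∧
      ∀ a, a ≠ v → a ≠ w → gdeg (H ∆ SimpleGraph.edge v w) a = gdeg H a := by
    have h' := h.symm
    refine ⟨gdeg_eq_succ_of_iff h fun b => ?_, gdeg_eq_succ_of_iff h' fun b => ?_,
      fun a h1 h2 => gdeg_eq_of_iff fun b => ?_⟩ <;>
    rw [symmDiff_graph_adj, SimpleGraph.edge_adj] <;> grind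
  refine card_nbij' (· ∆ SimpleGraph.edge v w) (· ∆ SimpleGraph.edge v w) ?_ ?_ ?_ ?_
  · intro H hH
    simp only [coe_filter, Set.mem_ofPred_eq, mem_fam_empty, mem_coe] at hH ⊢
    obtain ⟨hd, h⟩ := hH
    obtain ⟨e1, e2, e3⟩ := key H h
    intro a
    by_cases hav : a = v
    · subst hav; have := hd a; omega
    by_cases haw : a = w
    · subst haw; have := hd a; omega
    rw [e3 a hav haw, hd, hne a hav haw]
  · intro H hH
    simp only [coe_filter, Set.mem_ofPred_eq, mem_fam_empty, mem_coe] at hH ⊢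
    have hn := not_adj_of_gdeg_eq_zero ((hH v).trans hv') w
    have h : (H ∆ SimpleGraph.edge v w).Adj v w := by
      rw [symmDiff_graph_adj, SimpleGraph.edge_adj]; tauto
    obtain ⟨e1, e2, e3⟩ := key _ h
    rw [symmDiff_symmDiff_cancel_right] at e1 e2 e3
    refine ⟨fun a => ?_, h⟩
    by_cases hav : a = v
    · subst hav; have := hH a; omega
    by_cases haw : a = w
    · subst haw; have := hH a; omega
    rw [← e3 a hav haw, hH, hne a hav haw]
  · intro H _; exact symmDiff_symmDiff_cancel_right _ _
  · intro H _; exact symmDiff_symmDiff_cancel_right _ _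

lemma card_fam_of_eq_zero {d : V → ℕ} (hd : ∀ v, d v = 0) : #(fam d ∅ ∅) = 1 := by
  rw [card_eq_one]
  refine ⟨⊥, ?_⟩
  ext H
  rw [mem_fam_empty, mem_singleton]
  constructor
  · intro h
    ext a b
    have := not_adj_of_gdeg_eq_zero ((h a).trans (hd a)) b
    simpa using this
  · rintro rfl v
    simp [gdeg, hd]

/-- The number of perfect matchings on the vertices of degree one. -/
lemma card_fam_matching (E : ℕ) : ∀ d : V → ℕ, (∀ v, d v ≤ 1) → ∑ v, d v = 2 * E →
    #(fam d ∅ ∅) * (E.factorial * 2 ^ E) = (2 * E).factorial := by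
  induction E with
  | zero =>
    intro d _ hs
    rw [card_fam_of_eq_zero fun v => by simpa using (sum_eq_zero_iff.mp hs) v (mem_univ v)]
    simp
  | succ E ih =>
    intro d hd hs
    obtain ⟨v, hv⟩ : ∃ v, d v = 1 := by
      by_contra! h
      have : ∑ v, d v = 0 := sum_eq_zero fun v _ => by have := hd v; have := h v; omega
      omega
    set A : Finset V := {w ∈ univ.erase v | d w = 1} with hA
    have hAcard : #A = 2 * E + 1 := by
      have h1 : ∑ w ∈ univ.erase v, d w = #A := by
        rw [hA, card_filter]
        refine sum_congr rfl fun w _ => ?_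
        have := hd w
        split_ifs <;> omega
      rw [← add_sum_erase _ _ (mem_univ v), h1] at hs
      omega
    have hcount := sum_card_adj d v
    have h0 : ∑ w ∈ A, #{H ∈ fam d ∅ ∅ | H.Adj v w} = ∑ w, #{H ∈ fam d ∅ ∅ | H.Adj v w} := by
      refine sum_subset (subset_univ _) fun w _ hw => ?_
      rw [card_eq_zero, filter_eq_empty_iff]
      intro H hH h
      have hwv := h.ne'
      have hw0 : d w = 0 := by
        have := hd w
        simp only [hA, mem_filter, mem_erase, mem_univ, and_true, not_and] at hw
        have := hw hwv
        omega
      exact not_adj_of_gdeg_eq_zero ((mem_fam_empty.mp hH w).trans hw0) v h.symm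
    have hterm : ∀ w ∈ A, #{H ∈ fam d ∅ ∅ | H.Adj v w} * (E.factorial * 2 ^ E) =
        (2 * E).factorial := by
      intro w hw
      simp only [hA, mem_filter, mem_erase, mem_univ, and_true] at hw
      obtain ⟨hwv, hw1⟩ := hw
      rw [card_remove_edge (d' := fun a => if a = v ∨ a = w then 0 else d a) hwv.symm hv hw1
        (by simp) (by simp) (fun a h1 h2 => by simp [h1, h2])]
      refine ih _ (fun a => ?_) ?_
      · split_ifs; exacts [by omega, hd a]
      · rw [← add_sum_erase _ _ (mem_univ v),
          ← add_sum_erase _ _ (mem_erase.mpr ⟨hwv, mem_univ w⟩)] at hs ⊢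
        have : ∑ a ∈ (univ.erase v).erase w, (if a = v ∨ a = w then 0 else d a) =
            ∑ a ∈ (univ.erase v).erase w, d a := by
          refine sum_congr rfl fun a ha => ?_
          simp only [mem_erase, mem_univ, and_true] at ha
          simp [ha.1, ha.2]
        rw [this]
        simp only [true_or, or_true, if_true]
        omega
    rw [hv, one_mul, ← h0] at hcount
    have hprod : #(fam d ∅ ∅) * (E.factorial * 2 ^ E) = (2 * E + 1) * (2 * E).factorial := by
      rw [← hcount, sum_mul, sum_congr rfl hterm, sum_const, hAcard, smul_eq_mul]
    rw [show 2 * (E + 1) = 2 * E + 1 + 1 by ring, Nat.factorial_succ (2 * E + 1),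
      Nat.factorial_succ (2 * E), Nat.factorial_succ E, ← hprod]
    ring

end Matching

section Chain

variable {V : Type*} [Fintype V] [DecidableEq V]

lemma sum_update_two {R : Type*} [AddCommMonoid R] (f : ℕ → R) {d d' : V → ℕ} {v u : V}
    (hvu : v ≠ u) (hne : ∀ a, a ≠ v → a ≠ u → d' a = d a) :
    ∑ a, f (d' a) + (f (d v) + f (d u)) = ∑ a, f (d a) + (f (d' v) + f (d' u)) := by
  have hu : u ∈ (univ : Finset V).erase v := mem_erase.mpr ⟨hvu.symm, mem_univ u⟩
  have h : ∑ a ∈ (univ.erase v).erase u, f (d' a) = ∑ a ∈ (univ.erase v).erase u, f (d a) := by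
    refine sum_congr rfl fun a ha => ?_
    simp only [mem_erase, mem_univ, and_true] at ha
    rw [hne a ha.2 ha.1]
  rw [← add_sum_erase _ (fun a => f (d' a)) (mem_univ v), ← add_sum_erase _ (fun a => f (d' a)) hu,
    ← add_sum_erase _ (fun a => f (d a)) (mem_univ v), ← add_sum_erase _ (fun a => f (d a)) hu, h]
  abel

omit [DecidableEq V] in
lemma sparse_empty {d : V → ℕ} {M : ℕ} (hM : 1 ≤ M) (hd : ∀ v, d v ≤ M)
    (hlarge : 1000 * (M * M) ≤ ∑ v, d v) : Sparse d ∅ M 0 :=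
  ⟨hM, hd, fun v => by simp, by simpa using hlarge⟩

lemma abs_split_step {N T S S' t ℓ F F' L L' ε δ M : ℝ} (hN : 0 < N) (ht0 : 0 ≤ t) (htM : t ≤ M)
    (hM1 : 1 ≤ M) (hS : S = S' + 2 * t) (hF : F = F' + ℓ)
    (h1 : |L + ℓ - L' + (t / N + t * S' / N ^ 2)| ≤ 99 * M ^ 4 / N ^ 2)
    (h2 : |L' + F' - T + (S' / (2 * N) + S' ^ 2 / (4 * N ^ 2))| ≤ ε)
    (hδ : δ = ε + 100 * M ^ 4 / N ^ 2) :
    |L + F - T + (S / (2 * N) + S ^ 2 / (4 * N ^ 2))| ≤ δ := by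
  have h3 : |t ^ 2 / N ^ 2| ≤ M ^ 4 / N ^ 2 := by
    rw [abs_of_nonneg (by positivity)]
    gcongr
    calc t ^ 2 ≤ M ^ 2 := by gcongr
      _ ≤ M ^ 4 := pow_le_pow_right₀ hM1 (by norm_num)
  have e : L + F - T + (S / (2 * N) + S ^ 2 / (4 * N ^ 2)) =
      (L + ℓ - L' + (t / N + t * S' / N ^ 2)) +
      (L' + F' - T + (S' / (2 * N) + S' ^ 2 / (4 * N ^ 2))) + t ^ 2 / N ^ 2 := by
    subst hS hF
    field_simp
    ring
  rw [e, hδ]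
  refine (abs_add_le _ _).trans ?_
  have := abs_add_le (L + ℓ - L' + (t / N + t * S' / N ^ 2))
    (L' + F' - T + (S' / (2 * N) + S' ^ 2 / (4 * N ^ 2)))
  have e2 : 100 * M ^ 4 / N ^ 2 = 99 * M ^ 4 / N ^ 2 + M ^ 4 / N ^ 2 := by ring
  linarith

lemma log_famCard_of_excess {M E : ℕ} (hM : 1 ≤ M) (hlarge : 1000 * (M * M) ≤ 2 * E)
    (hcard : 2 * E ≤ Fintype.card V) (r : ℕ) : ∀ d : V → ℕ, (∀ v, d v ≤ M) → ∑ v, d v = 2 * E →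
    ∑ v, (d v - 1) = r → 0 < famCard d ∅ ∅ ∧
    |Real.log (famCard d ∅ ∅) + ∑ v, Real.log (d v).factorial -
      Real.log ((2 * E).factorial / (E.factorial * 2 ^ E)) +
      (fallSum d / (2 * tot d) + fallSum d ^ 2 / (4 * tot d ^ 2))| ≤
      r * (100 * (M : ℝ) ^ 4 / tot d ^ 2) := by
  induction r with
  | zero =>
    intro d hdM hsum hr
    have hd1 : ∀ v, d v ≤ 1 := fun v => by
      have := (sum_eq_zero_iff.mp hr) v (mem_univ v); omega
    have hcount := card_fam_matching E d hd1 hsum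
    have hF : famCard d ∅ ∅ = (2 * E).factorial / (E.factorial * 2 ^ E) := by
      rw [eq_div_iff (by positivity), ← hcount]
      unfold famCard
      push_cast; ring
    have hpos : 0 < famCard d ∅ ∅ := by rw [hF]; positivity
    have hS : fallSum d = 0 := by
      refine sum_eq_zero fun v _ => ?_
      have := hd1 v
      interval_cases d v <;> simp
    have hlog : ∑ v, Real.log (d v).factorial = 0 := by
      refine sum_eq_zero fun v _ => ?_
      have := hd1 v
      interval_cases d v <;> simp
    refine ⟨hpos, ?_⟩
    rw [hS, hlog, hF]
    simp
  | succ r ih =>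
    intro d hdM hsum hr
    obtain ⟨v, hv⟩ : ∃ v, 2 ≤ d v := by
      by_contra! h
      have : ∑ v, (d v - 1) = 0 := sum_eq_zero fun v _ => by have := h v; omega
      omega
    obtain ⟨u, hu⟩ : ∃ u, d u = 0 := by
      by_contra! h
      have : ∑ v : V, 1 < ∑ v, d v :=
        sum_lt_sum (fun a _ => Nat.one_le_iff_ne_zero.mpr (h a)) ⟨v, mem_univ v, hv⟩
      rw [sum_const, card_univ, smul_eq_mul, mul_one] at this
      omega
    have hvu : v ≠ u := by rintro rfl; omega
    obtain ⟨d', hv', hu', hne⟩ : ∃ d' : V → ℕ, d' v + 1 = d v ∧ d' u = 1 ∧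
        ∀ a, a ≠ v → a ≠ u → d' a = d a := by
      refine ⟨Function.update (Function.update d v (d v - 1)) u 1, ?_, by simp, fun a h1 h2 => ?_⟩
      · rw [Function.update_of_ne hvu, Function.update_self]; omega
      · rw [Function.update_of_ne h2, Function.update_of_ne h1]
    have hsum' : ∑ a, d' a = 2 * E := by
      have := sum_update_two (fun k => k) hvu hne
      omega
    have hr' : ∑ a, (d' a - 1) = r := by
      have := sum_update_two (fun k => k - 1) hvu hne
      omega
    have hdM' : ∀ a, d' a ≤ M := fun a => by
      by_cases h1 : a = v
      · subst h1; have := hdM a; omega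
      by_cases h2 : a = u
      · subst h2; omega
      rw [hne a h1 h2]; exact hdM a
    obtain ⟨hpos', hest'⟩ := ih d' hdM' hsum' hr'
    have hs : Sparse d' ∅ M 0 := sparse_empty hM hdM' (hsum'.symm ▸ hlarge)
    obtain ⟨hpos, hest⟩ := log_famCard_split hs hvu hv' hu hu' hne hpos'
    have htot : tot d = tot d' := by unfold tot; rw [hsum, hsum']
    refine ⟨hpos, ?_⟩
    rw [htot]
    have hdv : (d v : ℝ) = d' v + 1 := by exact_mod_cast hv'.symm
    refine abs_split_step hs.tot_pos (Nat.cast_nonneg _) (by exact_mod_cast hdM' v)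
      (by exact_mod_cast hM) ?_ ?_ hest hest' (by push_cast; ring)
    · have := sum_update_two (fun k => (k : ℝ) * ((k : ℝ) - 1)) hvu hne
      simp only [hu, hu', hdv] at this
      unfold fallSum
      push_cast at this
      linear_combination -this
    · have := sum_update_two (fun k => Real.log k.factorial) hvu hne
      simp only [hu, hu', ← hv', Nat.factorial_succ (d' v)] at this
      rw [← hv']
      push_cast at this ⊢
      rw [Real.log_mul (by positivity) (by positivity)] at this
      simp only [Nat.factorial_zero, Nat.factorial_one] at this
      linear_combination -this

/-- The number of graphs with degrees `d` when there are sufficiently many isolated vertices. -/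
lemma log_famCard_of_card_le {M E : ℕ} {d : V → ℕ} (hM : 1 ≤ M) (hlarge : 1000 * (M * M) ≤ 2 * E)
    (hcard : 2 * E ≤ Fintype.card V) (hd : ∀ v, d v ≤ M) (hsum : ∑ v, d v = 2 * E) :
    0 < famCard d ∅ ∅ ∧
    |Real.log (famCard d ∅ ∅) + ∑ v, Real.log (d v).factorial -
      Real.log ((2 * E).factorial / (E.factorial * 2 ^ E)) +
      (fallSum d / (2 * tot d) + fallSum d ^ 2 / (4 * tot d ^ 2))| ≤
      100 * (M : ℝ) ^ 4 / tot d := by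
  obtain ⟨hpos, h⟩ := log_famCard_of_excess hM hlarge hcard _ d hd hsum rfl
  refine ⟨hpos, h.trans ?_⟩
  have hN : 0 < tot d := (sparse_empty hM hd (hsum ▸ hlarge)).tot_pos
  have : ((∑ v, (d v - 1) : ℕ) : ℝ) ≤ tot d := by
    unfold tot
    exact_mod_cast sum_le_sum fun v _ => Nat.sub_le _ _
  calc _ ≤ tot d * (100 * (M : ℝ) ^ 4 / tot d ^ 2) := by gcongr
    _ = _ := by field_simp

end Chain

section Padding

variable {V W : Type*} [Fintype V] [DecidableEq V] [Fintype W] [DecidableEq W]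

lemma gdeg_map_inl (H : SimpleGraph V) (v : V) :
    gdeg (H.map (Function.Embedding.inl : V ↪ V ⊕ W)) (Sum.inl v) = gdeg H v := by
  unfold gdeg
  rw [← card_map (Function.Embedding.inl : V ↪ V ⊕ W)]
  congr 1
  ext (a | b) <;> simp [SimpleGraph.map_adj]

omit [DecidableEq V] [DecidableEq W] in
lemma gdeg_map_inr (H : SimpleGraph V) (w : W) :
    gdeg (H.map (Function.Embedding.inl : V ↪ V ⊕ W)) (Sum.inr w) = 0 := by
  simp [gdeg, SimpleGraph.map_adj]

omit [DecidableEq V] [DecidableEq W] in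
lemma map_comap_inl_of_isolated {H : SimpleGraph (V ⊕ W)} (h : ∀ w : W, gdeg H (Sum.inr w) = 0) :
    (H.comap (Function.Embedding.inl : V ↪ V ⊕ W)).map Function.Embedding.inl = H := by
  ext a b
  rcases a with a | a
  · rcases b with b | b
    · simp [SimpleGraph.map_adj]
    · have := not_adj_of_gdeg_eq_zero (h b) (Sum.inl a)
      rw [SimpleGraph.adj_comm] at this
      simp [SimpleGraph.map_adj, this]
  · have := not_adj_of_gdeg_eq_zero (h a) b
    simp [SimpleGraph.map_adj, this]

/-- Adding isolated vertices. -/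
lemma card_fam_sum (d : V → ℕ) :
    #(fam d ∅ ∅) = #(fam (Sum.elim d fun _ : W => 0) ∅ ∅) := by
  refine card_nbij' (fun H => H.map Function.Embedding.inl)
    (fun H => H.comap Function.Embedding.inl) ?_ ?_ ?_ ?_
  · intro H hH
    simp only [mem_coe, mem_fam_empty] at hH ⊢
    rintro (v | w)
    · rw [gdeg_map_inl, hH]; rfl
    · rw [gdeg_map_inr]; rfl
  · intro H hH
    simp only [mem_coe, mem_fam_empty] at hH ⊢
    intro v
    have h := hH (Sum.inl v)
    rw [← map_comap_inl_of_isolated fun w => hH (Sum.inr w), gdeg_map_inl] at h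
    exact h
  · intro H _
    exact SimpleGraph.comap_map_eq _ _
  · intro H hH
    simp only [mem_coe, mem_fam_empty] at hH
    exact map_comap_inl_of_isolated fun w => hH (Sum.inr w)

/-- The asymptotic number of graphs with sparse degree sequence `d`. -/
lemma log_famCard_empty {M E : ℕ} {d : V → ℕ} (hM : 1 ≤ M) (hlarge : 1000 * (M * M) ≤ 2 * E)
    (hd : ∀ v, d v ≤ M) (hsum : ∑ v, d v = 2 * E) :
    0 < famCard d ∅ ∅ ∧
    |Real.log (famCard d ∅ ∅) + ∑ v, Real.log (d v).factorial -
      Real.log ((2 * E).factorial / (E.factorial * 2 ^ E)) +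
      (fallSum d / (2 * tot d) + fallSum d ^ 2 / (4 * tot d ^ 2))| ≤
      100 * (M : ℝ) ^ 4 / tot d := by
  have hsum' : ∑ v, Sum.elim d (fun _ : Fin (2 * E) => 0) v = 2 * E := by simpa using hsum
  have h := log_famCard_of_card_le (d := Sum.elim d fun _ : Fin (2 * E) => 0) hM hlarge
    (by simp) (by rintro (v | w); exacts [hd v, Nat.zero_le _]) hsum'
  have e1 : famCard (Sum.elim d fun _ : Fin (2 * E) => 0) ∅ ∅ = famCard d ∅ ∅ := by
    unfold famCard; rw [← card_fam_sum]
  have e2 : tot (Sum.elim d fun _ : Fin (2 * E) => 0) = tot d := by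
    unfold tot; rw [hsum, hsum']
  have e3 : fallSum (Sum.elim d fun _ : Fin (2 * E) => 0) = fallSum d := by
    simp [fallSum]
  simpa [e1, e2, e3] using h

/-- The asymptotic number of graphs with sparse degree sequence `d` avoiding the pairs `X`. -/
lemma log_famCard {d : V → ℕ} {X : Finset (V × V)} {M x E : ℕ} (hs : Sparse d X M x)
    (hloop : ∀ p ∈ X, p.1 ≠ p.2) (hanti : ∀ p ∈ X, (p.2, p.1) ∉ X) (hsum : ∑ v, d v = 2 * E) :
    0 < famCard d X ∅ ∧
    |Real.log (famCard d X ∅) + ∑ v, Real.log (d v).factorial -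
      Real.log ((2 * E).factorial / (E.factorial * 2 ^ E)) +
      (fallSum d / (2 * tot d) + fallSum d ^ 2 / (4 * tot d ^ 2)) +
      (∑ p ∈ X, (d p.1 : ℝ) * d p.2) / tot d| ≤ 128 * ((M : ℝ) * (M + x)) ^ 2 / tot d := by
  have hlarge : 1000 * (M * M) ≤ 2 * E := by
    rw [← hsum]
    exact le_trans (by gcongr; omega) hs.large
  obtain ⟨hpos, h1⟩ := log_famCard_empty hs.one_le hlarge hs.deg_le hsum
  obtain ⟨hpos', h2⟩ := log_famCard_avoid hs hloop hanti hpos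
  refine ⟨hpos', ?_⟩
  have hN := hs.tot_pos
  have h3 : 100 * (M : ℝ) ^ 4 / tot d ≤ 100 * ((M : ℝ) * (M + x)) ^ 2 / tot d := by
    have : (M : ℝ) ^ 4 ≤ ((M : ℝ) * (M + x)) ^ 2 := by
      rw [show (M : ℝ) ^ 4 = (M * M) ^ 2 by ring]
      gcongr
      simp
    gcongr
  have h4 : 128 * ((M : ℝ) * (M + x)) ^ 2 / tot d =
      28 * ((M : ℝ) * (M + x)) ^ 2 / tot d + 100 * ((M : ℝ) * (M + x)) ^ 2 / tot d := by ring
  rw [h4]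
  refine le_trans (le_of_eq ?_) ((abs_add_le _ _).trans (add_le_add h2 (h1.trans h3)))
  congr 1
  ring

end Padding

section Translation

variable {n : ℕ}

/-- The edges of `X` as ordered pairs with increasing entries. -/
def edgePairs (X : SimpleGraph (Fin n)) : Finset (Fin n × Fin n) :=
  {p | X.Adj p.1 p.2 ∧ p.1 < p.2}

lemma inPairs_edgePairs (X : SimpleGraph (Fin n)) (a b : Fin n) :
    InPairs (edgePairs X) a b ↔ X.Adj a b := by
  simp only [InPairs, edgePairs, mem_filter, mem_univ, true_and]
  constructor
  · rintro (h | h)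
    exacts [h.1, h.1.symm]
  · intro h
    rcases lt_or_gt_of_ne h.ne with h' | h'
    exacts [Or.inl ⟨h, h'⟩, Or.inr ⟨h.symm, h'⟩]

lemma natCard_neighborSet (H : SimpleGraph (Fin n)) (v : Fin n) :
    Nat.card (H.neighborSet v) = gdeg H v := by
  rw [gdeg, Nat.card_eq_fintype_card, Fintype.card_subtype]
  rfl

lemma disjoint_edgeSet_iff (H X : SimpleGraph (Fin n)) :
    Disjoint H.edgeSet X.edgeSet ↔ ∀ a b, X.Adj a b → ¬ H.Adj a b := by
  rw [Set.disjoint_left]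
  constructor
  · intro h a b hX hH
    exact h (a := s(a, b)) hH hX
  · intro h e
    induction e with
    | h a b => exact fun hH hX => h a b hX hH

lemma gCount_eq (d : Fin n → ℕ) (X : SimpleGraph (Fin n)) :
    (gCount d X : ℝ) = famCard d (edgePairs X) ∅ := by
  unfold gCount famCard
  rw [Nat.card_eq_fintype_card, Fintype.card_subtype]
  congr 2
  ext H
  rw [mem_fam, mem_filter]
  simp only [mem_univ, true_and, natCard_neighborSet, disjoint_edgeSet_iff, inPairs_edgePairs,
    not_inPairs_empty, false_implies, implies_true, and_true]

lemma pairDeg_edgePairs_le (X : SimpleGraph (Fin n)) (v : Fin n) :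
    pairDeg (edgePairs X) v ≤ dMax (xDeg X) := by
  have : pairDeg (edgePairs X) v = xDeg X v := by
    rw [xDeg, natCard_neighborSet, pairDeg, gdeg]
    simp only [inPairs_edgePairs]
  rw [this]
  exact le_sup (f := xDeg X) (mem_univ v)

lemma pairSum_eq (X : SimpleGraph (Fin n)) (f : Fin n → ℝ) :
    pairSum X f = ∑ p ∈ edgePairs X, f p.1 * f p.2 := by
  have h1 : ∑ p ∈ edgePairs X, f p.1 * f p.2 =
      ∑ j, ∑ k, if X.Adj j k ∧ j < k then f j * f k else 0 := by
    rw [edgePairs, sum_filter, ← univ_product_univ, sum_product]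
  have h2 : ∑ j, ∑ k, (if X.Adj j k ∧ j < k then f j * f k else 0) =
      ∑ j, ∑ k, if X.Adj j k ∧ k < j then f j * f k else 0 := by
    rw [sum_comm]
    refine sum_congr rfl fun j _ => sum_congr rfl fun k _ => ?_
    rw [X.adj_comm, mul_comm]
  have h3 : ∑ j, ∑ k, (if X.Adj j k then f j * f k else 0) =
      ∑ j, ∑ k, (if X.Adj j k ∧ j < k then f j * f k else 0) +
      ∑ j, ∑ k, (if X.Adj j k ∧ k < j then f j * f k else 0) := by
    simp only [← sum_add_distrib]
    refine sum_congr rfl fun j _ => sum_congr rfl fun k _ => ?_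
    by_cases h : X.Adj j k
    · rcases lt_or_gt_of_ne h.ne with h' | h'
      · simp [h, h', h'.not_gt]
      · simp [h, h', h'.not_gt]
    · simp [h]
  unfold pairSum
  rw [h3, ← h2, h1]
  ring

lemma exists_gCount_eq {d : Fin n → ℕ} {X : SimpleGraph (Fin n)} (heven : Even (∑ j, d j))
    (hM : 1 ≤ dMax d) (hlarge : 500 * bigDelta d X ≤ eN d) :
    ∃ err : ℝ, |err| ≤ 64 * (bigDelta d X : ℝ) ^ 2 / (eN d : ℝ) ∧
      (gCount d X : ℝ) = ((2 * eN d).factorial : ℝ)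
            / (((eN d).factorial : ℝ) * 2 ^ eN d * ∏ j, ((d j).factorial : ℝ))
          * Real.exp (
              - (∑ j, (d j : ℝ) * ((d j : ℝ) - 1)) / (4 * (eN d : ℝ))
              - (∑ j, (d j : ℝ) * ((d j : ℝ) - 1))^2 / (16 * (eN d : ℝ)^2)
              - pairSum X (fun j => (d j : ℝ)) / (2 * (eN d : ℝ))
              + err) := by
  have hsum : ∑ j, d j = 2 * eN d := by
    unfold eN; have := heven.two_dvd; omega
  have hs : Sparse d (edgePairs X) (dMax d) (dMax (xDeg X)) :=
    ⟨hM, fun v => le_sup (f := d) (mem_univ v), pairDeg_edgePairs_le X, by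
      unfold bigDelta at hlarge; omega⟩
  obtain ⟨hpos, h⟩ := log_famCard hs
    (fun p hp => by simp only [edgePairs, mem_filter] at hp; exact hp.2.2.ne)
    (fun p hp hp' => by
      simp only [edgePairs, mem_filter] at hp hp'; exact lt_asymm hp.2.2 hp'.2.2) hsum
  rw [← gCount_eq] at hpos h
  rw [← pairSum_eq X (fun j => (d j : ℝ))] at h
  have htot : tot d = 2 * eN d := by unfold tot; rw [hsum]; push_cast; rfl
  have hE : (0 : ℝ) < eN d := by have := hs.tot_pos; linarith
  rw [htot] at h
  unfold fallSum at h
  have hprod : (0 : ℝ) < ∏ j, ((d j).factorial : ℝ) := prod_pos fun j _ => by positivity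
  have hlogprod : ∑ v, Real.log (d v).factorial = Real.log (∏ j, ((d j).factorial : ℝ)) :=
    (Real.log_prod fun j _ => by positivity).symm
  rw [hlogprod] at h
  set K : ℝ := (2 * eN d).factorial / ((eN d).factorial * 2 ^ eN d) with hK
  have hKpos : 0 < K := by positivity
  refine ⟨_, h.trans (le_of_eq ?_), ?_⟩
  · unfold bigDelta; push_cast; field_simp; norm_num
  · rw [← div_div, ← hK, ← Real.exp_log (div_pos hKpos hprod), ← Real.exp_add,
      Real.log_div hKpos.ne' hprod.ne', ← Real.exp_log hpos]
    congr 1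
    rw [Real.exp_log hpos]
    field_simp
    ring

end Translation

/-- Theorem 1.1 (McKay–Wormald, sparse range): if `d_max ≥ 1` and `Δ = o(E)` then
`G(d,X) = (2E)!/(E! 2^E ∏ d_j!) · exp(-Σd_j(d_j-1)/(4E) - (Σd_j(d_j-1))²/(16E²)
- Σ_{jk∈X} d_j d_k/(2E) + O(Δ²/E))`. -/
theorem stmt0
    (d : (n : ℕ) → Fin n → ℕ) (X : (n : ℕ) → SimpleGraph (Fin n))
    (heven : ∀ n, Even (∑ j, d n j))
    (hdmax : ∀ᶠ n : ℕ in atTop, 1 ≤ dMax (d n))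
    (hDelta : (fun n : ℕ => (bigDelta (d n) (X n) : ℝ))
        =o[atTop] fun n : ℕ => (eN (d n) : ℝ)) :
    ∃ C : ℝ, ∀ᶠ n : ℕ in atTop, ∃ err : ℝ,
      |err| ≤ C * (bigDelta (d n) (X n) : ℝ)^2 / (eN (d n) : ℝ) ∧
      (gCount (d n) (X n) : ℝ)
        = ((2 * eN (d n)).factorial : ℝ)
            / (((eN (d n)).factorial : ℝ) * 2 ^ eN (d n) * ∏ j, ((d n j).factorial : ℝ))
          * Real.exp (
              - (∑ j, (d n j : ℝ) * ((d n j : ℝ) - 1)) / (4 * (eN (d n) : ℝ))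
              - (∑ j, (d n j : ℝ) * ((d n j : ℝ) - 1))^2 / (16 * (eN (d n) : ℝ)^2)
              - pairSum (X n) (fun j => (d n j : ℝ)) / (2 * (eN (d n) : ℝ))
              + err) := by
  refine ⟨64, ?_⟩
  filter_upwards [hdmax, hDelta.bound (show (0 : ℝ) < 1 / 500 by norm_num)] with n hn hb
  refine exists_gCount_eq (heven n) hn ?_
  rw [Real.norm_natCast, Real.norm_natCast] at hb
  have : (500 : ℝ) * bigDelta (d n) (X n) ≤ eN (d n) := by linarith
  exact_mod_cast this
end
end

section
/- Assume conditions (★). Let Y be any graph on n vertices with Y edges (Y overloaded), and let E_{d,Y} be the number of edges that a uniformly random graph with degree sequence d has in common with Y. If Y = Ω(n^{1/5}), then for any constant δ ∈ (0, 1/10), with probability 1 − O(exp(−n^{δ})) one has E_{d,Y} = λY(1 + O(n^{−1/10+δ})). -/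
open Filter Finset Asymptotics MeasureTheory
open scoped Classical Topology

noncomputable section

/-- The number of edges a graph `H` has in common with `Y`. -/
def commonEdges {n : ℕ} (H Y : SimpleGraph (Fin n)) : ℕ :=
  Nat.card (H.edgeSet ∩ Y.edgeSet : Set (Sym2 (Fin n)))

section Switching

variable {V : Type*}

lemma card_insert_erase {s : Finset V} {a b : V} (ha : a ∈ s) (hb : b ∉ s) :
    (insert b (s.erase a)).card = s.card := by
  rw [card_insert_of_notMem (by grind), card_erase_add_one ha]

lemma card_sdiff_sub_card_sdiff (s t : Finset V) :
    ((s \ t).card : ℝ) - (t \ s).card = s.card - t.card := by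
  have h1 := card_sdiff_add_card_inter s t
  have h2 := card_sdiff_add_card_inter t s
  rw [inter_comm] at h2
  have h1' : ((s \ t).card : ℝ) + (s ∩ t).card = s.card := by exact_mod_cast h1
  have h2' : ((t \ s).card : ℝ) + (s ∩ t).card = t.card := by exact_mod_cast h2
  linarith

/-- The neighbours of `v` in `G`, as a finset. -/
def nbrs [Fintype V] (G : SimpleGraph V) (v : V) : Finset V := univ.filter fun w => G.Adj v w

@[simp] lemma mem_nbrs [Fintype V] {G : SimpleGraph V} {v w : V} : w ∈ nbrs G v ↔ G.Adj v w := by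
  simp [nbrs]

/-- The graphs with degree sequence `d` that contain `X`. -/
def degFam [Fintype V] (d : V → ℕ) (X : SimpleGraph V) : Finset (SimpleGraph V) :=
  univ.filter fun G => (∀ v, (nbrs G v).card = d v) ∧ X ≤ G

lemma mem_degFam [Fintype V] {d : V → ℕ} {X G : SimpleGraph V} :
    G ∈ degFam d X ↔ (∀ v, (nbrs G v).card = d v) ∧ X ≤ G := by
  simp [degFam]

/-- The 4-cycle with edges `xv`, `vy`, `yz`, `zx`. -/
def fourCycle (v z x y : V) : SimpleGraph V :=
  SimpleGraph.fromEdgeSet {s(x, v), s(y, z), s(y, v), s(x, z)}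

/-- The graph obtained from `G` by toggling the edges of the 4-cycle `xvyz`. -/
def toggle (v z x y : V) (G : SimpleGraph V) : SimpleGraph V := symmDiff G (fourCycle v z x y)

lemma toggle_injective (v z x y : V) : Function.Injective (toggle v z x y) :=
  symmDiff_left_injective _

lemma toggle_adj {v z x y : V} {G : SimpleGraph V} {a b : V} :
    (toggle v z x y G).Adj a b ↔
      ¬ (G.Adj a b ↔ a ≠ b ∧ (s(a, b) = s(x, v) ∨ s(a, b) = s(y, z) ∨ s(a, b) = s(y, v) ∨
        s(a, b) = s(x, z))) := by
  simp only [toggle, fourCycle, symmDiff, SimpleGraph.sup_adj, SimpleGraph.sdiff_adj,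
    SimpleGraph.fromEdgeSet_adj, Set.mem_insert_iff, Set.mem_singleton_iff]
  tauto

/-- The configuration in which the edges `xv`, `yz` can be replaced by `yv`, `xz`. -/
structure Switchable (X G : SimpleGraph V) (v z x y : V) : Prop where
  xv : G.Adj x v
  yz : G.Adj y z
  yv : ¬ G.Adj y v
  xz : ¬ G.Adj x z
  hxz : x ≠ z
  hyv : y ≠ v
  Xxv : ¬ X.Adj x v
  Xyz : ¬ X.Adj y z

namespace Switchable

variable {X G : SimpleGraph V} {v z x y : V}

lemma hvz (h : Switchable X G v z x y) : v ≠ z := by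
  rintro rfl; exact h.xz h.xv

lemma hxy (h : Switchable X G v z x y) : x ≠ y := by
  rintro rfl; exact h.xz h.yz

variable [Fintype V]

lemma nbrs_v (h : Switchable X G v z x y) :
    nbrs (toggle v z x y G) v = insert y ((nbrs G v).erase x) := by
  have := h.hvz; have := h.hxy; have := h.xv.ne; have := h.yz.ne
  have h1 := h.xv; have h2 := h.yz; have h3 := h.yv; have h4 := h.xz
  have := h.hxz; have := h.hyv
  ext a
  have := G.adj_comm a v
  simp only [mem_nbrs, toggle_adj, Sym2.eq_iff, mem_insert, mem_erase]
  grind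

lemma nbrs_z (h : Switchable X G v z x y) :
    nbrs (toggle v z x y G) z = insert x ((nbrs G z).erase y) := by
  have := h.hvz; have := h.hxy; have := h.xv.ne; have := h.yz.ne
  have h1 := h.xv; have h2 := h.yz; have h3 := h.yv; have h4 := h.xz
  have := h.hxz; have := h.hyv
  ext a
  have := G.adj_comm a z
  simp only [mem_nbrs, toggle_adj, Sym2.eq_iff, mem_insert, mem_erase]
  grind

lemma nbrs_x (h : Switchable X G v z x y) :
    nbrs (toggle v z x y G) x = insert z ((nbrs G x).erase v) := by
  have := h.hvz; have := h.hxy; have := h.xv.ne; have := h.yz.ne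
  have h1 := h.xv; have h2 := h.yz; have h3 := h.yv; have h4 := h.xz
  have := h.hxz; have := h.hyv
  ext a
  simp only [mem_nbrs, toggle_adj, Sym2.eq_iff, mem_insert, mem_erase]
  grind

lemma nbrs_y (h : Switchable X G v z x y) :
    nbrs (toggle v z x y G) y = insert v ((nbrs G y).erase z) := by
  have := h.hvz; have := h.hxy; have := h.xv.ne; have := h.yz.ne
  have h1 := h.xv; have h2 := h.yz; have h3 := h.yv; have h4 := h.xz
  have := h.hxz; have := h.hyv
  ext a
  simp only [mem_nbrs, toggle_adj, Sym2.eq_iff, mem_insert, mem_erase]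
  grind

lemma nbrs_of_ne {a : V} (hv : a ≠ v) (hz : a ≠ z) (hx : a ≠ x) (hy : a ≠ y) :
    nbrs (toggle v z x y G) a = nbrs G a := by
  ext b
  simp only [mem_nbrs, toggle_adj, Sym2.eq_iff]
  grind

lemma mem_degFam (h : Switchable X G v z x y) {d : V → ℕ} (hG : G ∈ degFam d X) :
    toggle v z x y G ∈ degFam d X := by
  rw [_root_.mem_degFam] at hG ⊢
  refine ⟨fun a => ?_, fun a b hab => ?_⟩
  · rw [← hG.1 a]
    have h1 := h.xv; have h2 := h.yz; have h3 := h.yv; have h4 := h.xz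
    by_cases hv : a = v
    · subst hv; rw [h.nbrs_v, card_insert_erase] <;> simp [G.adj_comm, *]
    by_cases hz : a = z
    · subst hz; rw [h.nbrs_z, card_insert_erase] <;> simp [G.adj_comm, *]
    by_cases hx : a = x
    · subst hx; rw [h.nbrs_x, card_insert_erase] <;> simp [*]
    by_cases hy : a = y
    · subst hy; rw [h.nbrs_y, card_insert_erase] <;> simp [*]
    rw [nbrs_of_ne hv hz hx hy]
  · have hg := hG.2 hab
    rw [toggle_adj]
    have h1 := h.Xxv; have h2 := h.Xyz; have h3 := h.yv; have h4 := h.xz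
    have e1 := X.adj_comm a b; have e2 := G.adj_comm a b
    simp only [Sym2.eq_iff]
    grind

end Switchable

/-- Double counting along a family of injections. -/
lemma sum_card_le_of_injective {α ι : Type*} (A B : Finset α) (f : α → Finset ι)
    (g : α → Finset ι) (φ : ι → α → α) (hφ : ∀ i, Function.Injective (φ i))
    (hmem : ∀ a ∈ A, ∀ i ∈ f a, φ i a ∈ B ∧ i ∈ g (φ i a)) :
    ∑ a ∈ A, (f a).card ≤ ∑ b ∈ B, (g b).card := by
  rw [← card_sigma, ← card_sigma]
  refine card_le_card_of_injOn (fun p => ⟨φ p.2 p.1, p.2⟩) ?_ ?_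
  · rintro ⟨a, i⟩ h
    simp only [coe_sigma, Set.mem_sigma_iff, mem_coe] at h ⊢
    exact hmem a h.1 i h.2
  · rintro ⟨a, i⟩ _ ⟨b, j⟩ _ h
    simp only [Sigma.mk.injEq, heq_eq_eq] at h ⊢
    obtain ⟨h1, rfl⟩ := h
    exact ⟨hφ _ h1, rfl⟩

variable [Fintype V]

/-- Toggling matches the graphs with `uv` present and `uz` absent against the graphs with `uz`
present and `uv` absent. -/
lemma card_edge_compare (d : V → ℕ) (X : SimpleGraph V) {u v z : V} {k M : ℝ}
    (huz : u ≠ z) (hX : ¬ X.Adj u v)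
    (hk : ((nbrs X z).card : ℝ) ≤ k) (hM : |(d v : ℝ) - d z| ≤ M) (t : ℕ) :
    (((degFam d X).filter fun G => (G.Adj u v ∧ ¬ G.Adj u z) ∧
      (nbrs G z \ nbrs G v).card = t).card : ℝ) * (t - 1 - k) ≤
    (((degFam d X).filter fun G => (¬ G.Adj u v ∧ G.Adj u z) ∧
      (nbrs G z \ nbrs G v).card = t).card : ℝ) * (t + M) := by
  set A := (degFam d X).filter fun G => (G.Adj u v ∧ ¬ G.Adj u z) ∧
      (nbrs G z \ nbrs G v).card = t
  set B := (degFam d X).filter fun G => (¬ G.Adj u v ∧ G.Adj u z) ∧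
      (nbrs G z \ nbrs G v).card = t
  have key := sum_card_le_of_injective A B
    (fun G => ((nbrs G z \ nbrs G v).erase v) \ nbrs X z)
    (fun G => nbrs G v \ nbrs G z) (fun y => toggle v z u y) (fun y => toggle_injective _ _ _ _) ?_
  · have h1 : (A.card : ℝ) * (t - 1 - k) ≤
        ∑ G ∈ A, (((((nbrs G z \ nbrs G v).erase v) \ nbrs X z).card : ℕ) : ℝ) := by
      rw [← nsmul_eq_mul]
      refine card_nsmul_le_sum _ _ _ fun G hG => ?_
      have ht : (nbrs G z \ nbrs G v).card = t := (mem_filter.1 hG).2.2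
      have e1 : (nbrs G z \ nbrs G v).card - 1 ≤ ((nbrs G z \ nbrs G v).erase v).card :=
        pred_card_le_card_erase
      have e2 := le_card_sdiff (nbrs X z) ((nbrs G z \ nbrs G v).erase v)
      have e3 : t ≤ (((nbrs G z \ nbrs G v).erase v) \ nbrs X z).card + (nbrs X z).card + 1 := by
        omega
      have e4 : (t : ℝ) ≤ (((nbrs G z \ nbrs G v).erase v) \ nbrs X z).card +
        (nbrs X z).card + 1 := by exact_mod_cast e3
      linarith
    have h2 : ∑ G ∈ B, ((nbrs G v \ nbrs G z).card : ℝ) ≤ (B.card : ℝ) * (t + M) := by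
      rw [← nsmul_eq_mul]
      refine sum_le_card_nsmul _ _ _ fun G hG => ?_
      have ht : (nbrs G z \ nbrs G v).card = t := (mem_filter.1 hG).2.2
      have hd := (mem_degFam.1 (mem_filter.1 hG).1).1
      have := card_sdiff_sub_card_sdiff (nbrs G v) (nbrs G z)
      rw [hd, hd, ht] at this
      linarith [le_abs_self ((d v : ℝ) - d z)]
    refine h1.trans (le_trans ?_ h2)
    exact_mod_cast key
  · intro G hG y hy
    simp only [A, mem_filter] at hG
    obtain ⟨hG, ⟨h1, h2⟩, ht⟩ := hG
    simp only [Finset.mem_sdiff, mem_erase, mem_nbrs] at hy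
    obtain ⟨⟨hyv, hy1, hy2⟩, hy3⟩ := hy
    have hs : Switchable X G v z u y := 
      ⟨h1, hy1.symm, fun h => hy2 h.symm, h2, huz, hyv, hX, fun h => hy3 h.symm⟩
    have hvz := hs.hvz
    have huy := hs.hxy
    have e1 : u ∉ nbrs (toggle v z u y G) v := by
      rw [hs.nbrs_v]; simp [huy]
    have e2 : u ∈ nbrs (toggle v z u y G) z := by
      rw [hs.nbrs_z]; simp
    refine ⟨?_, ?_⟩
    · simp only [B, mem_filter]
      refine ⟨hs.mem_degFam hG, ⟨fun h => e1 (mem_nbrs.2 h.symm), ?_⟩, ?_⟩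
      · exact (mem_nbrs.1 e2).symm
      · rw [← ht, hs.nbrs_v, hs.nbrs_z]
        rw [← card_insert_erase (s := nbrs G z \ nbrs G v) (a := y) (b := u)
          (by simp [hy1, hy2]) (by simp [h1.symm])]
        congr 1
        ext a
        simp only [Finset.mem_sdiff, mem_insert, mem_erase, mem_nbrs]
        grind
    · rw [Finset.mem_sdiff, hs.nbrs_v, hs.nbrs_z]
      simp [huy.symm]

/-- Counting pairs `(z, x)` with `x` adjacent to `v` but not to `z`. -/
lemma sum_card_nbrs_sdiff_ge {d : V → ℕ} {G : SimpleGraph V} (hG : ∀ v, (nbrs G v).card = d v)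
    {D M : ℝ} (hd : ∀ j, |(d j : ℝ) - D| ≤ M) (hD : D + M ≤ Fintype.card V) (v : V) :
    (D - M) * (Fintype.card V - D - M) ≤ ∑ z, ((nbrs G v \ nbrs G z).card : ℝ) := by
  have h1 : ∑ z, (nbrs G v \ nbrs G z).card = ∑ x ∈ nbrs G v, (nbrs G x)ᶜ.card := by
    have := sum_card_bipartiteAbove_eq_sum_card_bipartiteBelow (fun z x => ¬ G.Adj z x)
      (s := univ) (t := nbrs G v)
    convert this using 3
    · ext a; simp [mem_bipartiteAbove]
    · ext a; simp [mem_bipartiteBelow, G.adj_comm]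
  have h2 : ∀ x ∈ nbrs G v, (Fintype.card V - D - M : ℝ) ≤ ((nbrs G x)ᶜ.card : ℝ) := by
    intro x _
    rw [card_compl, Nat.cast_sub (card_le_univ _), hG]
    linarith [le_abs_self ((d x : ℝ) - D), hd x]
  have h3 := card_nsmul_le_sum _ _ _ h2
  rw [nsmul_eq_mul, hG] at h3
  have h4 : ∑ z, ((nbrs G v \ nbrs G z).card : ℝ) = ∑ x ∈ nbrs G v, ((nbrs G x)ᶜ.card : ℝ) := by
    exact_mod_cast h1
  rw [h4]
  refine le_trans (mul_le_mul_of_nonneg_right ?_ (by linarith)) h3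
  linarith [neg_abs_le ((d v : ℝ) - D), hd v]

/-- Few graphs with given degrees have two vertices with nearly equal neighbourhoods. -/
lemma card_small_sdiff_le (d : V → ℕ) (X : SimpleGraph V) {v w : V} (hvw : v ≠ w)
    {D M k L Q : ℝ} (T : ℕ) (hd : ∀ j, |(d j : ℝ) - D| ≤ M) (hD : D + M ≤ Fintype.card V)
    (hk : ∀ j, ((nbrs X j).card : ℝ) ≤ k) (hL : T + 2 * M + 2 + k ≤ L) (hQ : 0 < Q)
    (hQL : Fintype.card V * (Q + L) ≤ (D - M) * (Fintype.card V - D - M)) :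
    (((degFam d X).filter fun G => (nbrs G w \ nbrs G v).card ≤ T).card : ℝ) ≤
      (L / Q) ^ 2 * (degFam d X).card := by
  have hM : 0 ≤ M := (abs_nonneg _).trans (hd v)
  have hk0 : 0 ≤ k := (Nat.cast_nonneg _).trans (hk v)
  have hn : (0 : ℝ) < Fintype.card V := by
    have : Nonempty V := ⟨v⟩
    exact_mod_cast Fintype.card_pos
  set A := (degFam d X).filter fun G => (nbrs G w \ nbrs G v).card ≤ T
  set B := (degFam d X).filter fun G => (nbrs G w \ nbrs G v).card ≤ T + 1
  have hdd : ∀ i j, (d i : ℝ) - d j ≤ 2 * M := fun i j => by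
    linarith [(abs_le.1 (hd i)).2, (abs_le.1 (hd j)).1]
  have key := sum_card_le_of_injective A B
    (fun G => univ.sigma fun z => 
      ((((nbrs G v \ nbrs G z) \ (nbrs G v \ nbrs G w)).erase z) \ nbrs X v) ×ˢ
      (((((nbrs G z \ nbrs G v) \ (nbrs G w \ nbrs G v)).erase v).erase w) \ nbrs X z))
    (fun G => univ.sigma fun _ : V => (nbrs G w \ nbrs G v) ×ˢ (nbrs G v \ nbrs G w))
    (fun p => toggle v p.1 p.2.1 p.2.2) (fun y => toggle_injective _ _ _ _) ?_
  · simp only [card_sigma, card_product] at key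
    have h1 : (A.card : ℝ) * (Fintype.card V * Q ^ 2) ≤ ∑ G ∈ A, ∑ z, 
        ((((((nbrs G v \ nbrs G z) \ (nbrs G v \ nbrs G w)).erase z) \ nbrs X v).card : ℝ) *
        ((((((nbrs G z \ nbrs G v) \ (nbrs G w \ nbrs G v)).erase v).erase w) \ nbrs X z).card : ℝ))
        := by
      rw [← nsmul_eq_mul]
      refine card_nsmul_le_sum _ _ _ fun G hG => ?_
      have ht : (nbrs G w \ nbrs G v).card ≤ T := (mem_filter.1 hG).2
      have ht' : ((nbrs G w \ nbrs G v).card : ℝ) ≤ T := by exact_mod_cast ht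
      have hdG := (mem_degFam.1 (mem_filter.1 hG).1).1
      set f : V → ℝ := fun z => max ((nbrs G v \ nbrs G z).card - L) 0
      have f0 : ∀ z, 0 ≤ f z := fun z => le_max_right _ _
      have hsum : Fintype.card V * Q ≤ ∑ z, f z := by
        have e1 := sum_card_nbrs_sdiff_ge hdG hd hD v
        have e2 : ∑ z, (((nbrs G v \ nbrs G z).card : ℝ) - L) ≤ ∑ z, f z :=
          sum_le_sum fun z _ => le_max_left _ _
        rw [sum_sub_distrib, sum_const, nsmul_eq_mul, card_univ] at e2
        linarith
      have hcs := sq_sum_le_card_mul_sum_sq (s := univ) (f := f)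
      have e3 : (Fintype.card V * Q) ^ 2 ≤ Fintype.card V * ∑ z, f z ^ 2 :=
        (pow_le_pow_left₀ (by positivity) hsum 2).trans hcs
      have e4 : Fintype.card V * Q ^ 2 ≤ ∑ z, f z ^ 2 := by
        refine le_of_mul_le_mul_left ?_ hn
        linarith
      refine e4.trans (sum_le_sum fun z _ => ?_)
      rw [pow_two]
      have g1 := card_sdiff_sub_card_sdiff (nbrs G v) (nbrs G w)
      have g2 := card_sdiff_sub_card_sdiff (nbrs G z) (nbrs G v)
      rw [hdG, hdG] at g1 g2
      refine mul_le_mul ?_ ?_ (f0 z) (Nat.cast_nonneg _)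
      · refine max_le ?_ (Nat.cast_nonneg _)
        have i1 := le_card_sdiff (nbrs G v \ nbrs G w) (nbrs G v \ nbrs G z)
        have i2 := pred_card_le_card_erase (s := (nbrs G v \ nbrs G z) \ (nbrs G v \ nbrs G w))
          (a := z)
        have i3 := le_card_sdiff (nbrs X v)
          (((nbrs G v \ nbrs G z) \ (nbrs G v \ nbrs G w)).erase z)
        have i4 : (nbrs G v \ nbrs G z).card ≤ 
          ((((nbrs G v \ nbrs G z) \ (nbrs G v \ nbrs G w)).erase z) \ nbrs X v).card +
            (nbrs X v).card + 1 + (nbrs G v \ nbrs G w).card := by omega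
        have i5 : ((nbrs G v \ nbrs G z).card : ℝ) ≤
          ((((nbrs G v \ nbrs G z) \ (nbrs G v \ nbrs G w)).erase z) \ nbrs X v).card +
            (nbrs X v).card + 1 + (nbrs G v \ nbrs G w).card := by exact_mod_cast i4
        linarith [hdd v w, hk v]
      · refine max_le ?_ (Nat.cast_nonneg _)
        have i1 := le_card_sdiff (nbrs G w \ nbrs G v) (nbrs G z \ nbrs G v)
        have i2 := pred_card_le_card_erase (s := (nbrs G z \ nbrs G v) \ (nbrs G w \ nbrs G v))
          (a := v)
        have i2' := pred_card_le_card_erase 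
          (s := ((nbrs G z \ nbrs G v) \ (nbrs G w \ nbrs G v)).erase v) (a := w)
        have i3 := le_card_sdiff (nbrs X z)
          ((((nbrs G z \ nbrs G v) \ (nbrs G w \ nbrs G v)).erase v).erase w)
        have i4 : (nbrs G z \ nbrs G v).card ≤ 
          (((((nbrs G z \ nbrs G v) \ (nbrs G w \ nbrs G v)).erase v).erase w) \ nbrs X z).card +
            (nbrs X z).card + 2 + (nbrs G w \ nbrs G v).card := by omega
        have i5 : ((nbrs G z \ nbrs G v).card : ℝ) ≤
          (((((nbrs G z \ nbrs G v) \ (nbrs G w \ nbrs G v)).erase v).erase w) \ nbrs X z).card +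
            (nbrs X z).card + 2 + (nbrs G w \ nbrs G v).card := by exact_mod_cast i4
        linarith [hdd v z, hk z]
    have h2 : ∑ G ∈ B, ∑ _z : V, 
        (((nbrs G w \ nbrs G v).card : ℝ) * (nbrs G v \ nbrs G w).card) ≤ 
        (B.card : ℝ) * (Fintype.card V * L ^ 2) := by
      rw [← nsmul_eq_mul]
      refine sum_le_card_nsmul _ _ _ fun G hG => ?_
      have ht : (nbrs G w \ nbrs G v).card ≤ T + 1 := (mem_filter.1 hG).2
      have ht' : ((nbrs G w \ nbrs G v).card : ℝ) ≤ T + 1 := by exact_mod_cast ht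
      have hdG := (mem_degFam.1 (mem_filter.1 hG).1).1
      have g1 := card_sdiff_sub_card_sdiff (nbrs G v) (nbrs G w)
      rw [hdG, hdG] at g1
      rw [sum_const, nsmul_eq_mul, card_univ, pow_two]
      refine mul_le_mul_of_nonneg_left (mul_le_mul ?_ ?_ (Nat.cast_nonneg _) ?_) hn.le
      · linarith
      · linarith [hdd v w]
      · linarith [(Nat.cast_nonneg T : (0:ℝ) ≤ T)]
    have h3 : (A.card : ℝ) * (Fintype.card V * Q ^ 2) ≤ B.card * (Fintype.card V * L ^ 2) := by
      refine h1.trans (le_trans ?_ h2)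
      exact_mod_cast key
    have h4 : (B.card : ℝ) ≤ (degFam d X).card := by
      exact_mod_cast card_filter_le _ _
    have h5 : (A.card : ℝ) * Q ^ 2 ≤ B.card * L ^ 2 := by
      refine le_of_mul_le_mul_left ?_ hn
      linarith
    rw [div_pow, div_mul_eq_mul_div, le_div_iff₀ (by positivity)]
    nlinarith [mul_le_mul_of_nonneg_right h4 (sq_nonneg L)]
  · rintro G hG ⟨z, x, y⟩ hy
    simp only [A, mem_filter] at hG
    obtain ⟨hG, ht⟩ := hG
    simp only [mem_sigma, mem_univ, true_and, mem_product, Finset.mem_sdiff, mem_erase, mem_nbrs,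
      not_and, not_not] at hy
    obtain ⟨⟨⟨hxz, ⟨hx1, hx2⟩, hx3⟩, hx4⟩, ⟨⟨hyw, hyv, ⟨hy1, hy2⟩, hy3⟩, hy4⟩⟩ := hy
    have hs : Switchable X G v z x y := 
      ⟨hx1.symm, hy1.symm, fun h => hy2 h.symm, fun h => hx2 h.symm, hxz, hyv,
        fun h => hx4 h.symm, fun h => hy4 h.symm⟩
    have hxw : G.Adj w x := hx3 hx1
    have hyw' : ¬ G.Adj w y := fun h => hy2 (hy3 h)
    have hzw : w ≠ z := by rintro rfl; exact hx2 hxw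
    have e0 : nbrs (toggle v z x y G) w = nbrs G w :=
      Switchable.nbrs_of_ne hvw.symm hzw hxw.ne hyw.symm
    have hxy := hs.hxy
    refine ⟨?_, ?_⟩
    · simp only [B, mem_filter]
      refine ⟨hs.mem_degFam hG, ?_⟩
      rw [e0, hs.nbrs_v]
      refine (card_le_card (t := insert x (nbrs G w \ nbrs G v)) ?_).trans
        ((card_insert_le _ _).trans (by omega))
      intro a
      simp only [Finset.mem_sdiff, mem_insert, mem_erase, mem_nbrs]
      tauto
    · simp only [mem_sigma, mem_univ, true_and, mem_product, Finset.mem_sdiff, e0, hs.nbrs_v, mem_insert,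
        mem_erase, mem_nbrs]
      tauto

/-- The numbers of graphs containing `uv`, resp. `uz`, are nearly equal if most graphs separate the
neighbourhoods of `v` and `z`. -/
lemma card_edge_sub_le (d : V → ℕ) (X : SimpleGraph V) {u v z : V} {k M : ℝ}
    (huz : u ≠ z) (hX : ¬ X.Adj u v)
    (hk : ((nbrs X z).card : ℝ) ≤ k) (hM : |(d v : ℝ) - d z| ≤ M) (T : ℕ) (hT : k < T) :
    (((degFam d X).filter fun G => G.Adj u v).card : ℝ) ≤
      ((degFam d X).filter fun G => G.Adj u z).card +
      (M + 1 + k) / (T - k) * (degFam d X).card +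
      ((degFam d X).filter fun G => (nbrs G z \ nbrs G v).card ≤ T).card := by
  have hM0 : 0 ≤ M := (abs_nonneg _).trans hM
  have hk0 : 0 ≤ k := (Nat.cast_nonneg _).trans hk
  set F := degFam d X
  set ρ := (M + 1 + k) / (T - k)
  have hTk : 0 < (T : ℝ) - k := by linarith
  have hρ : 0 ≤ ρ := by positivity
  set A := F.filter fun G => G.Adj u v ∧ ¬ G.Adj u z
  set B := F.filter fun G => ¬ G.Adj u v ∧ G.Adj u z
  set S := F.filter fun G => (nbrs G z \ nbrs G v).card ≤ T
  set A' := A.filter fun G => ¬ (nbrs G z \ nbrs G v).card ≤ T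
  set B' := B.filter fun G => ¬ (nbrs G z \ nbrs G v).card ≤ T
  have hAB : (A'.card : ℝ) ≤ (1 + ρ) * B'.card := by
    have hfib : ∀ C : Finset (SimpleGraph V),
        ((C.filter fun G => ¬ (nbrs G z \ nbrs G v).card ≤ T).card : ℝ) =
        ∑ t ∈ Ioc T (Fintype.card V),
          ((C.filter fun G => (nbrs G z \ nbrs G v).card = t).card : ℝ) := by
      intro C
      rw [card_eq_sum_card_fiberwise (f := fun G => (nbrs G z \ nbrs G v).card)
        (t := Ioc T (Fintype.card V))]
      · push_cast
        refine sum_congr rfl fun t ht => ?_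
        congr 2
        rw [filter_filter]
        refine filter_congr fun G _ => ?_
        have := (mem_Ioc.1 ht).1
        constructor
        · exact fun h => h.2
        · exact fun h => ⟨by omega, h⟩
      · intro G hG
        simp only [coe_filter, Set.mem_ofPred_eq] at hG
        simp only [coe_Ioc, Set.mem_Ioc]
        exact ⟨by omega, card_le_univ _⟩
    rw [hfib, hfib, mul_sum]
    refine sum_le_sum fun t ht => ?_
    have h := card_edge_compare d X huz hX hk hM t
    simp only [← filter_filter] at h
    have h' : ((A.filter fun G => (nbrs G z \ nbrs G v).card = t).card : ℝ) * (t - 1 - k) ≤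
      ((B.filter fun G => (nbrs G z \ nbrs G v).card = t).card : ℝ) * (t + M) := by
      simpa only [A, B, F, ← filter_filter] using h
    have htT : (T : ℝ) + 1 ≤ t := by exact_mod_cast (mem_Ioc.1 ht).1
    have hpos : 0 < (t : ℝ) - 1 - k := by linarith
    have hfac : (t : ℝ) + M ≤ (1 + ρ) * (t - 1 - k) := by
      have e1 : ρ * (T - k) = M + 1 + k := div_mul_cancel₀ _ hTk.ne'
      have e2 : ρ * (T - k) ≤ ρ * (t - 1 - k) := mul_le_mul_of_nonneg_left (by linarith) hρ
      linarith
    refine le_of_mul_le_mul_right ?_ hpos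
    refine h'.trans ?_
    calc _ ≤ ((B.filter fun G => (nbrs G z \ nbrs G v).card = t).card : ℝ) *
            ((1 + ρ) * (t - 1 - k)) := mul_le_mul_of_nonneg_left hfac (Nat.cast_nonneg _)
      _ = _ := by ring
  have hA : (A.card : ℝ) ≤ A'.card + S.card := by
    have : A.card = (A.filter fun G => (nbrs G z \ nbrs G v).card ≤ T).card + A'.card :=
      (card_filter_add_card_filter_not _).symm
    have h2 : (A.filter fun G => (nbrs G z \ nbrs G v).card ≤ T).card ≤ S.card :=
      card_le_card (filter_subset_filter _ (filter_subset _ _))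
    have h3 : A.card ≤ A'.card + S.card := by omega
    exact_mod_cast h3
  have hB : (B'.card : ℝ) ≤ B.card := by exact_mod_cast card_filter_le _ _
  have hBF : (B.card : ℝ) ≤ F.card := by exact_mod_cast card_filter_le _ _
  have huv' : (F.filter fun G => G.Adj u v).card =
      ((F.filter fun G => G.Adj u v).filter fun G => G.Adj u z).card + A.card := by
    rw [← card_filter_add_card_filter_not (s := F.filter fun G => G.Adj u v) (fun G => G.Adj u z)]
    simp only [A, filter_filter]
  have huz' : (F.filter fun G => G.Adj u z).card =
      ((F.filter fun G => G.Adj u v).filter fun G => G.Adj u z).card + B.card := by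
    rw [← card_filter_add_card_filter_not (s := F.filter fun G => G.Adj u z) (fun G => G.Adj u v)]
    simp only [B, filter_filter, and_comm]
  rw [huv', huz']
  push_cast
  nlinarith [mul_le_mul_of_nonneg_left (hB.trans hBF) hρ]

lemma card_nbrs_sum (d : V → ℕ) (X : SimpleGraph V) (u : V) :
    ∑ z, ((degFam d X).filter fun G => G.Adj u z).card = d u * (degFam d X).card := by
  have := sum_card_bipartiteAbove_eq_sum_card_bipartiteBelow (fun z (G : SimpleGraph V) => G.Adj u z)
      (s := univ) (t := degFam d X)
  simp only [bipartiteAbove, bipartiteBelow] at this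
  rw [this, mul_comm, ← smul_eq_mul]
  exact sum_const_nat fun G hG => (mem_degFam.1 hG).1 u

/-- Upper bound for the probability of an edge, given a set of forced edges. -/
lemma card_edge_le (d : V → ℕ) (X : SimpleGraph V) {u v : V} (huv : u ≠ v) (hX : ¬ X.Adj u v)
    {D M k L Q : ℝ} (T : ℕ) (hd : ∀ j, |(d j : ℝ) - D| ≤ M) (hD : D + M ≤ Fintype.card V)
    (hk : ∀ j, ((nbrs X j).card : ℝ) ≤ k) (hL : T + 2 * M + 2 + k ≤ L) (hQ : 0 < Q)
    (hQL : Fintype.card V * (Q + L) ≤ (D - M) * (Fintype.card V - D - M))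
    (hT : k < T) (hn : 2 < Fintype.card V) :
    (((degFam d X).filter fun G => G.Adj u v).card : ℝ) ≤
      ((D + M) / (Fintype.card V - 2) + (2 * M + 1 + k) / (T - k) + (L / Q) ^ 2) *
        (degFam d X).card := by
  have hn' : (0 : ℝ) < Fintype.card V - 2 := by
    have : (2 : ℝ) < Fintype.card V := by exact_mod_cast hn
    linarith
  have hM : ∀ z, |(d v : ℝ) - d z| ≤ 2 * M := fun z => by
    rw [abs_le]
    constructor <;>
      linarith [(abs_le.1 (hd v)).2, (abs_le.1 (hd z)).1, (abs_le.1 (hd v)).1, (abs_le.1 (hd z)).2]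
  have h1 : ∀ z ∈ univ \ ({u, v} : Finset V),
      (((degFam d X).filter fun G => G.Adj u v).card : ℝ) ≤
      ((degFam d X).filter fun G => G.Adj u z).card +
        ((2 * M + 1 + k) / (T - k) + (L / Q) ^ 2) * (degFam d X).card := by
    intro z hz
    simp only [Finset.mem_sdiff, mem_univ, true_and, mem_insert, mem_singleton, not_or] at hz
    have e1 := card_edge_sub_le d X (Ne.symm hz.1) hX (hk z) (hM z) T hT
    have e2 := card_small_sdiff_le d X (Ne.symm hz.2) T hd hD hk hL hQ hQL
    linarith
  have h2 := card_nsmul_le_sum _ _ _ h1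
  have hcard : ((univ \ ({u, v} : Finset V)).card : ℝ) = Fintype.card V - 2 := by
    rw [card_sdiff_of_subset (subset_univ _), card_pair huv, card_univ, Nat.cast_sub hn.le]
    simp
  rw [nsmul_eq_mul, sum_add_distrib, sum_const, nsmul_eq_mul, hcard] at h2
  have h3 : ∑ z ∈ univ \ ({u, v} : Finset V),
      (((degFam d X).filter fun G => G.Adj u z).card : ℝ) ≤ (D + M) * (degFam d X).card := by
    refine (sum_le_sum_of_subset_of_nonneg (subset_univ _)
      fun _ _ _ => Nat.cast_nonneg _).trans ?_
    have e := card_nbrs_sum d X u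
    have e' : ∑ z, (((degFam d X).filter fun G => G.Adj u z).card : ℝ) =
      d u * (degFam d X).card := by exact_mod_cast e
    rw [e']
    exact mul_le_mul_of_nonneg_right (by linarith [(abs_le.1 (hd u)).2]) (Nat.cast_nonneg _)
  refine le_of_mul_le_mul_left ?_ hn'
  refine h2.trans ((add_le_add_left h3 _).trans (le_of_eq ?_))
  field_simp
  ring

/-- Upper bound for the number of graphs containing a given small set of edges. -/
lemma card_superset_le (d : V → ℕ) {D M k L Q p : ℝ} (T : ℕ) (hd : ∀ j, |(d j : ℝ) - D| ≤ M)
    (hD : D + M ≤ Fintype.card V) (hL : T + 2 * M + 2 + k ≤ L) (hQ : 0 < Q)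
    (hQL : Fintype.card V * (Q + L) ≤ (D - M) * (Fintype.card V - D - M))
    (hT : k < T) (hn : 2 < Fintype.card V)
    (hp : (D + M) / (Fintype.card V - 2) + (2 * M + 1 + k) / (T - k) + (L / Q) ^ 2 ≤ p)
    (hp0 : 0 ≤ p) (F : Finset (Sym2 V)) (hFk : (F.card : ℝ) ≤ k) (hF : ∀ e ∈ F, ¬ e.IsDiag) :
    ((degFam d (SimpleGraph.fromEdgeSet (F : Set (Sym2 V)))).card : ℝ) ≤
      p ^ F.card * (degFam d ⊥).card := by
  induction F using Finset.induction_on with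
  | empty => simp
  | insert e F he ih =>
    have hcard : (F.card : ℝ) + 1 ≤ k := by
      rw [card_insert_of_notMem he] at hFk
      exact_mod_cast hFk
    have ih := ih (by linarith) fun e he => hF e (mem_insert_of_mem he)
    have hed := hF e (mem_insert_self _ _)
    induction e using Sym2.inductionOn with
    | hf u v =>
    have huv : u ≠ v := by simpa using hed
    set X := SimpleGraph.fromEdgeSet (F : Set (Sym2 V))
    have hX : ¬ X.Adj u v := by simp [X, he]
    have hdeg : ∀ j, ((nbrs X j).card : ℝ) ≤ k := by
      intro j
      have : (nbrs X j).card ≤ F.card := by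
        refine card_le_card_of_injOn (fun w => s(j, w)) ?_ ?_
        · intro w hw
          have := mem_nbrs.1 (mem_coe.1 hw)
          simpa [X] using this.1
        · intro a _ b _ h
          exact Sym2.congr_right.1 h
      have : ((nbrs X j).card : ℝ) ≤ F.card := by exact_mod_cast this
      linarith
    have h1 := card_edge_le d X huv hX T hd hD hdeg hL hQ hQL hT hn
    have h2 : degFam d (SimpleGraph.fromEdgeSet ((insert s(u, v) F : Finset (Sym2 V)) :
        Set (Sym2 V))) = (degFam d X).filter fun G => G.Adj u v := by
      ext G
      simp only [mem_filter, mem_degFam, and_assoc]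
      refine and_congr_right fun _ => ?_
      simp only [X, SimpleGraph.le_iff_adj, SimpleGraph.fromEdgeSet_adj, coe_insert,
        Set.mem_insert_iff, mem_coe]
      constructor
      · exact fun h => ⟨fun a b hab => h a b ⟨Or.inr hab.1, hab.2⟩, h u v ⟨Or.inl rfl, huv⟩⟩
      · rintro ⟨h, hu⟩ a b ⟨hab | hab, hne⟩
        · rcases Sym2.eq_iff.1 hab with ⟨rfl, rfl⟩ | ⟨rfl, rfl⟩
          · exact hu
          · exact hu.symm
        · exact h a b ⟨hab, hne⟩
    rw [h2, card_insert_of_notMem he, pow_succ]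
    calc _ ≤ p * (degFam d X).card :=
          h1.trans (mul_le_mul_of_nonneg_right hp (Nat.cast_nonneg _))
      _ ≤ p * (p ^ F.card * (degFam d ⊥).card) := mul_le_mul_of_nonneg_left ih hp0
      _ = _ := by ring

/-- Markov's inequality for the `k`-th binomial moment of the number of edges in `S`. -/
lemma card_tail_mul_le (d : V → ℕ) (S : Finset (Sym2 V)) (k : ℕ) {p R : ℝ} (hp0 : 0 ≤ p)
    (hkR : k ≤ R)
    (hp : ∀ F ⊆ S, F.card = k → ((degFam d (SimpleGraph.fromEdgeSet (F : Set (Sym2 V)))).card : ℝ) ≤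
      p ^ F.card * (degFam d ⊥).card) :
    (((degFam d ⊥).filter fun G => R ≤ ((S.filter (· ∈ G.edgeSet)).card : ℝ)).card : ℝ) *
      (R - k) ^ k ≤ (p * S.card) ^ k * (degFam d ⊥).card := by
  set N := degFam d ⊥
  set B := N.filter fun G => R ≤ ((S.filter (· ∈ G.edgeSet)).card : ℝ)
  have hdc := sum_card_bipartiteAbove_eq_sum_card_bipartiteBelow
    (fun (G : SimpleGraph V) (F : Finset (Sym2 V)) => ∀ e ∈ F, e ∈ G.edgeSet)
    (s := N) (t := powersetCard k S)
  have habove : ∀ G ∈ N, ((powersetCard k S).bipartiteAbove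
      (fun (G : SimpleGraph V) (F : Finset (Sym2 V)) => ∀ e ∈ F, e ∈ G.edgeSet) G).card =
      (S.filter (· ∈ G.edgeSet)).card.choose k := by
    intro G _
    rw [← card_powersetCard]
    congr 1
    ext F
    simp only [mem_bipartiteAbove, mem_powersetCard, subset_iff, mem_filter]
    grind
  rw [sum_congr rfl habove] at hdc
  have hbelow : ∀ F ∈ powersetCard k S, ((N.bipartiteBelow
      (fun (G : SimpleGraph V) (F : Finset (Sym2 V)) => ∀ e ∈ F, e ∈ G.edgeSet) F).card : ℝ) ≤
      p ^ k * N.card := by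
    intro F hF
    rw [mem_powersetCard] at hF
    have h := hp F hF.1 hF.2
    rw [hF.2] at h
    refine le_trans ?_ h
    refine Nat.cast_le.2 (card_le_card fun G hG => ?_)
    rw [mem_bipartiteBelow, mem_degFam] at hG
    rw [mem_degFam]
    refine ⟨hG.1.1, fun a b hab => ?_⟩
    rw [SimpleGraph.fromEdgeSet_adj] at hab
    exact hG.2 _ hab.1
  have h1 : ∑ G ∈ N, ((S.filter (· ∈ G.edgeSet)).card.choose k : ℝ) ≤
      S.card.choose k * (p ^ k * N.card) := by
    have := sum_le_card_nsmul _ _ _ hbelow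
    rw [card_powersetCard, nsmul_eq_mul] at this
    refine le_trans (le_of_eq ?_) this
    exact_mod_cast hdc
  have h2 : (B.card : ℝ) * ((R - k) ^ k / k.factorial) ≤
      ∑ G ∈ B, ((S.filter (· ∈ G.edgeSet)).card.choose k : ℝ) := by
    rw [← nsmul_eq_mul]
    refine card_nsmul_le_sum _ _ _ fun G hG => ?_
    have hR := (mem_filter.1 hG).2
    set c := (S.filter (· ∈ G.edgeSet)).card
    have hkc : k ≤ c := by exact_mod_cast hkR.trans hR
    rw [div_le_iff₀ (by positivity)]
    have e1 := Nat.pow_sub_le_descFactorial c k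
    rw [Nat.descFactorial_eq_factorial_mul_choose, mul_comm] at e1
    have e2 : ((c + 1 - k : ℕ) : ℝ) ^ k ≤ (c.choose k : ℝ) * k.factorial := by exact_mod_cast e1
    refine (pow_le_pow_left₀ (by linarith) ?_ k).trans e2
    rw [Nat.cast_sub (by omega)]
    push_cast
    linarith
  have h3 : ∑ G ∈ B, ((S.filter (· ∈ G.edgeSet)).card.choose k : ℝ) ≤
      ∑ G ∈ N, ((S.filter (· ∈ G.edgeSet)).card.choose k : ℝ) :=
    sum_le_sum_of_subset_of_nonneg (filter_subset _ _) fun _ _ _ => Nat.cast_nonneg _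
  have h4 : (S.card.choose k : ℝ) * k.factorial ≤ (S.card : ℝ) ^ k := by
    have e1 := Nat.descFactorial_le_pow S.card k
    rw [Nat.descFactorial_eq_factorial_mul_choose, mul_comm] at e1
    exact_mod_cast e1
  have h5 := (h2.trans h3).trans h1
  have hf : (0 : ℝ) < k.factorial := by positivity
  calc (B.card : ℝ) * (R - k) ^ k = (B.card : ℝ) * ((R - k) ^ k / k.factorial) * k.factorial := by
        field_simp
    _ ≤ S.card.choose k * (p ^ k * N.card) * k.factorial := mul_le_mul_of_nonneg_right h5 hf.le
    _ = (S.card.choose k * k.factorial) * (p ^ k * N.card) := by ring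
    _ ≤ (S.card : ℝ) ^ k * (p ^ k * N.card) := mul_le_mul_of_nonneg_right h4 (by positivity)
    _ = _ := by rw [mul_pow]; ring

/-- Exponential upper tail bound for the number of edges in `S`. -/
lemma card_upper_tail_le (d : V → ℕ) (S : Finset (Sym2 V)) (k : ℕ) {p q τ : ℝ} (hp0 : 0 ≤ p)
    (hτ : 0 < τ) (hq0 : 0 ≤ q) (hq : q + τ ≤ 2) (hpq : p ≤ q + τ / 4) (hS : 0 < S.card)
    (hk : k ≤ τ / 4 * S.card)
    (hp : ∀ F ⊆ S, F.card = k → ((degFam d (SimpleGraph.fromEdgeSet (F : Set (Sym2 V)))).card : ℝ) ≤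
      p ^ F.card * (degFam d ⊥).card) :
    (((degFam d ⊥).filter fun G => (q + τ) * S.card ≤ ((S.filter (· ∈ G.edgeSet)).card : ℝ)).card
      : ℝ) ≤ Real.exp (-(τ * k / 4)) * (degFam d ⊥).card := by
  have hS' : (0 : ℝ) < S.card := by exact_mod_cast hS
  have hkR : (k : ℝ) ≤ (q + τ) * S.card :=
    hk.trans (mul_le_mul_of_nonneg_right (by linarith) hS'.le)
  have key := card_tail_mul_le d S k hp0 hkR hp
  have hR : (q + 3 * τ / 4) * S.card ≤ (q + τ) * S.card - k := by linarith
  have hpos : 0 < (q + 3 * τ / 4) * S.card := by positivity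
  have hpos' : 0 < (q + τ) * S.card - k := hpos.trans_le hR
  have h1 : p * S.card ≤ Real.exp (-(τ / 4)) * ((q + τ) * S.card - k) := by
    have e1 := Real.add_one_le_exp (-(τ / 4))
    calc p * S.card ≤ (-(τ / 4) + 1) * ((q + 3 * τ / 4) * S.card) := by
          rw [← mul_assoc]
          refine mul_le_mul_of_nonneg_right ?_ hS'.le
          nlinarith
      _ ≤ Real.exp (-(τ / 4)) * ((q + 3 * τ / 4) * S.card) :=
          mul_le_mul_of_nonneg_right e1 hpos.le
      _ ≤ _ := mul_le_mul_of_nonneg_left hR (Real.exp_pos _).le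
  have h2 : (p * S.card) ^ k ≤ Real.exp (-(τ * k / 4)) * ((q + τ) * S.card - k) ^ k := by
    refine (pow_le_pow_left₀ (by positivity) h1 k).trans (le_of_eq ?_)
    rw [mul_pow, ← Real.exp_nat_mul]
    congr 2
    ring
  refine le_of_mul_le_mul_right ?_ (pow_pos hpos' k)
  refine key.trans ((mul_le_mul_of_nonneg_right h2 (Nat.cast_nonneg _)).trans (le_of_eq ?_))
  ring

end Switching

lemma eventually_mul_rpow_le (K : ℝ) {α β : ℝ} (h : α < β) :
    ∀ᶠ n : ℕ in atTop, K * (n : ℝ) ^ α ≤ (n : ℝ) ^ β := by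
  have h1 := (tendsto_rpow_atTop (sub_pos.2 h)).comp tendsto_natCast_atTop_atTop
  filter_upwards [h1.eventually_ge_atTop K, eventually_gt_atTop 0] with n hn hn0
  have hn0' : (0 : ℝ) < n := by exact_mod_cast hn0
  simp only [Function.comp_apply] at hn
  calc K * (n : ℝ) ^ α ≤ (n : ℝ) ^ (β - α) * (n : ℝ) ^ α :=
        mul_le_mul_of_nonneg_right hn (by positivity)
    _ = (n : ℝ) ^ β := by rw [← Real.rpow_add hn0']; ring_nf

lemma eventually_log_le (K : ℝ) {β : ℝ} (h : 0 < β) :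
    ∀ᶠ n : ℕ in atTop, K * Real.log n ≤ (n : ℝ) ^ β := by
  have h1 := ((isLittleO_log_rpow_atTop h).comp_tendsto tendsto_natCast_atTop_atTop).bound
    (c := 1 / (|K| + 1)) (by positivity)
  filter_upwards [h1, eventually_ge_atTop 1] with n hn hn1
  have h2 : 0 ≤ Real.log n := Real.log_natCast_nonneg n
  simp only [Function.comp_apply, Real.norm_eq_abs] at hn
  rw [abs_of_nonneg h2, abs_of_nonneg (Real.rpow_nonneg (Nat.cast_nonneg n) β), div_mul_eq_mul_div, one_mul,
    le_div_iff₀ (by positivity)] at hn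
  nlinarith [le_abs_self K]

set_option maxHeartbeats 1000000 in
/-- The numerical parameters of the switching argument. -/
lemma eventually_exists_parameters {C c δ : ℝ} (hC : 0 ≤ C) (hc : 0 < c) (hδ0 : 0 < δ)
    (hδ1 : δ < 1 / 10) :
    ∀ᶠ n : ℕ in atTop, ∃ (k T : ℕ) (L Q : ℝ), (2 < n ∧ (k : ℝ) < T ∧
      T + 2 * (C * (n : ℝ) ^ ((1 : ℝ) / 2 + 1 / 20)) + 2 + k ≤ L ∧ 0 < Q) ∧
      (∀ D : ℝ, (n : ℝ) ^ (1 - δ / 4) ≤ D → (n : ℝ) ^ (1 - δ / 4) ≤ n - D - 1 →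
        D + C * (n : ℝ) ^ ((1 : ℝ) / 2 + 1 / 20) ≤ n ∧
        n * (Q + L) ≤ (D - C * (n : ℝ) ^ ((1 : ℝ) / 2 + 1 / 20)) *
          (n - D - C * (n : ℝ) ^ ((1 : ℝ) / 2 + 1 / 20)) ∧
        (D + C * (n : ℝ) ^ ((1 : ℝ) / 2 + 1 / 20)) / (n - 2) +
          (2 * (C * (n : ℝ) ^ ((1 : ℝ) / 2 + 1 / 20)) + 1 + k) / (T - k) + (L / Q) ^ 2 ≤
          D / (n - 1) + (n : ℝ) ^ (-(1 : ℝ) / 10 + 3 * δ / 4) / 4) ∧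
      (k : ℝ) ≤ (n : ℝ) ^ (-(1 : ℝ) / 10 + 3 * δ / 4) / 4 * (c * (n : ℝ) ^ ((1 : ℝ) / 5)) ∧
      (n : ℝ) ^ δ ≤ (n : ℝ) ^ (-(1 : ℝ) / 10 + 3 * δ / 4) * k / 4 := by
  filter_upwards [eventually_gt_atTop 4,
    eventually_mul_rpow_le 4 (show (3 : ℝ) / 20 < 7 / 10 by norm_num),
    eventually_mul_rpow_le (2 * C) (show (11 : ℝ) / 20 < 39 / 40 by norm_num),
    eventually_mul_rpow_le (16 * (2 * C + 6)) (show (7 : ℝ) / 10 < 39 / 40 by norm_num),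
    eventually_mul_rpow_le (4 * (2 * (C + 1) + 2 * (2 * C + 3) + (16 * (2 * C + 6)) ^ 2))
      (show -(3 : ℝ) / 20 < -1 / 10 by norm_num),
    eventually_mul_rpow_le (8 / c) (show 1 / 10 + δ / 2 < 1 / 10 + 3 * δ / 4 by linarith),
    eventually_mul_rpow_le 4 (show δ < 5 * δ / 4 by linarith)]
    with n hn h1 h2 h3 h4 h5 h6
  have hx4 : (4 : ℝ) < n := by exact_mod_cast hn
  set x := (n : ℝ)
  have hx0 : 0 < x := by linarith
  have hx1 : 1 ≤ x := by linarith
  have ep : (1 : ℝ) / 2 + 1 / 20 = 11 / 20 := by norm_num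
  rw [ep]
  set M := C * x ^ ((11 : ℝ) / 20)
  have hM0 : 0 ≤ M := by positivity
  have mono : ∀ {α β : ℝ}, α ≤ β → x ^ α ≤ x ^ β := fun h => Real.rpow_le_rpow_of_exponent_le hx1 h
  have one_le : ∀ {α : ℝ}, 0 ≤ α → 1 ≤ x ^ α := fun h => Real.one_le_rpow hx1 h
  have pos : ∀ α : ℝ, 0 < x ^ α := fun α => Real.rpow_pos_of_pos hx0 α
  set k := ⌈x ^ (1 / 10 + δ / 2)⌉₊
  set T := ⌈x ^ ((7 : ℝ) / 10)⌉₊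
  have k1 : x ^ (1 / 10 + δ / 2) ≤ k := Nat.le_ceil _
  have k2 : (k : ℝ) ≤ 2 * x ^ (1 / 10 + δ / 2) := by
    have := (Nat.ceil_lt_add_one (pos (1 / 10 + δ / 2)).le).le
    linarith [one_le (show 0 ≤ 1 / 10 + δ / 2 by linarith)]
  have k3 : (k : ℝ) ≤ 2 * x ^ ((3 : ℝ) / 20) := by
    linarith [mono (show 1 / 10 + δ / 2 ≤ (3 : ℝ) / 20 by linarith)]
  have T1 : x ^ ((7 : ℝ) / 10) ≤ T := Nat.le_ceil _
  have T2 : (T : ℝ) ≤ 2 * x ^ ((7 : ℝ) / 10) := by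
    have := (Nat.ceil_lt_add_one (pos ((7 : ℝ) / 10)).le).le
    linarith [one_le (show (0 : ℝ) ≤ 7 / 10 by norm_num)]
  have TK : x ^ ((7 : ℝ) / 10) / 2 ≤ T - k := by linarith
  have hM7 : M ≤ C * x ^ ((7 : ℝ) / 10) :=
    mul_le_mul_of_nonneg_left (mono (by norm_num)) hC
  set L := (2 * C + 6) * x ^ ((7 : ℝ) / 10)
  set q := x ^ ((39 : ℝ) / 40)
  have hq0 : 0 < q := pos _
  have hQ0 : 0 < q / 16 := by positivity
  refine ⟨k, T, L, q / 16, ⟨by omega, ?_, ?_, hQ0⟩, ?_, ?_, ?_⟩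
  · linarith [pos ((7 : ℝ) / 10)]
  · have := one_le (show (0 : ℝ) ≤ 7 / 10 by norm_num)
    have e : L = 2 * (C * x ^ ((7 : ℝ) / 10)) + 6 * x ^ ((7 : ℝ) / 10) := by ring
    rw [e]
    linarith
  · intro D hD1 hD2
    have hqD : q ≤ D := (mono (by linarith)).trans hD1
    have hqD' : q ≤ x - D - 1 := (mono (by linarith)).trans hD2
    have hMq : M ≤ q / 2 := by
      have : 2 * C * x ^ ((11 : ℝ) / 20) = 2 * M := by ring
      linarith
    have hLq : L ≤ q / 16 := by
      have : 16 * (2 * C + 6) * x ^ ((7 : ℝ) / 10) = 16 * L := by ring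
      linarith
    refine ⟨by linarith, ?_, ?_⟩
    · have e1 : (D / 2) * ((x - D) / 2) ≤ (D - M) * (x - D - M) :=
        mul_le_mul (by linarith) (by linarith) (by linarith) (by linarith)
      have e2 : x * (q / 16 + L) ≤ x * (q / 8) := mul_le_mul_of_nonneg_left (by linarith) hx0.le
      refine e2.trans (le_trans ?_ e1)
      rcases le_total D (x / 2) with h | h
      · nlinarith [mul_le_mul hqD (show x / 2 ≤ x - D by linarith) (by positivity) (by linarith)]
      · nlinarith [mul_le_mul h (show q ≤ x - D by linarith) hq0.le (by linarith)]
    · have hz : x ^ (-(3 : ℝ) / 20) ≤ 1 := Real.rpow_le_one_of_one_le_of_nonpos hx1 (by norm_num)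
      have a1 : (D + M) / (x - 2) ≤ D / (x - 1) + 2 * (C + 1) * x ^ (-(3 : ℝ) / 20) := by
        have b1 : (D + M) / (x - 2) - D / (x - 1) ≤ (M + 1) / (x - 2) := by
          have p1 : 0 < x - 2 := by linarith
          have p2 : 0 < x - 1 := by linarith
          rw [div_sub_div _ _ p1.ne' p2.ne', div_le_div_iff₀ (by positivity) p1]
          nlinarith [mul_nonneg p1.le (show 0 ≤ x - 1 - D by linarith)]
        have b2 : (M + 1) / (x - 2) ≤ 2 * (C + 1) * x ^ (-(3 : ℝ) / 20) := by
          rw [div_le_iff₀ (by linarith)]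
          have c1 : x ^ (-(3 : ℝ) / 20) * x = x ^ ((17 : ℝ) / 20) := by
            rw [← Real.rpow_add_one hx0.ne']; norm_num
          have c2 : M ≤ C * x ^ ((17 : ℝ) / 20) :=
            mul_le_mul_of_nonneg_left (mono (by norm_num)) hC
          have c3 := one_le (show (0 : ℝ) ≤ 17 / 20 by norm_num)
          have c4 : 0 ≤ (C + 1) * x ^ (-(3 : ℝ) / 20) := by have := pos (-(3 : ℝ) / 20); positivity
          calc M + 1 ≤ (C + 1) * x ^ ((17 : ℝ) / 20) := by linarith
            _ = (C + 1) * x ^ (-(3 : ℝ) / 20) * x := by rw [← c1]; ring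
            _ ≤ (C + 1) * x ^ (-(3 : ℝ) / 20) * (2 * (x - 2)) :=
              mul_le_mul_of_nonneg_left (by linarith) c4
            _ = _ := by ring
        linarith
      have a2 : (2 * M + 1 + k) / (T - k) ≤ 2 * (2 * C + 3) * x ^ (-(3 : ℝ) / 20) := by
        rw [div_le_iff₀ (by linarith [pos ((7 : ℝ) / 10)])]
        have c1 : x ^ (-(3 : ℝ) / 20) * x ^ ((7 : ℝ) / 10) = x ^ ((11 : ℝ) / 20) := by
          rw [← Real.rpow_add hx0]; norm_num
        have c3 := one_le (show (0 : ℝ) ≤ 11 / 20 by norm_num)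
        have c5 := mono (show (3 : ℝ) / 20 ≤ 11 / 20 by norm_num)
        have c4 : 0 ≤ (2 * C + 3) * x ^ (-(3 : ℝ) / 20) := by
          have := pos (-(3 : ℝ) / 20); positivity
        calc 2 * M + 1 + k ≤ (2 * C + 3) * x ^ ((11 : ℝ) / 20) := by
              have : (2 * C + 3) * x ^ ((11 : ℝ) / 20) = 2 * M + 3 * x ^ ((11 : ℝ) / 20) := by ring
              linarith
          _ = (2 * C + 3) * x ^ (-(3 : ℝ) / 20) * x ^ ((7 : ℝ) / 10) := by rw [← c1]; ring
          _ ≤ (2 * C + 3) * x ^ (-(3 : ℝ) / 20) * (2 * (T - k)) :=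
            mul_le_mul_of_nonneg_left (by linarith) c4
          _ = _ := by ring
      have a3 : (L / (q / 16)) ^ 2 ≤ (16 * (2 * C + 6)) ^ 2 * x ^ (-(3 : ℝ) / 20) := by
        have c1 : L / (q / 16) = 16 * (2 * C + 6) * x ^ (-(11 : ℝ) / 40) := by
          have : x ^ (-(11 : ℝ) / 40) = x ^ ((7 : ℝ) / 10) / q := by
            rw [← Real.rpow_sub hx0]; norm_num
          rw [this]
          simp only [L]
          field_simp
        rw [c1, mul_pow]
        refine mul_le_mul_of_nonneg_left ?_ (by positivity)
        rw [← Real.rpow_natCast, ← Real.rpow_mul hx0.le]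
        exact mono (by norm_num)
      have a4 : x ^ (-(1 : ℝ) / 10) ≤ x ^ (-(1 : ℝ) / 10 + 3 * δ / 4) := mono (by linarith)
      nlinarith
  · have e : x ^ (-(1 : ℝ) / 10 + 3 * δ / 4) * x ^ ((1 : ℝ) / 5) = x ^ (1 / 10 + 3 * δ / 4) := by
      rw [← Real.rpow_add hx0]; ring_nf
    rw [div_mul_eq_mul_div, div_le_iff₀ hc] at h5
    calc (k : ℝ) ≤ x ^ (1 / 10 + 3 * δ / 4) * c / 4 := by linarith
      _ = _ := by rw [← e]; ring
  · have e : x ^ (-(1 : ℝ) / 10 + 3 * δ / 4) * x ^ (1 / 10 + δ / 2) = x ^ (5 * δ / 4) := by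
      rw [← Real.rpow_add hx0]; ring_nf
    have := mul_le_mul_of_nonneg_left k1 (pos (-(1 : ℝ) / 10 + 3 * δ / 4)).le
    rw [e] at this
    linarith

section Assembly

variable {V : Type*} [Fintype V]

lemma nbrs_compl (G : SimpleGraph V) (v : V) : nbrs Gᶜ v = (insert v (nbrs G v))ᶜ := by
  ext w
  simp only [mem_nbrs, SimpleGraph.compl_adj, mem_compl, mem_insert]
  grind

lemma card_nbrs_compl (G : SimpleGraph V) (v : V) :
    (nbrs Gᶜ v).card = Fintype.card V - 1 - (nbrs G v).card := by
  rw [nbrs_compl, card_compl, card_insert_of_notMem (by simp)]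
  omega

lemma card_nbrs_le (G : SimpleGraph V) (v : V) : (nbrs G v).card ≤ Fintype.card V - 1 := by
  have : (insert v (nbrs G v)).card ≤ Fintype.card V := card_le_univ _
  rw [card_insert_of_notMem (by simp)] at this
  omega

lemma card_degFam_compl_filter_le (d : V → ℕ) (P : SimpleGraph V → Prop) :
    ((degFam d ⊥).filter P).card ≤
      ((degFam (fun v => Fintype.card V - 1 - d v) ⊥).filter fun G => P Gᶜ).card := by
  refine card_le_card_of_injOn (fun G => Gᶜ) ?_ (compl_injective.injOn)
  intro G hG
  simp only [mem_coe, mem_filter, mem_degFam, bot_le, and_true, compl_compl] at hG ⊢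
  exact ⟨fun v => by rw [card_nbrs_compl, hG.1], hG.2⟩

lemma card_degFam_compl (d : V → ℕ) (hd : ∀ v, d v ≤ Fintype.card V - 1) :
    (degFam (fun v => Fintype.card V - 1 - d v) ⊥).card = (degFam d ⊥).card := by
  have h1 := card_degFam_compl_filter_le d fun _ => True
  have h2 := card_degFam_compl_filter_le (fun v => Fintype.card V - 1 - d v) fun _ => True
  have e : (fun v => Fintype.card V - 1 - (Fintype.card V - 1 - d v)) = d :=
    funext fun v => Nat.sub_sub_self (hd v)
  simp only [filter_true] at h1 h2
  rw [e] at h2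
  exact le_antisymm h2 h1

end Assembly

lemma card_neighborSet_eq {n : ℕ} (H : SimpleGraph (Fin n)) (v : Fin n) :
    Nat.card (H.neighborSet v) = (nbrs H v).card := by
  have : H.neighborSet v = (nbrs H v : Set (Fin n)) := by ext; simp
  rw [this, Nat.card_coe_set_eq, Set.ncard_coe_finset]

lemma natCard_degFam_filter {n : ℕ} (d : Fin n → ℕ) (P : SimpleGraph (Fin n) → Prop) :
    Nat.card {H : SimpleGraph (Fin n) // (∀ v, Nat.card (H.neighborSet v) = d v) ∧ P H} =
      ((degFam d ⊥).filter P).card := by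
  rw [Nat.card_eq_fintype_card, Fintype.card_subtype]
  congr 1
  ext H
  simp only [mem_filter, mem_univ, true_and, mem_degFam, card_neighborSet_eq, bot_le, and_true]

lemma gCount_bot {n : ℕ} (d : Fin n → ℕ) : gCount d ⊥ = (degFam d ⊥).card := by
  rw [gCount, natCard_degFam_filter d fun H => Disjoint H.edgeSet (⊥ : SimpleGraph (Fin n)).edgeSet]
  simp

lemma xEdges_eq {n : ℕ} (Y : SimpleGraph (Fin n)) : xEdges Y = Y.edgeFinset.card := by
  rw [xEdges, ← SimpleGraph.coe_edgeFinset, Nat.card_coe_set_eq, Set.ncard_coe_finset]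

lemma commonEdges_eq {n : ℕ} (H Y : SimpleGraph (Fin n)) :
    commonEdges H Y = (Y.edgeFinset.filter (· ∈ H.edgeSet)).card := by
  have : (H.edgeSet ∩ Y.edgeSet : Set (Sym2 (Fin n))) =
      ((Y.edgeFinset.filter (· ∈ H.edgeSet) : Finset (Sym2 (Fin n))) : Set (Sym2 (Fin n))) := by
    ext e; simp [and_comm]
  rw [commonEdges, this, Nat.card_coe_set_eq, Set.ncard_coe_finset]

lemma commonEdges_add_compl {n : ℕ} (H Y : SimpleGraph (Fin n)) :
    commonEdges H Y + commonEdges Hᶜ Y = xEdges Y := by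
  rw [commonEdges_eq, commonEdges_eq, xEdges_eq,
    ← card_filter_add_card_filter_not (s := Y.edgeFinset) (· ∈ H.edgeSet)]
  congr 2
  ext e
  simp only [mem_filter]
  refine and_congr_right fun he => ?_
  rw [SimpleGraph.mem_edgeFinset] at he
  induction e using Sym2.inductionOn with
  | hf u v => simp [(Y.mem_edgeSet.1 he).ne]

/-- Upper tail bound under the numerical conditions provided by `eventually_exists_parameters`. -/
lemma card_commonEdges_ge_le {n : ℕ} (d : Fin n → ℕ) (Y : SimpleGraph (Fin n))
    {D M L Q τ₀ τ : ℝ} {k T : ℕ} (hd : ∀ j, |(d j : ℝ) - D| ≤ M) (hM : 0 ≤ M)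
    (hn : 2 < n) (hT : (k : ℝ) < T)
    (hL : T + 2 * M + 2 + k ≤ L) (hQ : 0 < Q) (hD0 : 0 ≤ D) (hDn : D ≤ n - 1) (hDM : D + M ≤ n)
    (hQL : n * (Q + L) ≤ (D - M) * (n - D - M))
    (hp : (D + M) / (n - 2) + (2 * M + 1 + k) / (T - k) + (L / Q) ^ 2 ≤ D / (n - 1) + τ₀ / 4)
    (hτ₀ : 0 < τ₀) (hτ : τ₀ ≤ τ) (hτ1 : τ ≤ 1) (hY : 0 < xEdges Y)
    (hk : k ≤ τ₀ / 4 * xEdges Y) :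
    (((degFam d ⊥).filter fun G => (D / (n - 1) + τ) * xEdges Y ≤ (commonEdges G Y : ℝ)).card
      : ℝ) ≤ Real.exp (-(τ₀ * k / 4)) * (degFam d ⊥).card := by
  have hn' : (2 : ℝ) < n := by exact_mod_cast hn
  have hTk : 0 < (T : ℝ) - k := by linarith
  set p := (D + M) / ((n : ℝ) - 2) + (2 * M + 1 + k) / (T - k) + (L / Q) ^ 2
  have hn2 : 0 < (n : ℝ) - 2 := by linarith
  have hn1 : 0 < (n : ℝ) - 1 := by linarith
  have hp0 : 0 ≤ p := by positivity
  have hq1 : D / ((n : ℝ) - 1) ≤ 1 := by rw [div_le_one hn1]; exact hDn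
  have hY' : (0 : ℝ) < xEdges Y := by exact_mod_cast hY
  have key := card_upper_tail_le d Y.edgeFinset k (p := p) (q := D / (n - 1)) (τ := τ) hp0
    (by linarith) (by positivity) (by linarith) (by linarith) (by rwa [← xEdges_eq])
    (by
      rw [← xEdges_eq]
      exact hk.trans (mul_le_mul_of_nonneg_right (by linarith) hY'.le))
    (fun F hFY hF => card_superset_le d (D := D) (M := M) (k := k) (L := L) (Q := Q) T hd
      (by simpa using hDM) hL hQ (by simpa using hQL) hT (by simpa using hn) (by simp [p]) hp0 F
      (by rw [hF])
      (fun e he => Y.not_isDiag_of_mem_edgeFinset (hFY he)))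
  simp only [← xEdges_eq, ← commonEdges_eq] at key
  refine key.trans (mul_le_mul_of_nonneg_right ?_ (Nat.cast_nonneg _))
  refine Real.exp_le_exp.2 (neg_le_neg ?_)
  exact div_le_div_of_nonneg_right (mul_le_mul_of_nonneg_right hτ (Nat.cast_nonneg _)) (by norm_num)

/-- Corollary 2.7, second part: for `Y = Ω(n^{1/5})` edges and `δ ∈ (0,1/10)`,
with probability `1 - O(exp(-n^δ))` the number of common edges is
`λY(1 + O(n^{-1/10+δ}))`. -/
theorem stmt11 (a b : ℝ) (ha : 0 < a) (hb : 0 < b) (hab : a + b < 1/2) :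
    ∃ ε : ℝ, 0 < ε ∧
      ∀ (d : (n : ℕ) → Fin n → ℕ) (Y : (n : ℕ) → SimpleGraph (Fin n)),
        (∀ n, Even (∑ j, d n j)) →
        (∃ C : ℝ, ∀ (n : ℕ) (j : Fin n),
            |(d n j : ℝ) - dBar (d n)| ≤ C * (n : ℝ) ^ ((1:ℝ)/2 + ε)) →
        (∀ᶠ n : ℕ in atTop,
            (n : ℝ) / (3 * a * Real.log n) ≤ min (dBar (d n)) ((n : ℝ) - dBar (d n) - 1)) →
        (∃ c : ℝ, 0 < c ∧ ∀ᶠ n : ℕ in atTop,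
            c * (n : ℝ) ^ ((1:ℝ)/5) ≤ (xEdges (Y n) : ℝ)) →
        ∀ δ : ℝ, 0 < δ → δ < 1/10 →
          ∃ C C' : ℝ, ∀ᶠ n : ℕ in atTop,
            (Nat.card {H : SimpleGraph (Fin n) //
                (∀ v, Nat.card (H.neighborSet v) = d n v) ∧
                ¬ |(commonEdges H (Y n) : ℝ) - lamb (d n) * (xEdges (Y n) : ℝ)|
                    ≤ C * (lamb (d n) * (xEdges (Y n) : ℝ) * (n : ℝ) ^ (-(1:ℝ)/10 + δ))} : ℝ)
              / (gCount (d n) ⊥ : ℝ)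
            ≤ C' * Real.exp (-(n : ℝ) ^ δ) := by
  refine ⟨1 / 20, by norm_num, ?_⟩
  rintro d Y - ⟨C₀, hC₀⟩ hmin ⟨c, hc, hY⟩ δ hδ0 hδ1
  set C := max C₀ 0
  have hC : 0 ≤ C := le_max_right _ _
  refine ⟨1, 2, ?_⟩
  filter_upwards [hmin, hY, eventually_exists_parameters hC hc hδ0 hδ1,
    eventually_log_le (3 * a) (show 0 < δ / 4 by linarith)] with n hn hYn hpar hlog
  obtain ⟨k, T, L, Q, ⟨hn2, hT, hL, hQ⟩, hDpar, hk, hexp⟩ := hpar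
  set M := C * (n : ℝ) ^ ((1 : ℝ) / 2 + 1 / 20)
  have hn2' : (2 : ℝ) < n := by exact_mod_cast hn2
  have hn0 : (0 : ℝ) < n := by linarith
  have hM : 0 ≤ M := by positivity
  have hd : ∀ j, |(d n j : ℝ) - dBar (d n)| ≤ M := fun j =>
    (hC₀ n j).trans (mul_le_mul_of_nonneg_right (le_max_left _ _) (by positivity))
  set D := dBar (d n)
  have hlog0 : 0 < Real.log n := Real.log_pos (by linarith)
  have hq0 : (n : ℝ) ^ (1 - δ / 4) ≤ min D (n - D - 1) := by
    refine le_trans ?_ hn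
    rw [le_div_iff₀ (by positivity)]
    calc (n : ℝ) ^ (1 - δ / 4) * (3 * a * Real.log n)
        ≤ (n : ℝ) ^ (1 - δ / 4) * (n : ℝ) ^ (δ / 4) :=
          mul_le_mul_of_nonneg_left hlog (by positivity)
      _ = n := by rw [← Real.rpow_add hn0]; simp
  have hD1 := hq0.trans (min_le_left _ _)
  have hD2 := hq0.trans (min_le_right _ _)
  have hqpos : 0 < (n : ℝ) ^ (1 - δ / 4) := Real.rpow_pos_of_pos hn0 _
  have hn1 : 0 < (n : ℝ) - 1 := by linarith
  set lam := lamb (d n) with hlam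
  have hlam' : lam = D / (n - 1) := rfl
  set τ₀ := (n : ℝ) ^ (-(1 : ℝ) / 10 + 3 * δ / 4)
  have hτ₀ : 0 < τ₀ := Real.rpow_pos_of_pos hn0 _
  set τ := lam * (n : ℝ) ^ (-(1 : ℝ) / 10 + δ)
  have hlam1 : lam ≤ 1 := by rw [hlam', div_le_one hn1]; linarith
  have hlam0 : (n : ℝ) ^ (-(δ / 4)) ≤ lam := by
    rw [hlam', le_div_iff₀ hn1]
    refine le_trans ?_ hD1
    have : (n : ℝ) ^ (1 - δ / 4) = (n : ℝ) ^ (-(δ / 4)) * n := by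
      rw [← Real.rpow_add_one hn0.ne']; ring_nf
    rw [this]
    exact mul_le_mul_of_nonneg_left (by linarith) (by positivity)
  have hτ : τ₀ ≤ τ := by
    have : τ₀ = (n : ℝ) ^ (-(δ / 4)) * (n : ℝ) ^ (-(1 : ℝ) / 10 + δ) := by
      rw [← Real.rpow_add hn0]; simp only [τ₀]; ring_nf
    rw [this]
    exact mul_le_mul_of_nonneg_right hlam0 (by positivity)
  have hτ1 : τ ≤ 1 := by
    refine mul_le_one₀ hlam1 (by positivity) ?_
    exact Real.rpow_le_one_of_one_le_of_nonpos (by linarith) (by linarith)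
  have hYpos : (0 : ℝ) < xEdges (Y n) :=
    lt_of_lt_of_le (mul_pos hc (Real.rpow_pos_of_pos hn0 _)) hYn
  have hYpos' : 0 < xEdges (Y n) := by exact_mod_cast hYpos
  have hk' : (k : ℝ) ≤ τ₀ / 4 * xEdges (Y n) :=
    hk.trans (mul_le_mul_of_nonneg_left hYn (by positivity))
  have hexp' : Real.exp (-(τ₀ * k / 4)) ≤ Real.exp (-(n : ℝ) ^ δ) :=
    Real.exp_le_exp.2 (neg_le_neg hexp)
  rw [gCount_bot, natCard_degFam_filter]
  set N := degFam (d n) ⊥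
  rcases N.eq_empty_or_nonempty with hN | ⟨G₀, hG₀⟩
  · rw [hN]
    simp only [card_empty, Nat.cast_zero, div_zero]
    positivity
  have hdn : ∀ v, d n v ≤ Fintype.card (Fin n) - 1 := fun v => by
    rw [← (mem_degFam.1 hG₀).1 v]
    exact card_nbrs_le _ _
  rw [div_le_iff₀ (by exact_mod_cast card_pos.2 ⟨G₀, hG₀⟩)]
  set P : SimpleGraph (Fin n) → Prop := fun H =>
    (D / (n - 1) + τ) * xEdges (Y n) ≤ (commonEdges H (Y n) : ℝ)
  set P' : SimpleGraph (Fin n) → Prop := fun H =>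
    ((n - 1 - D) / (n - 1) + τ) * xEdges (Y n) ≤ (commonEdges Hᶜ (Y n) : ℝ)
  have hupper : ((N.filter P).card : ℝ) ≤ Real.exp (-(n : ℝ) ^ δ) * N.card := by
    obtain ⟨h1, h2, h3⟩ := hDpar D hD1 hD2
    exact (card_commonEdges_ge_le (d n) (Y n) hd hM hn2 hT hL hQ (by linarith) (by linarith) h1 h2
      h3 hτ₀ hτ hτ1 hYpos' hk').trans (mul_le_mul_of_nonneg_right hexp' (Nat.cast_nonneg _))
  have hlower : ((N.filter P').card : ℝ) ≤ Real.exp (-(n : ℝ) ^ δ) * N.card := by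
    obtain ⟨h1, h2, h3⟩ := hDpar (n - 1 - D) (by linarith) (by linarith)
    have hd' : ∀ j, |((Fintype.card (Fin n) - 1 - d n j : ℕ) : ℝ) - (n - 1 - D)| ≤ M := by
      intro j
      rw [Nat.cast_sub (hdn j), Nat.cast_sub (by simp; omega), ← abs_neg]
      simp only [Fintype.card_fin]
      convert hd j using 2
      push_cast
      ring
    have h := card_commonEdges_ge_le (fun j => Fintype.card (Fin n) - 1 - d n j) (Y n) hd' hM hn2
      hT hL hQ (by linarith) (by linarith) h1 h2 h3 hτ₀ hτ hτ1 hYpos' hk'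
    rw [card_degFam_compl _ hdn] at h
    have h4 := card_degFam_compl_filter_le (d n) P'
    simp only [P', compl_compl] at h4
    exact (Nat.cast_le.2 h4).trans
      (h.trans (mul_le_mul_of_nonneg_right hexp' (Nat.cast_nonneg _)))
  have hsub : (N.filter fun H => ¬ |(commonEdges H (Y n) : ℝ) - lam * (xEdges (Y n) : ℝ)|
      ≤ 1 * (lam * (xEdges (Y n) : ℝ) * (n : ℝ) ^ (-(1 : ℝ) / 10 + δ))) ⊆
      N.filter P ∪ N.filter P' := by
    intro H hH
    simp only [mem_filter, mem_union] at hH ⊢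
    obtain ⟨hHN, hH⟩ := hH
    have e1 : 1 * (lam * (xEdges (Y n) : ℝ) * (n : ℝ) ^ (-(1 : ℝ) / 10 + δ)) =
        τ * xEdges (Y n) := by ring
    rw [e1, not_le, lt_abs] at hH
    rcases hH with h | h
    · refine Or.inl ⟨hHN, ?_⟩
      simp only [P]
      rw [← hlam']
      linarith
    · refine Or.inr ⟨hHN, ?_⟩
      simp only [P']
      have e2 : (commonEdges H (Y n) : ℝ) + commonEdges Hᶜ (Y n) = xEdges (Y n) := by
        exact_mod_cast commonEdges_add_compl H (Y n)
      have e3 : ((n : ℝ) - 1 - D) / (n - 1) = 1 - lam := by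
        rw [hlam', sub_div, div_self hn1.ne']
      rw [e3]
      linarith
  have hcard := (card_le_card hsub).trans (card_union_le _ _)
  have hcard' : ((N.filter fun H => ¬ |(commonEdges H (Y n) : ℝ) - lam * (xEdges (Y n) : ℝ)|
      ≤ 1 * (lam * (xEdges (Y n) : ℝ) * (n : ℝ) ^ (-(1 : ℝ) / 10 + δ))).card : ℝ) ≤
      (N.filter P).card + (N.filter P').card := by exact_mod_cast hcard
  linarith
end
end
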